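/- Let n ≥ 2 and let B ⊂ ℝ^{n+1} be a convex body containing the origin in its interior. If all hyperplane sections of B through the origin are similar to one another (for any two n-dimensional linear subspaces H₁, H₂ of ℝ^{n+1} there is a similarity transformation of ℝ^{n+1} carrying B ∩ H₁ onto B ∩ H₂), then B is a closed Euclidean ball (not necessarily centered at the origin). -/

import Mathlib

open Metric

namespace SimilarSections

open Filter Topology

theorem exists_quadratic_bound {X Y : Type*} [NormedAddCommGroup X] [NormedSpace ℝ X]
    [NormedAddCommGroup Y] [NormedSpace ℝ Y] {F : X → Y} (hF : ContDiff ℝ 2 F) {K : Set X}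
    (hK : IsCompact K) (hc : Convex ℝ K) :
    ∃ M : ℝ, 0 ≤ M ∧ ∀ x ∈ K, ∀ y ∈ K, ‖F y - F x - fderiv ℝ F x (y - x)‖ ≤ M * ‖y - x‖ ^ 2 := by
  have h1 : ContDiff ℝ 1 (fderiv ℝ F) := hF.fderiv_right (by norm_num)
  obtain ⟨L, hL⟩ := h1.contDiffOn.exists_lipschitzOnWith (s := K) (by norm_num) hc hK
  refine ⟨L, L.2, fun x hx y hy => ?_⟩
  have hs : segment ℝ x y ⊆ K := hc.segment_subset hx hy
  have := Convex.norm_image_sub_le_of_norm_fderiv_le' (𝕜 := ℝ) (f := F) (s := segment ℝ x y)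
    (x := x) (y := y) (φ := fderiv ℝ F x) (C := L * ‖y - x‖)
    (fun z _ => (hF.differentiable (by norm_num)) z) ?_ (convex_segment x y)
    (left_mem_segment ℝ x y) (right_mem_segment ℝ x y)
  · calc _ ≤ L * ‖y - x‖ * ‖y - x‖ := this
      _ = _ := by ring
  · intro z hz
    calc _ ≤ L * ‖z - x‖ := by
            simpa [dist_eq_norm] using hL.dist_le_mul z (hs hz) x hx
      _ ≤ _ := by
        gcongr
        obtain ⟨a, b, ha, hb, hab, rfl⟩ := hz
        have : a • x + b • y - x = b • (y - x) := by
          rw [← sub_eq_iff_eq_add.2 hab.symm]; module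
        rw [this, norm_smul, Real.norm_of_nonneg hb]
        have : b ≤ 1 := by linarith
        nlinarith [norm_nonneg (y - x)]

theorem exp_mem_unitary_of_mem_skewAdjoint {R : Type*} [NormedRing R] [NormedAlgebra ℝ R]
    [CompleteSpace R] [StarRing R] [ContinuousStar R] {x : R} (h : x ∈ skewAdjoint R) :
    NormedSpace.exp x ∈ unitary R :=
  letI : NormedAlgebra ℚ R := NormedAlgebra.restrictScalars ℚ ℝ R
  NormedSpace.exp_mem_unitary_of_mem_skewAdjoint h

variable {V : Type*} [NormedAddCommGroup V] [InnerProductSpace ℝ V] [FiniteDimensional ℝ V]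

theorem norm_exp_apply {T : V →L[ℝ] V} (hT : T ∈ skewAdjoint (V →L[ℝ] V)) (u : V) :
    ‖(NormedSpace.exp T : V →L[ℝ] V) u‖ = ‖u‖ := by
  have h : (NormedSpace.exp T : V →L[ℝ] V) ∈ unitary (V →L[ℝ] V) :=
    exp_mem_unitary_of_mem_skewAdjoint hT
  exact ContinuousLinearMap.norm_map_of_mem_unitary h u

theorem contDiff_exp : ContDiff ℝ 2 (NormedSpace.exp : (V →L[ℝ] V) → V →L[ℝ] V) :=
  contDiff_iff_contDiffAt.2 fun x => (NormedSpace.exp_analytic (𝕂 := ℝ) x).contDiffAt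

theorem mem_unitary_of_norm_map {g : V →L[ℝ] V} (hg : ∀ u, ‖g u‖ = ‖u‖) :
    g ∈ unitary (V →L[ℝ] V) := by
  have h1 : star g * g = 1 := by
    have := (ContinuousLinearMap.norm_map_iff_adjoint_comp_self g).1 hg
    simpa [ContinuousLinearMap.star_eq_adjoint, ContinuousLinearMap.mul_def] using this
  have hinj : Function.Injective g.toLinearMap := by
    intro a b hab
    have : ‖g (a - b)‖ = 0 := by
      rw [map_sub]; simpa [sub_eq_zero] using hab
    rw [hg] at this
    simpa [sub_eq_zero] using this
  refine ⟨h1, ?_⟩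
  have hsurj := LinearMap.injective_iff_surjective.1 hinj
  ext x
  obtain ⟨y, rfl⟩ := hsurj x
  have := congrArg (fun f : V →L[ℝ] V => f y) h1
  simp only [mul_apply_eq_comp, one_apply_eq_self] at this
  simp [this]

theorem isCompact_unitary : IsCompact (unitary (V →L[ℝ] V) : Set (V →L[ℝ] V)) := by
  refine isCompact_of_isClosed_isBounded ?_ ?_
  · have : (unitary (V →L[ℝ] V) : Set (V →L[ℝ] V)) = {g | star g * g = 1} ∩ {g | g * star g = 1} := by
      ext g; simp [Unitary.mem_iff]
    rw [this]
    exact (isClosed_eq (by fun_prop) (by fun_prop)).inter (isClosed_eq (by fun_prop) (by fun_prop))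
  · refine (isBounded_iff_forall_norm_le).2 ⟨1, fun g hg => ?_⟩
    exact ContinuousLinearMap.opNorm_le_bound _ zero_le_one fun x => by
      rw [ContinuousLinearMap.norm_map_of_mem_unitary hg]; simp

end SimilarSections

namespace SimilarSections

open Filter Topology

variable {V : Type*} [NormedAddCommGroup V] [InnerProductSpace ℝ V] [FiniteDimensional ℝ V]

theorem apply_exp_eq_of_fderiv_eq_zero {f : V → ℝ} (hf : Differentiable ℝ f) {X : V →L[ℝ] V}
    (hX : X ∈ skewAdjoint (V →L[ℝ] V)) (h0 : ∀ u : V, ‖u‖ ≤ 1 → fderiv ℝ f u (X u) = 0) (t : ℝ)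
    (u : V) (hu : ‖u‖ ≤ 1) : f ((NormedSpace.exp (t • X) : V →L[ℝ] V) u) = f u := by
  have hskew : ∀ s : ℝ, s • X ∈ skewAdjoint (V →L[ℝ] V) := fun s => by
    rw [skewAdjoint.mem_iff] at hX ⊢
    simp [hX]
  have hd : ∀ s : ℝ, HasDerivAt (fun s : ℝ => f ((NormedSpace.exp (s • X) : V →L[ℝ] V) u)) 0 s := by
    intro s
    have h1 := hasDerivAt_exp_smul_const' (𝕂 := ℝ) X s
    have h2 := h1.clm_apply (hasDerivAt_const s u)
    have h3 := (hf ((NormedSpace.exp (s • X) : V →L[ℝ] V) u)).hasFDerivAt.comp_hasDerivAt s h2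
    refine h3.congr_deriv ?_
    have := h0 ((NormedSpace.exp (s • X) : V →L[ℝ] V) u) (by rw [norm_exp_apply (hskew s)]; exact hu)
    simpa using this
  have := is_const_of_deriv_eq_zero (fun s => (hd s).differentiableAt) (fun s => (hd s).deriv) t 0
  simpa using this

theorem exists_orbit_bound {f : V → ℝ} (hf : ContDiff ℝ 2 f) :
    ∃ C : ℝ, 0 < C ∧ ∀ g ∈ unitary (V →L[ℝ] V), ∀ δ : ℝ,
      (∀ u : V, ‖u‖ ≤ 1 → |f (g u) - f u| ≤ δ) →
      ∃ g' ∈ unitary (V →L[ℝ] V), (∀ u : V, ‖u‖ ≤ 1 → f (g' u) = f (g u)) ∧ ‖g' - 1‖ ≤ C * δ := by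
  by_contra! hcon
  choose g hgU δ hδ hg using fun k : ℕ => hcon (k + 1) (by positivity)
  have hdiff : Differentiable ℝ f := hf.differentiable (by norm_num)
  have hU : ∀ h ∈ unitary (V →L[ℝ] V), ∀ u : V, ‖u‖ ≤ 1 → ‖h u‖ ≤ 1 := fun h hh u hu => by
    rw [ContinuousLinearMap.norm_map_of_mem_unitary hh]; exact hu
  let S : ℕ → Set (V →L[ℝ] V) := fun k =>
    (unitary (V →L[ℝ] V) : Set _) ∩ {h | ∀ u : V, ‖u‖ ≤ 1 → f (h u) = f (g k u)}
  have hScl : ∀ k, IsCompact (S k) := fun k => by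
    refine isCompact_unitary.inter_right ?_
    simp only [Set.ofPred_forall]
    refine isClosed_iInter fun u => isClosed_iInter fun _ => isClosed_eq ?_ continuous_const
    exact hf.continuous.comp (by fun_prop)
  have hmin : ∀ k, ∃ m ∈ S k, ∀ h ∈ S k, ‖m - 1‖ ≤ ‖h - 1‖ := fun k => by
    obtain ⟨m, hm, hm'⟩ := (hScl k).exists_isMinOn (f := fun h => ‖h - 1‖) ⟨g k, hgU k, fun _ _ => rfl⟩
      (by fun_prop)
    exact ⟨m, hm, fun h hh => hm' hh⟩
  choose m hmS hmmin using hmin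
  have hδ0 : ∀ k, 0 ≤ δ k := fun k => (abs_nonneg _).trans (hδ k 0 (by simp))
  let d : ℕ → ℝ := fun k => ‖m k - 1‖
  have hdδ : ∀ k, (k + 1) * δ k < d k := fun k => hg k _ (hmS k).1 (hmS k).2
  have hd0 : ∀ k, 0 < d k := fun k =>
    lt_of_le_of_lt (mul_nonneg (by positivity) (hδ0 k)) (hdδ k)
  have hstab : ∀ k, ∀ s ∈ unitary (V →L[ℝ] V), (∀ u : V, ‖u‖ ≤ 1 → f (s u) = f u) →
      d k ≤ ‖s * m k - 1‖ := fun k s hs hsf => by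
    refine hmmin k _ ⟨mul_mem hs (hmS k).1, fun u hu => ?_⟩
    rw [mul_apply_eq_comp, hsf _ (hU _ (hmS k).1 u hu), (hmS k).2 u hu]
  let Y : ℕ → V →L[ℝ] V := fun k => (d k)⁻¹ • (m k - 1)
  have hY : ∀ k, ‖Y k‖ = 1 := fun k => by
    simp only [Y, norm_smul, norm_inv, Real.norm_of_nonneg (hd0 k).le]
    exact inv_mul_cancel₀ (hd0 k).ne'
  have hmY : ∀ k, m k = 1 + d k • Y k := fun k => by
    simp [Y, smul_smul, mul_inv_cancel₀ (hd0 k).ne']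
  obtain ⟨⟨M, X⟩, -, φ, hφ, hlim⟩ :=
    (isCompact_unitary.prod (isCompact_sphere (0 : V →L[ℝ] V) 1)).tendsto_subseq
      (x := fun k => (m k, Y k)) (fun k => ⟨(hmS k).1, by simp [hY]⟩)
  have hM : Tendsto (fun k => m (φ k)) atTop (𝓝 M) := (continuous_fst.tendsto _).comp hlim
  have hX : Tendsto (fun k => Y (φ k)) atTop (𝓝 X) := (continuous_snd.tendsto _).comp hlim
  have hMU : M ∈ unitary (V →L[ℝ] V) :=
    isCompact_unitary.isClosed.mem_of_tendsto hM (Eventually.of_forall fun k => (hmS _).1)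
  have hrat : ∀ k, δ k / d k ≤ 1 / ((k : ℝ) + 1) := fun k => by
    rw [div_le_div_iff₀ (hd0 k) (by positivity)]
    nlinarith [hdδ k]
  have hrat0 : Tendsto (fun k => δ (φ k) / d (φ k)) atTop (𝓝 0) :=
    squeeze_zero (fun k => div_nonneg (hδ0 _) (hd0 _).le) (fun k => hrat _)
      (tendsto_one_div_add_atTop_nhds_zero_nat.comp hφ.tendsto_atTop)
  have hd2 : ∀ k, d k ≤ 2 := fun k => by
    have h1 : ∀ h ∈ unitary (V →L[ℝ] V), ‖h‖ ≤ 1 := fun h hh =>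
      ContinuousLinearMap.opNorm_le_bound _ zero_le_one fun x => by
        rw [ContinuousLinearMap.norm_map_of_mem_unitary hh]; simp
    calc d k ≤ ‖m k‖ + ‖(1 : V →L[ℝ] V)‖ := norm_sub_le _ _
      _ ≤ 1 + 1 := add_le_add (h1 _ (hmS k).1) (h1 _ (one_mem _))
      _ = 2 := by norm_num
  have hδlim : Tendsto (fun k => δ (φ k)) atTop (𝓝 0) := by
    refine squeeze_zero (fun k => hδ0 _) (fun k => ?_) (by simpa using hrat0.mul_const 2)
    have := hd2 (φ k)
    calc δ (φ k) = δ (φ k) / d (φ k) * d (φ k) := (div_mul_cancel₀ _ (hd0 _).ne').symm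
      _ ≤ _ := mul_le_mul_of_nonneg_left this (div_nonneg (hδ0 _) (hd0 _).le)
  have hMf : ∀ u : V, ‖u‖ ≤ 1 → f (M u) = f u := fun u hu => by
    have h1 : Tendsto (fun k => f (m (φ k) u) - f u) atTop (𝓝 (f (M u) - f u)) := by
      refine Tendsto.sub_const ?_ _
      exact (hf.continuous.tendsto _).comp
        (((ContinuousLinearMap.apply ℝ V u).continuous.tendsto M).comp hM)
    have h2 : Tendsto (fun k => f (m (φ k) u) - f u) atTop (𝓝 0) := by
      refine squeeze_zero_norm (fun k => ?_) hδlim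
      rw [(hmS (φ k)).2 u hu]
      exact hδ _ u hu
    exact sub_eq_zero.1 (tendsto_nhds_unique h1 h2)
  have hdlim : Tendsto (fun k => d (φ k)) atTop (𝓝 0) := by
    have hMs : star M ∈ unitary (V →L[ℝ] V) := Unitary.star_mem hMU
    have h1 : ∀ k, d (φ k) ≤ ‖star M * m (φ k) - 1‖ := fun k => by
      refine hstab _ _ hMs fun u hu => ?_
      rw [← hMf _ (hU _ hMs u hu), ← mul_apply_eq_comp, hMU.2, one_apply_eq_self]
    refine squeeze_zero (fun k => (hd0 _).le) h1 ?_
    have h2 : Tendsto (fun k => ‖star M * m (φ k) - 1‖) atTop (𝓝 ‖star M * M - 1‖) :=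
      ((hM.const_mul (star M)).sub_const 1).norm
    rwa [hMU.1, sub_self, norm_zero] at h2
  have hXskew : X ∈ skewAdjoint (V →L[ℝ] V) := by
    rw [skewAdjoint.mem_iff]
    have h1 : ∀ k, star (Y k) + Y k + d k • (star (Y k) * Y k) = 0 := fun k => by
      have h := (hmS k).1.1
      rw [hmY k] at h
      simp only [star_add, star_one, star_smul, star_trivial, add_mul, mul_add, one_mul, mul_one,
        smul_mul_assoc, mul_smul_comm] at h
      have h' : d k • (star (Y k) + Y k + d k • (star (Y k) * Y k)) = 0 := by
        rw [add_assoc, add_eq_left] at h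
        rw [← h]; module
      exact (smul_eq_zero.1 h').resolve_left (hd0 k).ne'
    have hs : Tendsto (fun k => star (Y (φ k))) atTop (𝓝 (star X)) := hX.star
    have h2 := (hs.add hX).add (hdlim.smul (hs.mul hX))
    simp only [h1, zero_smul, add_zero] at h2
    exact eq_neg_of_add_eq_zero_left (tendsto_nhds_unique h2 tendsto_const_nhds)
  have hYu : ∀ u : V, Tendsto (fun k => Y (φ k) u) atTop (𝓝 (X u)) := fun u =>
    ((ContinuousLinearMap.apply ℝ V u).continuous.tendsto X).comp hX
  have hDf : ∀ u : V, ‖u‖ ≤ 1 → fderiv ℝ f u (X u) = 0 := fun u hu => by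
    have h1 := (hdiff u).hasFDerivAt.hasFDerivWithinAt (s := Set.univ).lim
      (c := fun k => (d (φ k))⁻¹) (d := fun k => d (φ k) • Y (φ k) u) (v := X u)
      (l := atTop) (by simpa using hdlim.smul (hYu u)) (Eventually.of_forall fun _ => Set.mem_univ _) ?_
    · refine tendsto_nhds_unique h1 (squeeze_zero_norm (fun k => ?_) hrat0)
      have h3 : u + d (φ k) • Y (φ k) u = m (φ k) u := by rw [hmY]; simp
      rw [h3, norm_smul, (hmS (φ k)).2 u hu, norm_inv, Real.norm_of_nonneg (hd0 _).le,
        div_eq_inv_mul]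
      exact mul_le_mul_of_nonneg_left (hδ _ u hu) (inv_nonneg.2 (hd0 _).le)
    · refine (hYu u).congr fun k => ?_
      rw [smul_smul, inv_mul_cancel₀ (hd0 _).ne', one_smul]
  have hexp : Tendsto (fun k => (d (φ k))⁻¹ • ((NormedSpace.exp ((- d (φ k)) • X) : V →L[ℝ] V) - 1))
      atTop (𝓝 (-X)) := by
    have h1 := (hasFDerivAt_exp_zero (𝕂 := ℝ) (𝔸 := V →L[ℝ] V)).hasFDerivWithinAt
      (s := Set.univ).lim (c := fun k => (d (φ k))⁻¹) (d := fun k => (-d (φ k)) • X) (v := -X)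
      (l := atTop) (by simpa using hdlim.neg.smul_const X) (Eventually.of_forall fun _ => Set.mem_univ _) ?_
    · simpa using h1
    · refine tendsto_const_nhds.congr fun k => ?_
      rw [smul_smul, mul_neg, inv_mul_cancel₀ (hd0 _).ne', neg_one_smul]
  have hfin : Tendsto (fun k => (d (φ k))⁻¹ •
      ((NormedSpace.exp ((- d (φ k)) • X) : V →L[ℝ] V) * m (φ k) - 1)) atTop (𝓝 0) := by
    have h1 := (hexp.add hX).add (hdlim.smul (hexp.mul hX))
    simp only [neg_add_cancel, zero_smul, add_zero] at h1
    refine h1.congr fun k => ?_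
    have h2 : d (φ k) * (d (φ k))⁻¹ = 1 := mul_inv_cancel₀ (hd0 _).ne'
    generalize (NormedSpace.exp ((- d (φ k)) • X) : V →L[ℝ] V) = Z
    have h3 := hmY (φ k)
    generalize Y (φ k) = y at h3 ⊢
    generalize d (φ k) = a at h2 h3 ⊢
    rw [h3, smul_mul_assoc, smul_smul, h2, one_smul, mul_add, mul_smul_comm, mul_one,
      add_sub_right_comm, smul_add, smul_smul, mul_comm a⁻¹ a, h2, one_smul, sub_mul, one_mul]
    abel
  have hge : ∀ k, 1 ≤ ‖(d (φ k))⁻¹ • ((NormedSpace.exp ((- d (φ k)) • X) : V →L[ℝ] V) * m (φ k) - 1)‖ := by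
    intro k
    rw [norm_smul, norm_inv, Real.norm_of_nonneg (hd0 _).le, ← div_eq_inv_mul, one_le_div (hd0 _)]
    have hsk : (- d (φ k)) • X ∈ skewAdjoint (V →L[ℝ] V) := by
      rw [skewAdjoint.mem_iff] at hXskew ⊢
      simp [hXskew]
    exact hstab _ _ (exp_mem_unitary_of_mem_skewAdjoint hsk)
      (fun u hu => apply_exp_eq_of_fderiv_eq_zero hdiff hXskew hDf _ u hu)
  have := ge_of_tendsto hfin.norm (Eventually.of_forall hge)
  rw [norm_zero] at this
  linarith

end SimilarSections

namespace SimilarSections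

open Filter Topology

variable {V : Type*} [NormedAddCommGroup V] [InnerProductSpace ℝ V] [FiniteDimensional ℝ V]

theorem norm_unitary_apply_le {h : V →L[ℝ] V} (hh : h ∈ unitary (V →L[ℝ] V)) {u : V}
    (hu : ‖u‖ ≤ 1) : ‖h u‖ ≤ 1 := by
  rwa [ContinuousLinearMap.norm_map_of_mem_unitary hh]

theorem norm_unitary_le_one {h : V →L[ℝ] V} (hh : h ∈ unitary (V →L[ℝ] V)) : ‖h‖ ≤ 1 :=
  ContinuousLinearMap.opNorm_le_bound _ zero_le_one fun x => by
    rw [ContinuousLinearMap.norm_map_of_mem_unitary hh]; simp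

theorem unitary_apply_star {h : V →L[ℝ] V} (hh : h ∈ unitary (V →L[ℝ] V)) (u : V) :
    h (star h u) = u := by
  rw [← mul_apply_eq_comp, hh.2, one_apply_eq_self]

theorem unitary_star_apply {h : V →L[ℝ] V} (hh : h ∈ unitary (V →L[ℝ] V)) (u : V) :
    star h (h u) = u := by
  rw [← mul_apply_eq_comp, hh.1, one_apply_eq_self]

theorem exists_transport_bound {f : V → ℝ} (hf : ContDiff ℝ 2 f) :
    ∃ C : ℝ, 0 < C ∧ ∀ a ∈ unitary (V →L[ℝ] V), ∀ b ∈ unitary (V →L[ℝ] V), ∀ δ : ℝ,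
      (∀ u : V, ‖u‖ ≤ 1 → |f (a u) - f (b u)| ≤ δ) →
      ∃ k ∈ unitary (V →L[ℝ] V), (∀ u : V, ‖u‖ ≤ 1 → f (b (k u)) = f (a u)) ∧ ‖k - 1‖ ≤ C * δ := by
  obtain ⟨C, hC, h⟩ := exists_orbit_bound hf
  refine ⟨C, hC, fun a ha b hb δ hab => ?_⟩
  have hbs : star b ∈ unitary (V →L[ℝ] V) := Unitary.star_mem hb
  obtain ⟨g, hg, hgf, hgn⟩ := h (a * star b) (mul_mem ha hbs) δ fun u hu => by
    have := hab (star b u) (norm_unitary_apply_le hbs hu)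
    rwa [unitary_apply_star hb] at this
  refine ⟨star b * g * b, mul_mem (mul_mem hbs hg) hb, fun u hu => ?_, ?_⟩
  · rw [mul_apply_eq_comp, mul_apply_eq_comp, unitary_apply_star hb,
      hgf _ (norm_unitary_apply_le hb hu), mul_apply_eq_comp, unitary_star_apply hb]
  · have : star b * g * b - 1 = star b * (g - 1) * b := by
      rw [mul_sub, sub_mul, mul_one, hb.1]
    rw [this]
    calc _ ≤ ‖star b‖ * ‖g - 1‖ * ‖b‖ :=
          (norm_mul_le _ _).trans (mul_le_mul_of_nonneg_right (norm_mul_le _ _) (norm_nonneg _))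
      _ ≤ 1 * ‖g - 1‖ * 1 := by
          gcongr
          · exact norm_unitary_le_one hbs
          · exact norm_unitary_le_one hb
      _ ≤ _ := by simpa using hgn

theorem exists_exp_approx : ∃ C : ℝ, 0 ≤ C ∧ ∀ k ∈ unitary (V →L[ℝ] V), ‖k - 1‖ ≤ 1 →
    ∃ T ∈ skewAdjoint (V →L[ℝ] V), ‖T‖ ≤ ‖k - 1‖ ∧
      ‖(NormedSpace.exp T : V →L[ℝ] V) - k‖ ≤ C * ‖k - 1‖ ^ 2 := by
  obtain ⟨M, hM0, hM⟩ := exists_quadratic_bound (contDiff_exp (V := V))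
    (isCompact_closedBall (0 : V →L[ℝ] V) 1) (convex_closedBall _ _)
  refine ⟨M + 1 / 2, by positivity, fun k hk hk1 => ?_⟩
  let T : V →L[ℝ] V := (1 / 2 : ℝ) • (k - star k)
  have h0 : ‖star (k - 1)‖ = ‖k - 1‖ := norm_star (k - 1)
  have hT : ‖T‖ ≤ ‖k - 1‖ := by
    have h1 : k - star k = (k - 1) - star (k - 1) := by simp
    calc ‖T‖ = 1 / 2 * ‖(k - 1) - star (k - 1)‖ := by simp only [T, norm_smul, h1]; norm_num
      _ ≤ 1 / 2 * (‖k - 1‖ + ‖star (k - 1)‖) := by gcongr; exact norm_sub_le _ _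
      _ = _ := by rw [h0]; ring
  refine ⟨T, ?_, hT, ?_⟩
  · rw [skewAdjoint.mem_iff]; simp [T, ← smul_neg]
  · have h1 := hM 0 (by simp) T (by simpa using hT.trans hk1)
    rw [(hasFDerivAt_exp_zero (𝕂 := ℝ) (𝔸 := V →L[ℝ] V)).fderiv, NormedSpace.exp_zero, sub_zero] at h1
    have h2 : k - 1 - T = -((1 / 2 : ℝ) • (star (k - 1) * (k - 1))) := by
      have := hk.1
      simp only [star_sub, star_one, sub_mul, mul_sub, this, mul_one, one_mul, T]
      module
    have h3 : ‖k - 1 - T‖ ≤ 1 / 2 * ‖k - 1‖ ^ 2 := by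
      rw [h2, norm_neg, norm_smul]
      have h5 := (norm_mul_le (star (k - 1)) (k - 1)).trans_eq (by rw [h0])
      rw [Real.norm_of_nonneg (by norm_num), sq]
      linarith
    have h4 : (NormedSpace.exp T : V →L[ℝ] V) - k
        = ((NormedSpace.exp T : V →L[ℝ] V) - 1 - T) - (k - 1 - T) := by abel
    rw [h4]
    calc _ ≤ _ := norm_sub_le _ _
      _ ≤ M * ‖T‖ ^ 2 + 1 / 2 * ‖k - 1‖ ^ 2 := add_le_add (by simpa using h1) h3
      _ ≤ M * ‖k - 1‖ ^ 2 + 1 / 2 * ‖k - 1‖ ^ 2 := by gcongr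
      _ = _ := by ring

theorem exists_linearization {f : V → ℝ} (hf : ContDiff ℝ 2 f) :
    ∃ C : ℝ, 0 ≤ C ∧ ∀ b ∈ unitary (V →L[ℝ] V), ∀ u : V, ‖u‖ ≤ 1 →
      ∃ l : (V →L[ℝ] V) →L[ℝ] ℝ, ∀ T : V →L[ℝ] V, ‖T‖ ≤ 1 →
        |f (b ((NormedSpace.exp T : V →L[ℝ] V) u)) - f (b u) - l T| ≤ C * ‖T‖ ^ 2 := by
  let F : (V →L[ℝ] V) × (V →L[ℝ] V) × V → ℝ := fun x =>
    f (x.1 ((NormedSpace.exp x.2.1 : V →L[ℝ] V) x.2.2))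
  have hF : ContDiff ℝ 2 F := by
    refine hf.comp (contDiff_fst.clm_apply (ContDiff.clm_apply ?_ (by fun_prop)))
    exact contDiff_exp.comp (by fun_prop)
  obtain ⟨M, hM0, hM⟩ := exists_quadratic_bound hF
    (isCompact_closedBall (0 : (V →L[ℝ] V) × (V →L[ℝ] V) × V) 1) (convex_closedBall _ _)
  refine ⟨M, hM0, fun b hb u hu => ⟨(fderiv ℝ F (b, 0, u)).comp
    ((ContinuousLinearMap.inr ℝ _ _).comp (ContinuousLinearMap.inl ℝ _ _)), fun T hT => ?_⟩⟩
  have hb1 := norm_unitary_le_one hb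
  have := hM (b, 0, u) (by simp [Prod.norm_def, hu, hb1]) (b, T, u) (by simp [Prod.norm_def, hu, hb1, hT])
  simpa [F, Prod.norm_def] using this

theorem exists_lipschitz_ball {f : V → ℝ} (hf : ContDiff ℝ 2 f) :
    ∃ L : ℝ, 0 ≤ L ∧ ∀ x y : V, ‖x‖ ≤ 1 → ‖y‖ ≤ 1 → |f x - f y| ≤ L * ‖x - y‖ := by
  obtain ⟨L, hL⟩ := hf.contDiffOn.exists_lipschitzOnWith (by norm_num) (convex_closedBall (0 : V) 1)
    (isCompact_closedBall _ _)
  refine ⟨L, L.2, fun x y hx hy => ?_⟩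
  simpa [dist_eq_norm] using hL.dist_le_mul x (by simpa using hx) y (by simpa using hy)

theorem exists_correction {D : Type*} [TopologicalSpace D] [NormalSpace D] [ParacompactSpace D]
    {f : V → ℝ} (hf : ContDiff ℝ 2 f) :
    ∃ C : ℝ, 0 < C ∧ ∀ (p p' : D → V → ℝ) (δ : ℝ), 0 < δ → C * δ ≤ 1 →
      (∀ w, ∃ a ∈ unitary (V →L[ℝ] V), ∀ u : V, ‖u‖ ≤ 1 → p w u = f (a u)) →
      (∀ w, ∃ b ∈ unitary (V →L[ℝ] V), ∀ u : V, ‖u‖ ≤ 1 → p' w u = f (b u)) →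
      (∀ w₀, ∀ η > 0, ∀ᶠ w in 𝓝 w₀, ∀ u : V, ‖u‖ ≤ 1 → |p w u - p w₀ u| ≤ η) →
      (∀ w₀, ∀ η > 0, ∀ᶠ w in 𝓝 w₀, ∀ u : V, ‖u‖ ≤ 1 → |p' w u - p' w₀ u| ≤ η) →
      (∀ w (u : V), ‖u‖ ≤ 1 → |p w u - p' w u| ≤ δ) →
      ∃ T : D → V →L[ℝ] V, Continuous T ∧ (∀ w, T w ∈ skewAdjoint (V →L[ℝ] V)) ∧
        ∀ w (u : V), ‖u‖ ≤ 1 →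
          |p' w ((NormedSpace.exp (T w) : V →L[ℝ] V) u) - p w u| ≤ C * δ ^ 2 := by
  obtain ⟨C₁, hC₁, h₁⟩ := exists_transport_bound hf
  obtain ⟨C₂, hC₂, h₂⟩ := exists_exp_approx (V := V)
  obtain ⟨C₃, hC₃, h₃⟩ := exists_linearization hf
  obtain ⟨L, hL0, hL⟩ := exists_lipschitz_ball hf
  let C₄ := L * (C₂ * C₁ ^ 2) + 2 + C₃ * C₁ ^ 2
  refine ⟨C₁ + C₄ + C₃ * C₁ ^ 2, by positivity, fun p p' δ hδ hCδ hp hp' hpc hpc' hpp => ?_⟩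
  have hC₄ : 0 ≤ C₄ := by positivity
  have hC₁δ : C₁ * δ ≤ 1 := by
    refine le_trans ?_ hCδ
    gcongr
    nlinarith [sq_nonneg C₁]
  choose a haU ha using hp
  choose b hbU hb using hp'
  choose! l hl using h₃
  have hexpball : ∀ T ∈ skewAdjoint (V →L[ℝ] V), ∀ u : V, ‖u‖ ≤ 1 →
      ‖(NormedSpace.exp T : V →L[ℝ] V) u‖ ≤ 1 := fun T hT u hu => by rwa [norm_exp_apply hT]
  let t : D → Set (V →L[ℝ] V) := fun w =>
    {T | T ∈ skewAdjoint (V →L[ℝ] V) ∧ ‖T‖ ≤ C₁ * δ ∧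
      ∀ u : V, ‖u‖ ≤ 1 → |f (b w u) + l (b w) u T - p w u| ≤ C₄ * δ ^ 2}
  have htc : ∀ w, Convex ℝ (t w) := by
    intro w S hS T hT x y hx hy hxy
    refine ⟨?_, ?_, fun u hu => ?_⟩
    · have h1 := skewAdjoint.mem_iff.1 hS.1
      have h2 := skewAdjoint.mem_iff.1 hT.1
      rw [skewAdjoint.mem_iff]
      simp only [star_add, star_smul, star_trivial, h1, h2]
      module
    · calc _ ≤ ‖x • S‖ + ‖y • T‖ := norm_add_le _ _
        _ = x * ‖S‖ + y * ‖T‖ := by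
          rw [norm_smul, norm_smul, Real.norm_of_nonneg hx, Real.norm_of_nonneg hy]
        _ ≤ x * (C₁ * δ) + y * (C₁ * δ) := by gcongr; exacts [hS.2.1, hT.2.1]
        _ = _ := by rw [← add_mul, hxy, one_mul]
    · have h1 := abs_le.1 (hS.2.2 u hu)
      have h2 := abs_le.1 (hT.2.2 u hu)
      have e : f (b w u) + l (b w) u (x • S + y • T) - p w u
          = x * (f (b w u) + l (b w) u S - p w u) + y * (f (b w u) + l (b w) u T - p w u) := by
        simp only [map_add, map_smul, smul_eq_mul]
        linear_combination (-(f (b w u)) + p w u) * hxy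
      rw [e, abs_le]
      constructor <;> nlinarith
  have htl : ∀ w₀, ∃ T, ∀ᶠ w in 𝓝 w₀, T ∈ t w := by
    intro w₀
    obtain ⟨k, hkU, hk, hk1⟩ := h₁ (a w₀) (haU w₀) (b w₀) (hbU w₀) δ fun u hu => by
      rw [← ha _ _ hu, ← hb _ _ hu]; exact hpp w₀ u hu
    obtain ⟨T, hTs, hT1, hTk⟩ := h₂ k hkU (hk1.trans hC₁δ)
    refine ⟨T, ?_⟩
    filter_upwards [hpc w₀ (δ ^ 2) (by positivity), hpc' w₀ (δ ^ 2) (by positivity)] with w hw hw'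
    refine ⟨hTs, hT1.trans hk1, fun u hu => ?_⟩
    have hTδ : ‖T‖ ≤ C₁ * δ := hT1.trans hk1
    have e1 := abs_le.1 (hl (b w) (hbU w) u hu T (hTδ.trans hC₁δ))
    have e2 := abs_le.1 (hw u hu)
    have e3 := abs_le.1 (hw' _ (hexpball T hTs u hu))
    rw [hb w _ (hexpball T hTs u hu)] at e3
    rw [hb w₀ _ (hexpball T hTs u hu)] at e3
    have e4 := hL (b w₀ ((NormedSpace.exp T : V →L[ℝ] V) u)) (b w₀ (k u))
      (norm_unitary_apply_le (hbU _) (hexpball T hTs u hu))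
      (norm_unitary_apply_le (hbU _) (norm_unitary_apply_le hkU hu))
    rw [hk u hu, ← ha w₀ u hu] at e4
    have e5 : ‖b w₀ ((NormedSpace.exp T : V →L[ℝ] V) u) - b w₀ (k u)‖ ≤ C₂ * (C₁ * δ) ^ 2 := by
      rw [← map_sub, ContinuousLinearMap.norm_map_of_mem_unitary (hbU w₀),
        ← sub_apply]
      calc _ ≤ ‖(NormedSpace.exp T : V →L[ℝ] V) - k‖ * ‖u‖ := ContinuousLinearMap.le_opNorm _ _
        _ ≤ (C₂ * ‖k - 1‖ ^ 2) * 1 := by gcongr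
        _ ≤ C₂ * (C₁ * δ) ^ 2 := by rw [mul_one]; gcongr
    have e6 := abs_le.1 (e4.trans (mul_le_mul_of_nonneg_left e5 hL0))
    have e7 : C₃ * ‖T‖ ^ 2 ≤ C₃ * (C₁ * δ) ^ 2 := by gcongr
    have e8 : C₄ * δ ^ 2 = L * (C₂ * (C₁ * δ) ^ 2) + 2 * δ ^ 2 + C₃ * (C₁ * δ) ^ 2 := by
      simp only [C₄]; ring
    rw [e8, abs_le]
    constructor <;> linarith [e1.1, e1.2, e2.1, e2.2, e3.1, e3.2, e6.1, e6.2]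
  obtain ⟨T, hT⟩ := exists_continuous_forall_mem_convex_of_local_const htc htl
  refine ⟨T, T.continuous, fun w => (hT w).1, fun w u hu => ?_⟩
  rw [hb w _ (hexpball _ (hT w).1 u hu)]
  have e1 := abs_le.1 (hl (b w) (hbU w) u hu (T w) ((hT w).2.1.trans hC₁δ))
  have e2 := abs_le.1 ((hT w).2.2 u hu)
  have e7 : C₃ * ‖T w‖ ^ 2 ≤ C₃ * (C₁ * δ) ^ 2 := by gcongr; exact (hT w).2.1
  have e8 : C₄ * δ ^ 2 + C₃ * (C₁ * δ) ^ 2 ≤ (C₁ + C₄ + C₃ * C₁ ^ 2) * δ ^ 2 := by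
    nlinarith [mul_pos hC₁ (pow_pos hδ 2)]
  rw [abs_le]
  constructor <;> linarith [e1.1, e1.2, e2.1, e2.2]

theorem exists_approximate_lift {D : Type*} [TopologicalSpace D] [NormalSpace D]
    [ParacompactSpace D] {f : V → ℝ} (hf : ContDiff ℝ 2 f) {L : ℝ} (q : ℝ → D → V → ℝ)
    (hq : ∀ t w, ∃ b ∈ unitary (V →L[ℝ] V), ∀ u : V, ‖u‖ ≤ 1 → q t w u = f (b u))
    (hqL : ∀ t s w (u : V), 0 ≤ t → t ≤ 1 → 0 ≤ s → s ≤ 1 → ‖u‖ ≤ 1 →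
      |q t w u - q s w u| ≤ L * |t - s|)
    (hqc : ∀ t w₀, ∀ η > 0, ∀ᶠ w in 𝓝 w₀, ∀ u : V, ‖u‖ ≤ 1 → |q t w u - q t w₀ u| ≤ η)
    (hq0 : ∀ w (u : V), ‖u‖ ≤ 1 → q 0 w u = f u) (η : ℝ) (hη : 0 < η) :
    ∃ k : D → V →L[ℝ] V, Continuous k ∧ (∀ w, k w ∈ unitary (V →L[ℝ] V)) ∧
      ∀ w (u : V), ‖u‖ ≤ 1 → |q 1 w (k w u) - f u| ≤ η := by
  obtain ⟨C, hC, hstep⟩ := exists_correction (D := D) hf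
  obtain ⟨M, hM0, hM⟩ := exists_lipschitz_ball hf
  let L' := |L| + 1
  have hL' : 0 < L' := by positivity
  obtain ⟨N, hN⟩ := exists_nat_gt (max (C * L') (C * L' ^ 2 / η))
  have hN1 : C * L' < N := (le_max_left _ _).trans_lt hN
  have hN2 : C * L' ^ 2 / η < N := (le_max_right _ _).trans_lt hN
  have hN0 : (0 : ℝ) < N := lt_trans (by positivity) hN1
  let δ := L' / N
  have hδ : 0 < δ := by positivity
  have hCδ : C * δ ≤ 1 := by
    simp only [δ]
    rw [← mul_div_assoc, div_le_one hN0]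
    exact hN1.le
  have key : ∀ j : ℕ, j ≤ N → ∃ k : D → V →L[ℝ] V, Continuous k ∧
      (∀ w, k w ∈ unitary (V →L[ℝ] V)) ∧
      ∀ w (u : V), ‖u‖ ≤ 1 → |q (j / N) w (k w u) - f u| ≤ j * (C * δ ^ 2) := by
    intro j
    induction j with
    | zero =>
      intro _
      refine ⟨fun _ => 1, continuous_const, fun _ => one_mem _, fun w u hu => ?_⟩
      simp [hq0 w u hu]
    | succ j ih =>
      intro hj
      obtain ⟨k, hkc, hkU, hk⟩ := ih (by omega)
      have hu1 : ∀ w (u : V), ‖u‖ ≤ 1 → ‖k w u‖ ≤ 1 := fun w u hu =>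
        norm_unitary_apply_le (hkU w) hu
      have horb : ∀ t w, ∃ a ∈ unitary (V →L[ℝ] V), ∀ u : V, ‖u‖ ≤ 1 →
          q t w (k w u) = f (a u) := fun t w => by
        obtain ⟨b, hb, hbq⟩ := hq t w
        exact ⟨b * k w, mul_mem hb (hkU w), fun u hu => hbq _ (hu1 w u hu)⟩
      have hcont : ∀ t w₀, ∀ η > 0, ∀ᶠ w in 𝓝 w₀, ∀ u : V, ‖u‖ ≤ 1 →
          |q t w (k w u) - q t w₀ (k w₀ u)| ≤ η := fun t w₀ η hη => by
        obtain ⟨b, hb, hbq⟩ := hq t w₀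
        have h1 : ∀ᶠ w in 𝓝 w₀, M * ‖k w - k w₀‖ < η / 2 := by
          have : Tendsto (fun w => M * ‖k w - k w₀‖) (𝓝 w₀) (𝓝 (M * ‖k w₀ - k w₀‖)) :=
            ((hkc.tendsto w₀).sub_const _).norm.const_mul _
          rw [sub_self, norm_zero, mul_zero] at this
          exact this.eventually_lt_const (by positivity)
        filter_upwards [hqc t w₀ (η / 2) (by positivity), h1] with w hw hw' u hu
        have e1 := abs_le.1 (hw _ (hu1 w u hu))
        have e2 := hM (b (k w u)) (b (k w₀ u)) (norm_unitary_apply_le hb (hu1 w u hu))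
          (norm_unitary_apply_le hb (hu1 w₀ u hu))
        rw [← hbq _ (hu1 w u hu), ← hbq _ (hu1 w₀ u hu), ← map_sub,
          ContinuousLinearMap.norm_map_of_mem_unitary hb, ← sub_apply] at e2
        have e3 : M * ‖(k w - k w₀) u‖ ≤ M * ‖k w - k w₀‖ := by
          gcongr
          exact ContinuousLinearMap.unit_le_opNorm _ _ hu
        have e4 := abs_le.1 (e2.trans e3)
        rw [abs_le]
        constructor <;> linarith [e1.1, e1.2, e4.1, e4.2]
      have hdist : ∀ w (u : V), ‖u‖ ≤ 1 →
          |q (j / N) w (k w u) - q ((j + 1 : ℕ) / N) w (k w u)| ≤ δ := by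
        intro w u hu
        have hj' : ((j + 1 : ℕ) : ℝ) ≤ N := by exact_mod_cast hj
        have hj0 : (j : ℝ) ≤ N := by push_cast at hj'; linarith
        refine (hqL _ _ w _ (by positivity) (by rwa [div_le_one hN0]) (by positivity)
          (by rwa [div_le_one hN0]) (hu1 w u hu)).trans ?_
        have e1 : |(j / N : ℝ) - ((j + 1 : ℕ) : ℝ) / N| = 1 / N := by
          rw [← sub_div, abs_div, abs_of_pos hN0]; push_cast; norm_num
        rw [e1]
        have e2 : L ≤ L' := (le_abs_self L).trans (by simp [L'])
        simp only [δ]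
        rw [mul_one_div]
        gcongr
      obtain ⟨T, hTc, hTs, hT⟩ := hstep (fun w u => q (j / N) w (k w u))
        (fun w u => q ((j + 1 : ℕ) / N) w (k w u)) δ hδ hCδ (horb _) (horb _) (hcont _) (hcont _) hdist
      refine ⟨fun w => k w * NormedSpace.exp (T w), hkc.mul (contDiff_exp.continuous.comp hTc),
          fun w => mul_mem (hkU w) (exp_mem_unitary_of_mem_skewAdjoint (hTs w)), fun w u hu => ?_⟩
      have e1 := abs_le.1 (hT w u hu)
      have e2 := abs_le.1 (hk w u hu)
      rw [mul_apply_eq_comp, abs_le]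
      push_cast at e1 ⊢
      constructor <;> linarith [e1.1, e1.2, e2.1, e2.2]
  obtain ⟨k, hkc, hkU, hk⟩ := key N le_rfl
  refine ⟨k, hkc, hkU, fun w u hu => ?_⟩
  have := hk w u hu
  rw [div_self hN0.ne'] at this
  refine this.trans ?_
  have e : N * (C * δ ^ 2) = C * L' ^ 2 / N := by
    simp only [δ]; field_simp
  rw [e, div_le_iff₀ hN0]
  rw [div_lt_iff₀ hη] at hN2
  linarith

end SimilarSections

namespace SimilarSections

open Filter Topology MeasureTheory

variable {V : Type*} [NormedAddCommGroup V] [InnerProductSpace ℝ V]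

/-- The support function of a set. -/
noncomputable def supp (K : Set V) (u : V) : ℝ := sSup ((fun x => inner ℝ x u) '' K)

theorem le_supp {K : Set V} {R : ℝ} (hK : K ⊆ closedBall 0 R) {x : V} (hx : x ∈ K) (u : V) :
    inner ℝ x u ≤ supp K u := by
  refine le_csSup ⟨R * ‖u‖, ?_⟩ (Set.mem_image_of_mem _ hx)
  rintro _ ⟨y, hy, rfl⟩
  refine (real_inner_le_norm y u).trans ?_
  gcongr
  simpa using hK hy

theorem supp_le {K : Set V} (hne : K.Nonempty) {u : V} {c : ℝ} (h : ∀ x ∈ K, inner ℝ x u ≤ c) :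
    supp K u ≤ c := by
  refine csSup_le (hne.image _) ?_
  rintro _ ⟨y, hy, rfl⟩
  exact h y hy

theorem supp_sub_le {K : Set V} {R : ℝ} (hne : K.Nonempty) (hK : K ⊆ closedBall 0 R) (u v : V) :
    supp K u - supp K v ≤ R * ‖u - v‖ := by
  rw [sub_le_iff_le_add]
  refine supp_le hne fun x hx => ?_
  have h1 := le_supp hK hx v
  have h2 : inner ℝ x u = inner ℝ x (u - v) + inner ℝ x v := by rw [← inner_add_right]; simp
  have h3 : inner ℝ x (u - v) ≤ R * ‖u - v‖ := by
    refine (real_inner_le_norm x _).trans ?_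
    gcongr
    simpa using hK hx
  linarith

theorem continuous_supp {K : Set V} {R : ℝ} (hne : K.Nonempty) (hK : K ⊆ closedBall 0 R) :
    Continuous (supp K) := by
  refine (LipschitzWith.of_le_add_mul (K := R.toNNReal) fun u v => ?_).continuous
  have h1 := supp_sub_le hne hK u v
  rw [dist_eq_norm]
  have h2 : R * ‖u - v‖ ≤ R.toNNReal * ‖u - v‖ := by gcongr; exact Real.le_coe_toNNReal R
  linarith

theorem mul_norm_le_supp {K : Set V} {ρ R : ℝ} (hρ : 0 ≤ ρ) (hK : K ⊆ closedBall 0 R)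
    (hK' : closedBall 0 ρ ⊆ K) (u : V) : ρ * ‖u‖ ≤ supp K u := by
  rcases eq_or_ne u 0 with rfl | hu
  · simpa using le_supp hK (hK' (by simpa using hρ : (0 : V) ∈ closedBall 0 ρ)) 0
  · have hu' : ‖u‖ ≠ 0 := norm_ne_zero_iff.2 hu
    have h1 := le_supp hK (hK' (by
      simp [norm_smul, abs_of_nonneg hρ, hu'] : (ρ / ‖u‖) • u ∈ closedBall (0 : V) ρ)) u
    rw [real_inner_smul_left, real_inner_self_eq_norm_sq] at h1
    refine le_of_eq_of_le ?_ h1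
    field_simp

theorem supp_similar {K K' : Set V} {R R' r : ℝ} (hr : 0 < r) (O : V ≃ₗᵢ[ℝ] V) (c : V)
    (hne : K.Nonempty) (hK : K ⊆ closedBall 0 R) (hR' : K' ⊆ closedBall 0 R')
    (h : K' = (fun x => r • O x + c) '' K) (u : V) :
    supp K' u = r * supp K (O.symm u) + inner ℝ c u := by
  have hin : ∀ x, inner ℝ (r • O x + c) u = r * inner ℝ x (O.symm u) + inner ℝ c u := fun x => by
    rw [inner_add_left, real_inner_smul_left, ← O.inner_map_map x, O.apply_symm_apply]
  apply le_antisymm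
  · refine supp_le (h ▸ hne.image _) fun y hy => ?_
    rw [h] at hy
    obtain ⟨x, hx, rfl⟩ := hy
    have := le_supp hK hx (O.symm u)
    simp only [hin]
    gcongr
  · rw [← le_sub_iff_add_le, ← le_div_iff₀' hr]
    refine supp_le hne fun x hx => ?_
    rw [le_div_iff₀' hr, le_sub_iff_add_le, ← hin]
    exact le_supp hR' (h ▸ Set.mem_image_of_mem _ hx) u

theorem supp_le_of_subset_smul {K K' : Set V} {R s : ℝ} (hs : 0 ≤ s) (hne : K.Nonempty)
    (hR : K' ⊆ closedBall 0 R) (h : ∀ x ∈ K, ∃ y ∈ K', x = (1 + s) • y) (u : V) :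
    supp K u ≤ supp K' u + s * R * ‖u‖ := by
  refine supp_le hne fun x hx => ?_
  obtain ⟨y, hy, rfl⟩ := h x hx
  have h1 := le_supp hR hy u
  have h2 : inner ℝ y u ≤ R * ‖u‖ := by
    refine (real_inner_le_norm y u).trans ?_
    gcongr
    simpa using hR hy
  rw [real_inner_smul_left]
  nlinarith

variable [FiniteDimensional ℝ V] [MeasurableSpace V] [BorelSpace V]

/-- Nonnegative radial compactly supported `C^2` kernels. -/
structure IsKernel (φ : V → ℝ) : Prop where
  contDiff : ContDiff ℝ 2 φ
  compact : HasCompactSupport φ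
  nonneg : ∀ x, 0 ≤ φ x
  radial : ∀ x y, ‖x‖ = ‖y‖ → φ x = φ y
  pos : 0 < ∫ t, ‖t‖ * φ t

/-- The support function smoothed by a kernel. -/
noncomputable def smoothed (φ : V → ℝ) (K : Set V) (u : V) : ℝ := ∫ t, supp K t * φ (u - t)

/-- The smoothed support function, normalized to be invariant under homotheties. -/
noncomputable def profile (φ : V → ℝ) (K : Set V) (u : V) : ℝ :=
  (smoothed φ K u - fderiv ℝ (smoothed φ K) 0 u) / smoothed φ K 0

theorem smoothed_eq_convolution (φ : V → ℝ) (K : Set V) :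
    smoothed φ K = convolution (supp K) φ (ContinuousLinearMap.lsmul ℝ ℝ) volume := by
  ext u
  simp [smoothed, convolution_def]

theorem IsKernel.hasCompactSupport_sub {φ : V → ℝ} (hφ : IsKernel φ) (u : V) :
    HasCompactSupport fun t => φ (u - t) :=
  hφ.compact.comp_homeomorph (Homeomorph.subLeft u)

theorem IsKernel.integrable_mul {φ : V → ℝ} (hφ : IsKernel φ) {g : V → ℝ} (hg : Continuous g)
    (u : V) : Integrable fun t => g t * φ (u - t) :=
  (hg.mul (hφ.contDiff.continuous.comp (continuous_const.sub continuous_id))).integrable_of_hasCompactSupport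
    (hφ.hasCompactSupport_sub u).mul_left

theorem contDiff_smoothed {φ : V → ℝ} (hφ : IsKernel φ) {K : Set V} {R : ℝ} (hne : K.Nonempty)
    (hK : K ⊆ closedBall 0 R) : ContDiff ℝ 2 (smoothed φ K) := by
  rw [smoothed_eq_convolution]
  exact hφ.compact.contDiff_convolution_right _ (continuous_supp hne hK).locallyIntegrable hφ.contDiff

theorem contDiff_profile {φ : V → ℝ} (hφ : IsKernel φ) {K : Set V} {R : ℝ} (hne : K.Nonempty)
    (hK : K ⊆ closedBall 0 R) : ContDiff ℝ 2 (profile φ K) := by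
  have := contDiff_smoothed hφ hne hK
  unfold profile
  fun_prop

theorem IsKernel.integral_inner_mul {φ : V → ℝ} (hφ : IsKernel φ) (c u : V) :
    ∫ t, inner ℝ c t * φ (u - t) = (∫ t, φ t) * inner ℝ c u := by
  have h0 : ∫ t, inner ℝ c t * φ t = 0 := by
    have h1 := integral_neg_eq_self (fun t : V => inner ℝ c t * φ t) volume
    have h2 : ∀ t, inner ℝ c (-t) * φ (-t) = -(inner ℝ c t * φ t) := fun t => by
      rw [inner_neg_right, hφ.radial (-t) t (norm_neg t)]; ring
    simp only [h2, integral_neg] at h1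
    linarith
  have h3 : ∫ t, inner ℝ c t * φ (u - t) = ∫ t, inner ℝ c (u - t) * φ t := by
    rw [← integral_sub_left_eq_self (fun t : V => inner ℝ c (u - t) * φ t) volume u]
    simp
  have hi : Integrable φ := hφ.contDiff.continuous.integrable_of_hasCompactSupport hφ.compact
  have hi2 : Integrable fun t => inner ℝ c t * φ t :=
    ((continuous_const.inner continuous_id).mul hφ.contDiff.continuous).integrable_of_hasCompactSupport
      hφ.compact.mul_left
  rw [h3]
  simp only [inner_sub_right, sub_mul]
  rw [integral_sub (hi.const_mul _) hi2, h0, sub_zero, integral_const_mul, mul_comm]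

theorem smoothed_similar {φ : V → ℝ} (hφ : IsKernel φ) {K K' : Set V} {R R' r : ℝ} (hr : 0 < r)
    (O : V ≃ₗᵢ[ℝ] V) (c : V) (hne : K.Nonempty) (hK : K ⊆ closedBall 0 R)
    (hR' : K' ⊆ closedBall 0 R') (h : K' = (fun x => r • O x + c) '' K) (u : V) :
    smoothed φ K' u = r * smoothed φ K (O.symm u) + (∫ t, φ t) * inner ℝ c u := by
  have h1 : ∫ t, supp K (O.symm t) * φ (u - t) = smoothed φ K (O.symm u) := by
    have h2 := (O.measurePreserving).integral_comp' (f := O.toMeasurableEquiv)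
      (fun t => supp K (O.symm t) * φ (u - t))
    rw [← h2]
    refine integral_congr_ae (Eventually.of_forall fun t => ?_)
    have : φ (u - O t) = φ (O.symm u - t) := hφ.radial _ _ (by
      rw [← O.symm.norm_map, map_sub, O.symm_apply_apply])
    simp [this]
  have hc : Continuous fun t => supp K (O.symm t) := (continuous_supp hne hK).comp O.symm.continuous
  have hi : Integrable fun t => inner ℝ c t * φ (u - t) :=
    hφ.integrable_mul (continuous_const.inner continuous_id) u
  simp only [smoothed, supp_similar hr O c hne hK hR' h, add_mul, mul_assoc]
  rw [integral_add ((hφ.integrable_mul hc u).const_mul r) hi, integral_const_mul, h1,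
    hφ.integral_inner_mul]
  rfl

theorem profile_similar {φ : V → ℝ} (hφ : IsKernel φ) {K K' : Set V} {R R' r : ℝ} (hr : 0 < r)
    (O : V ≃ₗᵢ[ℝ] V) (c : V) (hne : K.Nonempty) (hK : K ⊆ closedBall 0 R)
    (hR' : K' ⊆ closedBall 0 R') (h : K' = (fun x => r • O x + c) '' K) (u : V) :
    profile φ K' u = profile φ K (O.symm u) := by
  have hs := smoothed_similar hφ hr O c hne hK hR' h
  have hd : HasFDerivAt (smoothed φ K) (fderiv ℝ (smoothed φ K) 0) (O.symm 0) := by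
    rw [map_zero]
    exact ((contDiff_smoothed hφ hne hK).differentiable (by norm_num) 0).hasFDerivAt
  have hd' := ((hd.comp (0 : V) O.symm.toContinuousLinearEquiv.hasFDerivAt).const_mul r).add
    (((innerSL ℝ c).hasFDerivAt (x := (0 : V))).const_mul (∫ t, φ t))
  have hd2 : fderiv ℝ (smoothed φ K') 0 u
      = r * fderiv ℝ (smoothed φ K) 0 (O.symm u) + (∫ t, φ t) * inner ℝ c u := by
    have : fderiv ℝ (smoothed φ K') 0 = _ := (hd'.congr_of_eventuallyEq (Eventually.of_forall hs)).fderiv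
    rw [this]
    simp
  unfold profile
  rw [hd2, hs u, hs 0, map_zero, inner_zero_right, mul_zero, add_zero, add_sub_add_right_eq_sub,
    ← mul_sub, mul_div_mul_left _ _ hr.ne']

end SimilarSections

namespace SimilarSections

open Filter Topology MeasureTheory

variable {V : Type*} [NormedAddCommGroup V] [InnerProductSpace ℝ V] [FiniteDimensional ℝ V]
  [MeasurableSpace V] [BorelSpace V]
  {E : Type*} [NormedAddCommGroup E] [InnerProductSpace ℝ E]

theorem fderiv_smoothed_zero {φ : V → ℝ} (hφ : IsKernel φ) {K : Set V} {R : ℝ} (hne : K.Nonempty)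
    (hK : K ⊆ closedBall 0 R) :
    fderiv ℝ (smoothed φ K) 0 = ∫ t, supp K t • fderiv ℝ φ (0 - t) := by
  rw [smoothed_eq_convolution, (hφ.compact.hasFDerivAt_convolution_right
    (ContinuousLinearMap.lsmul ℝ ℝ) (continuous_supp hne hK).locallyIntegrable
    (hφ.contDiff.of_le (by norm_num)) 0).fderiv, convolution_def]
  refine integral_congr_ae (Eventually.of_forall fun t => ?_)
  ext v
  simp [ContinuousLinearMap.precompR_apply]

theorem norm_integral_smul_sub_le {F : Type*} [NormedAddCommGroup F] [NormedSpace ℝ F]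
    {Ψ : V → F} (hΨ : Continuous Ψ)
    (hc : HasCompactSupport Ψ) {h₁ h₂ : V → ℝ} (hh₁ : Continuous h₁) (hh₂ : Continuous h₂)
    {a : ℝ} (ha : 0 ≤ a) (h : ∀ t, |h₁ t - h₂ t| ≤ a * ‖t‖) {u : V} (hu : ‖u‖ ≤ 1) :
    ‖(∫ t, h₁ t • Ψ (u - t)) - ∫ t, h₂ t • Ψ (u - t)‖ ≤ a * ∫ t, (1 + ‖t‖) * ‖Ψ t‖ := by
  have hcs : HasCompactSupport fun t => Ψ (u - t) := hc.comp_homeomorph (Homeomorph.subLeft u)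
  have hct : Continuous fun t => Ψ (u - t) := hΨ.comp (continuous_const.sub continuous_id)
  have hInt : ∀ g : V → ℝ, Continuous g → Integrable fun t => g t • Ψ (u - t) := fun g hg =>
    (hg.smul hct).integrable_of_hasCompactSupport hcs.smul_left
  have hInt2 : Integrable fun t => (1 + ‖t‖) * ‖Ψ t‖ :=
    ((continuous_const.add continuous_norm).mul hΨ.norm).integrable_of_hasCompactSupport
      hc.norm.mul_left
  rw [← integral_sub (hInt _ hh₁) (hInt _ hh₂), ← integral_const_mul,
    ← integral_sub_left_eq_self (fun t => a * ((1 + ‖t‖) * ‖Ψ t‖)) volume u]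
  refine norm_integral_le_of_norm_le ?_ (Eventually.of_forall fun t => ?_)
  · exact (hInt2.const_mul a).comp_sub_left u
  · rw [← sub_smul, norm_smul, ← mul_assoc, Real.norm_eq_abs]
    gcongr
    refine (h t).trans ?_
    gcongr
    have : t = u - (u - t) := by abel
    calc ‖t‖ = ‖u - (u - t)‖ := by rw [← this]
      _ ≤ ‖u‖ + ‖u - t‖ := norm_sub_le _ _
      _ ≤ _ := by gcongr

theorem exists_profile_lipschitz {φ : V → ℝ} (hφ : IsKernel φ) {ρ R : ℝ} (hρ : 0 < ρ) :
    ∃ L, 0 ≤ L ∧ ∀ (K K' : Set V) (a : ℝ), 0 ≤ a → K ⊆ closedBall 0 R → K' ⊆ closedBall 0 R →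
      closedBall 0 ρ ⊆ K → closedBall 0 ρ ⊆ K' → (∀ t, |supp K t - supp K' t| ≤ a * ‖t‖) →
      ∀ u, ‖u‖ ≤ 1 → |profile φ K u - profile φ K' u| ≤ L * a := by
  set C₁ := ∫ t, (1 + ‖t‖) * ‖φ t‖ with hC₁
  set C₂ := ∫ t, (1 + ‖t‖) * ‖fderiv ℝ φ t‖ with hC₂
  have hC₁0 : 0 ≤ C₁ := integral_nonneg fun t => by positivity
  have hC₂0 : 0 ≤ C₂ := integral_nonneg fun t => by positivity
  have hD : 0 < ∫ t, ‖t‖ * φ t := hφ.pos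
  set d := ρ * ∫ t, ‖t‖ * φ t with hd
  have hd0 : 0 < d := by positivity
  have hΨ := hφ.contDiff.continuous
  have hΨ' := hφ.contDiff.continuous_fderiv (by norm_num)
  have hne : ∀ K : Set V, closedBall 0 ρ ⊆ K → K.Nonempty := fun K h => ⟨0, h (by simp [hρ.le])⟩
  have hnum : ∀ (K K' : Set V) (a : ℝ), 0 ≤ a → K ⊆ closedBall 0 R → K' ⊆ closedBall 0 R →
      K.Nonempty → K'.Nonempty → (∀ t, |supp K t - supp K' t| ≤ a * ‖t‖) →
      ∀ u, ‖u‖ ≤ 1 → |(smoothed φ K u - fderiv ℝ (smoothed φ K) 0 u) -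
        (smoothed φ K' u - fderiv ℝ (smoothed φ K') 0 u)| ≤ a * (C₁ + C₂) := by
    intro K K' a ha hK hK' hk hk' h u hu
    have hc := continuous_supp hk hK
    have hc' := continuous_supp hk' hK'
    have h1 := norm_integral_smul_sub_le hΨ hφ.compact hc hc' ha h hu
    have h2 := norm_integral_smul_sub_le hΨ' (hφ.compact.fderiv ℝ) hc hc' ha h
      (u := 0) (by simp)
    rw [← fderiv_smoothed_zero hφ hk hK, ← fderiv_smoothed_zero hφ hk' hK'] at h2
    have h3 := ((fderiv ℝ (smoothed φ K) 0 - fderiv ℝ (smoothed φ K') 0).le_opNorm u).trans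
      (mul_le_mul_of_nonneg_left hu (norm_nonneg _))
    rw [sub_apply, Real.norm_eq_abs] at h3
    have h1' : |smoothed φ K u - smoothed φ K' u| ≤ a * C₁ := h1
    have h4 : |fderiv ℝ (smoothed φ K) 0 u - fderiv ℝ (smoothed φ K') 0 u| ≤ a * C₂ := by
      linarith
    rw [abs_le] at *
    constructor <;> linarith [h4.1, h4.2, h1'.1, h1'.2]
  have hden : ∀ (K K' : Set V) (a : ℝ), 0 ≤ a → K ⊆ closedBall 0 R → K' ⊆ closedBall 0 R →
      K.Nonempty → K'.Nonempty → (∀ t, |supp K t - supp K' t| ≤ a * ‖t‖) →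
      |smoothed φ K 0 - smoothed φ K' 0| ≤ a * C₁ := fun K K' a ha hK hK' hk hk' h =>
    norm_integral_smul_sub_le hΨ hφ.compact (continuous_supp hk hK)
      (continuous_supp hk' hK') ha h (u := 0) (by simp)
  have hsm : ∀ K : Set V, K ⊆ closedBall 0 R → closedBall 0 ρ ⊆ K → d ≤ smoothed φ K 0 := by
    intro K hK hk
    rw [hd, ← integral_const_mul]
    have hi : Integrable fun t => ‖t‖ * φ t :=
      (continuous_norm.mul hΨ).integrable_of_hasCompactSupport hφ.compact.mul_left
    refine integral_mono (hi.const_mul ρ)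
      (hφ.integrable_mul (continuous_supp (hne K hk) hK) 0) fun t => ?_
    simp only [zero_sub]
    rw [hφ.radial (-t) t (norm_neg t), ← mul_assoc]
    exact mul_le_mul_of_nonneg_right (mul_norm_le_supp hρ.le hK hk t) (hφ.nonneg t)
  refine ⟨(C₁ + C₂) / d + |R| * (C₁ + C₂) / d * C₁ / d, by positivity, ?_⟩
  intro K K' a ha hK hK' hk hk' h u hu
  have hR0 : 0 ≤ R := by
    have : (0 : V) ∈ closedBall (0 : V) R := hK (hk (by simp [hρ.le]))
    simpa using this
  have e1 := hnum K K' a ha hK hK' (hne K hk) (hne K' hk') h u hu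
  have e2 := hden K K' a ha hK hK' (hne K hk) (hne K' hk') h
  have hz : ∀ t : V, supp ({0} : Set V) t = 0 := fun t => by simp [supp]
  have hsz : smoothed φ ({0} : Set V) = 0 := by
    ext v
    simp [smoothed, hz]
  have e3 : |smoothed φ K' u - fderiv ℝ (smoothed φ K') 0 u| ≤ R * (C₁ + C₂) := by
    have := hnum K' {0} R hR0 hK' (by simpa using hR0) (hne K' hk') (Set.singleton_nonempty 0)
      (fun t => by
        rw [hz, sub_zero, abs_of_nonneg
          ((by positivity : (0 : ℝ) ≤ ρ * ‖t‖).trans (mul_norm_le_supp hρ.le hK' hk' t))]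
        have h0 : supp K' 0 = 0 := by
          refine le_antisymm (supp_le (hne K' hk') fun x _ => by simp) ?_
          simpa using mul_norm_le_supp hρ.le hK' hk' 0
        simpa [h0] using supp_sub_le (hne K' hk') hK' t 0) u hu
    rw [hsz] at this
    simpa using this
  have d1 := hsm K hK hk
  have d2 := hsm K' hK' hk'
  unfold profile
  set N := smoothed φ K u - fderiv ℝ (smoothed φ K) 0 u
  set N' := smoothed φ K' u - fderiv ℝ (smoothed φ K') 0 u
  set s := smoothed φ K 0
  set s' := smoothed φ K' 0
  have hs : 0 < s := hd0.trans_le d1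
  have hs' : 0 < s' := hd0.trans_le d2
  have key : N / s - N' / s' = (N - N') / s + N' / s' * (s' - s) / s := by
    field_simp
    ring
  rw [key, add_mul]
  refine (abs_add_le _ _).trans (add_le_add ?_ ?_)
  · rw [abs_div, abs_of_pos hs, div_mul_eq_mul_div, mul_comm (C₁ + C₂)]
    gcongr
  · rw [abs_div, abs_mul, abs_div, abs_of_pos hs, abs_of_pos hs', abs_sub_comm s' s, abs_of_nonneg hR0]
    calc |N'| / s' * |s - s'| / s ≤ R * (C₁ + C₂) / d * (a * C₁) / d := by gcongr
      _ = _ := by ring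

omit [FiniteDimensional ℝ V] [MeasurableSpace V] [BorelSpace V] in
theorem supp_preimage_sub_le {B : Set E} (hB : Convex ℝ B) {ρ R : ℝ} (hρ : 0 < ρ)
    (hR : B ⊆ closedBall 0 R) (hk : closedBall 0 ρ ⊆ B) {A A' : V →L[ℝ] E}
    (hA : ∀ u, ‖A u‖ = ‖u‖) (hA' : ∀ u, ‖A' u‖ = ‖u‖) (t : V) :
    |supp (A ⁻¹' B) t - supp (A' ⁻¹' B) t| ≤ ‖A - A'‖ * (R * R / ρ) * ‖t‖ := by
  have hR0 : 0 ≤ R := by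
    have : (0 : E) ∈ closedBall (0 : E) R := hR (hk (by simp [hρ.le]))
    simpa using this
  have main : ∀ A A' : V →L[ℝ] E, (∀ u, ‖A u‖ = ‖u‖) → (∀ u, ‖A' u‖ = ‖u‖) →
      supp (A ⁻¹' B) t - supp (A' ⁻¹' B) t ≤ ‖A - A'‖ * (R * R / ρ) * ‖t‖ := by
    intro A A' hA hA'
    have hs : 0 ≤ ‖A - A'‖ * R / ρ := by positivity
    have h := supp_le_of_subset_smul (K := A ⁻¹' B) (K' := A' ⁻¹' B) (R := R) hs
      ⟨0, by simpa using hk (by simp [hρ.le] : (0 : E) ∈ closedBall (0 : E) ρ)⟩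
      (fun x hx => by simpa [hA'] using hR hx)
      (fun x hx => ⟨(1 + ‖A - A'‖ * R / ρ)⁻¹ • x, ?_, by
        rw [smul_smul, mul_inv_cancel₀ (by positivity), one_smul]⟩) t
    · rw [sub_le_iff_le_add']
      refine h.trans (le_of_eq ?_)
      ring
    · set s := ‖A - A'‖ * R / ρ with hsd
      have hxR : ‖x‖ ≤ R := by simpa [hA] using hR hx
      rw [Set.mem_preimage, map_smul]
      have hz : ‖(A' - A) x‖ ≤ s * ρ := by
        rw [hsd, div_mul_cancel₀ _ hρ.ne', norm_sub_rev A A']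
        exact ((A' - A).le_opNorm x).trans (by gcongr)
      rcases hs.eq_or_lt with h0 | h0
      · have : (A' - A) x = 0 := norm_le_zero_iff.1 (by rw [← h0] at hz; simpa using hz)
        have h2 : A' x = A x := by simpa [sub_eq_zero] using this
        rw [← h0, h2]
        simpa using hx
      · have hzB : s⁻¹ • (A' - A) x ∈ B := hk (by
          simp only [mem_closedBall, dist_zero_right, norm_smul, norm_inv, Real.norm_eq_abs,
            abs_of_pos h0]
          rw [inv_mul_le_iff₀ h0]
          exact hz)
        have := hB hx hzB (a := (1 + s)⁻¹) (b := (1 + s)⁻¹ * s) (by positivity) (by positivity)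
          (by field_simp)
        convert this using 1
        rw [smul_smul, mul_assoc, mul_inv_cancel₀ h0.ne', mul_one, ← smul_add]
        congr 1
        simp
  rw [abs_le]
  refine ⟨?_, main A A' hA hA'⟩
  have := main A' A hA' hA
  rw [norm_sub_rev] at this
  linarith

end SimilarSections

namespace SimilarSections

open Filter Topology MeasureTheory

variable {V : Type*} [NormedAddCommGroup V] [InnerProductSpace ℝ V] [FiniteDimensional ℝ V]
  [MeasurableSpace V] [BorelSpace V]

theorem exists_isKernel [Nontrivial V] {ε : ℝ} (hε : 0 < ε) :
    ∃ φ : V → ℝ, IsKernel φ ∧ (∀ t, ε < ‖t‖ → φ t = 0) ∧ 0 < ∫ t, φ t := by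
  set φ : V → ℝ := fun t => Real.smoothTransition (1 - ‖t‖ ^ 2 / ε ^ 2) with hφ
  have hcd : ContDiff ℝ 2 φ := by
    refine Real.smoothTransition.contDiff.comp ?_
    exact contDiff_const.sub ((contDiff_norm_sq ℝ).div_const _)
  have hz : ∀ t, ε < ‖t‖ → φ t = 0 := fun t ht => by
    refine Real.smoothTransition.zero_of_nonpos ?_
    have : 1 ≤ ‖t‖ ^ 2 / ε ^ 2 := by
      rw [one_le_div (by positivity)]
      gcongr
    linarith
  have hc : HasCompactSupport φ := HasCompactSupport.intro (isCompact_closedBall 0 ε) fun t ht =>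
    hz t (by simpa using ht)
  have hnn : ∀ t, 0 ≤ φ t := fun t => Real.smoothTransition.nonneg _
  obtain ⟨v, hv⟩ := exists_norm_eq V (half_pos hε).le
  have hv' : 0 < φ v := by
    refine Real.smoothTransition.pos_of_pos ?_
    rw [hv]
    have : (ε / 2) ^ 2 / ε ^ 2 = 1 / 4 := by field_simp; norm_num
    rw [this]
    norm_num
  have hpos : ∀ g : V → ℝ, Continuous g → (∀ t, 0 ≤ g t) → 0 < g v → 0 < ∫ t, g t * φ t := by
    intro g hg hg0 hgv
    exact (hg.mul hcd.continuous).integral_pos_of_hasCompactSupport_nonneg_nonzero hc.mul_left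
      (fun t => mul_nonneg (hg0 t) (hnn t)) (mul_pos hgv hv').ne'
  refine ⟨φ, ⟨hcd, hc, hnn, fun x y h => by simp only [hφ, h], ?_⟩, hz, ?_⟩
  · exact hpos _ continuous_norm (fun t => norm_nonneg t) (by rw [hv]; positivity)
  · simpa using hpos (fun _ => 1) continuous_const (fun _ => zero_le_one) one_pos

theorem abs_smoothed_sub_le {φ : V → ℝ} (hφ : IsKernel φ) {ε : ℝ}
    (hz : ∀ t, ε < ‖t‖ → φ t = 0) {K : Set V} {R : ℝ} (hR : 0 ≤ R) (hne : K.Nonempty)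
    (hK : K ⊆ closedBall 0 R) (u : V) :
    |smoothed φ K u - (∫ t, φ t) * supp K u| ≤ R * ε * ∫ t, φ t := by
  have hi : Integrable fun t => φ (u - t) := by
    simpa using hφ.integrable_mul (continuous_const (y := (1 : ℝ))) u
  have h0 : ∫ t, φ (u - t) = ∫ t, φ t := integral_sub_left_eq_self φ volume u
  have h1 := hφ.integrable_mul (continuous_supp hne hK) u
  rw [← h0, mul_comm, ← integral_const_mul, ← integral_const_mul, smoothed,
    ← integral_sub h1 (hi.const_mul _), ← Real.norm_eq_abs]
  refine norm_integral_le_of_norm_le (hi.const_mul _) (Eventually.of_forall fun t => ?_)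
  rw [← sub_mul, norm_mul, Real.norm_eq_abs, Real.norm_of_nonneg (hφ.nonneg _)]
  by_cases ht : ε < ‖u - t‖
  · simp [hz _ ht]
  · push Not at ht
    refine mul_le_mul_of_nonneg_right ?_ (hφ.nonneg _)
    have a1 := supp_sub_le hne hK u t
    have a2 := supp_sub_le hne hK t u
    rw [norm_sub_rev] at a2
    have : R * ‖u - t‖ ≤ R * ε := by gcongr
    rw [abs_le]
    constructor <;> linarith

omit [FiniteDimensional ℝ V] [MeasurableSpace V] [BorelSpace V] in
theorem supp_smul {K : Set V} {R : ℝ} (hne : K.Nonempty) (hK : K ⊆ closedBall 0 R) {c : ℝ}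
    (hc : 0 < c) (u : V) : supp K (c • u) = c * supp K u := by
  have key : ∀ (c : ℝ) (u : V), 0 < c → supp K (c • u) ≤ c * supp K u := fun c u hc =>
    supp_le hne fun x hx => by
      rw [real_inner_smul_right]
      gcongr
      exact le_supp hK hx u
  refine le_antisymm (key c u hc) ?_
  have := key c⁻¹ (c • u) (inv_pos.2 hc)
  rwa [smul_smul, inv_mul_cancel₀ hc.ne', one_smul, le_inv_mul_iff₀ hc] at this

omit [FiniteDimensional ℝ V] [MeasurableSpace V] [BorelSpace V] in
theorem mem_of_forall_inner_le_supp [CompleteSpace V] {K : Set V} (hne : K.Nonempty) (hKc : IsCompact K)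
    (hKv : Convex ℝ K) {x : V} (h : ∀ u, inner ℝ x u ≤ supp K u) : x ∈ K := by
  by_contra hx
  obtain ⟨f, s, h1, h2⟩ := geometric_hahn_banach_closed_point hKv hKc.isClosed hx
  set u := (InnerProductSpace.toDual ℝ V).symm f with hu
  have hf : ∀ y, f y = inner ℝ y u := fun y => by
    rw [real_inner_comm, hu, InnerProductSpace.toDual_symm_apply]
  have h3 : supp K u ≤ s := supp_le hne fun y hy => by rw [← hf]; exact (h1 y hy).le
  have h4 := h u
  rw [← hf] at h4
  linarith

theorem exists_center_of_profile_even [Nontrivial V] {K : Set V} {R : ℝ} (hR : 0 ≤ R)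
    (hne : K.Nonempty) (hK : K ⊆ closedBall 0 R)
    (h : ∀ φ : V → ℝ, IsKernel φ → ∀ y, ‖y‖ = 1 → profile φ K y = profile φ K (-y))
    (hs : ∀ φ : V → ℝ, IsKernel φ → smoothed φ K 0 ≠ 0) :
    ∃ b : V, ∀ u, supp K u - supp K (-u) = inner ℝ b u := by
  have key : ∀ ε : ℝ, 0 < ε → ∃ β : V →ₗ[ℝ] ℝ, ∀ u,
      |β u - (supp K u - supp K (-u))| ≤ 2 * (R * ε) * ‖u‖ := by
    intro ε hε
    obtain ⟨φ, hφ, hz, hI⟩ := exists_isKernel (V := V) hε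
    refine ⟨(2 / ∫ t, φ t) • (fderiv ℝ (smoothed φ K) 0).toLinearMap, fun u => ?_⟩
    rcases eq_or_ne u 0 with rfl | hu
    · simp
    have hun : 0 < ‖u‖ := norm_pos_iff.2 hu
    have unit : ∀ u : V, ‖u‖ = 1 →
        |2 / (∫ t, φ t) * fderiv ℝ (smoothed φ K) 0 u - (supp K u - supp K (-u))| ≤ 2 * (R * ε) := by
      intro u hu
      have e1 := h φ hφ u hu
      unfold profile at e1
      rw [div_left_inj' (hs φ hφ), map_neg] at e1
      have a1 := abs_smoothed_sub_le hφ hz hR hne hK u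
      have a2 := abs_smoothed_sub_le hφ hz hR hne hK (-u)
      have : 2 / (∫ t, φ t) * fderiv ℝ (smoothed φ K) 0 u - (supp K u - supp K (-u)) =
          ((smoothed φ K u - (∫ t, φ t) * supp K u) -
            (smoothed φ K (-u) - (∫ t, φ t) * supp K (-u))) / ∫ t, φ t := by
        have : fderiv ℝ (smoothed φ K) 0 u = (smoothed φ K u - smoothed φ K (-u)) / 2 := by linarith
        rw [this]
        field_simp
        ring
      rw [this, abs_div, abs_of_pos hI, div_le_iff₀ hI]
      refine (abs_sub _ _).trans ?_
      linarith
    have e2 := unit (‖u‖⁻¹ • u) (by rw [norm_smul, norm_inv, norm_norm, inv_mul_cancel₀ hun.ne'])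
    rw [← smul_neg, supp_smul hne hK (inv_pos.2 hun), supp_smul hne hK (inv_pos.2 hun), map_smul,
      smul_eq_mul] at e2
    have e3 : 2 / (∫ t, φ t) * (‖u‖⁻¹ * fderiv ℝ (smoothed φ K) 0 u) -
        (‖u‖⁻¹ * supp K u - ‖u‖⁻¹ * supp K (-u)) = ‖u‖⁻¹ *
        (2 / (∫ t, φ t) * fderiv ℝ (smoothed φ K) 0 u - (supp K u - supp K (-u))) := by ring
    rw [e3, abs_mul, abs_of_pos (inv_pos.2 hun), inv_mul_le_iff₀ hun, mul_comm ‖u‖] at e2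
    exact e2
  choose! β hβ using key
  have ht : Tendsto (fun ε : ℝ => (fun u => β ε u : V → ℝ)) (𝓝[>] 0)
      (𝓝 fun u => supp K u - supp K (-u)) := by
    rw [tendsto_pi_nhds]
    intro u
    rw [tendsto_iff_norm_sub_tendsto_zero]
    refine squeeze_zero' (Eventually.of_forall fun _ => norm_nonneg _)
      (g := fun ε => 2 * (R * ε) * ‖u‖) ?_ ?_
    · filter_upwards [self_mem_nhdsWithin] with ε hε using hβ ε hε u
    · have : Tendsto (fun ε : ℝ => 2 * (R * ε) * ‖u‖) (𝓝 0) (𝓝 (2 * (R * 0) * ‖u‖)) := by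
        exact Continuous.tendsto (by fun_prop) 0
      simpa using this.mono_left nhdsWithin_le_nhds
  set ℓ := linearMapOfTendsto _ β ht
  refine ⟨(InnerProductSpace.toDual ℝ V).symm (LinearMap.toContinuousLinearMap ℓ), fun u => ?_⟩
  rw [InnerProductSpace.toDual_symm_apply]
  rfl

theorem exists_supp_add_const_of_profile_const [Nontrivial V] {K : Set V} {R : ℝ} (hR : 0 ≤ R)
    (hne : K.Nonempty) (hK : K ⊆ closedBall 0 R)
    (h : ∀ φ : V → ℝ, IsKernel φ → ∀ y z, ‖y‖ = 1 → ‖z‖ = 1 → profile φ K y = profile φ K z)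
    (hs : ∀ φ : V → ℝ, IsKernel φ → smoothed φ K 0 ≠ 0) {y z : V} (hy : ‖y‖ = 1) (hz : ‖z‖ = 1) :
    supp K y + supp K (-y) = supp K z + supp K (-z) := by
  refine eq_of_forall_dist_le fun δ hδ => ?_
  rw [Real.dist_eq]
  obtain ⟨φ, hφ, hzero, hI⟩ := exists_isKernel (V := V) (ε := δ / (4 * R + 1)) (by positivity)
  have e1 := h φ hφ y z hy hz
  have e2 := h φ hφ (-y) (-z) (by simpa) (by simpa)
  unfold profile at e1 e2
  rw [div_left_inj' (hs φ hφ)] at e1 e2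
  rw [map_neg, map_neg] at e2
  have a1 := abs_smoothed_sub_le hφ hzero hR hne hK y
  have a2 := abs_smoothed_sub_le hφ hzero hR hne hK (-y)
  have a3 := abs_smoothed_sub_le hφ hzero hR hne hK z
  have a4 := abs_smoothed_sub_le hφ hzero hR hne hK (-z)
  have hle : 4 * (R * (δ / (4 * R + 1))) ≤ δ := by
    rw [← mul_assoc, mul_div_assoc', div_le_iff₀ (by positivity)]
    nlinarith
  set I := ∫ t, φ t
  have : |I * ((supp K y + supp K (-y)) - (supp K z + supp K (-z)))| ≤ I * δ := by
    have : 4 * (R * (δ / (4 * R + 1))) * I ≤ δ * I := by gcongr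
    rw [abs_le] at *
    constructor <;> linarith [a1.1, a1.2, a2.1, a2.2, a3.1, a3.2, a4.1, a4.2]
  rwa [abs_mul, abs_of_pos hI, mul_le_mul_iff_right₀ hI] at this


omit [FiniteDimensional ℝ V] [MeasurableSpace V] [BorelSpace V] in
theorem sub_mem_of_supp_sub_supp_neg [CompleteSpace V] {K : Set V} {R : ℝ} (hK : K ⊆ closedBall 0 R)
    (hne : K.Nonempty) (hKc : IsCompact K) (hKv : Convex ℝ K) {b : V}
    (hb : ∀ u, supp K u - supp K (-u) = inner ℝ b u) {x : V} (hx : x ∈ K) : b - x ∈ K := by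
  refine mem_of_forall_inner_le_supp hne hKc hKv fun u => ?_
  have h1 := le_supp hK hx (-u)
  rw [inner_neg_right] at h1
  rw [inner_sub_left, ← hb]
  linarith

omit [FiniteDimensional ℝ V] [MeasurableSpace V] [BorelSpace V] in
theorem eq_closedBall_of_supp [CompleteSpace V] {K : Set V} {R : ℝ} (hK : K ⊆ closedBall 0 R)
    (hne : K.Nonempty) (hKc : IsCompact K) (hKv : Convex ℝ K) {b : V} {a : ℝ} (ha : 0 ≤ a)
    (hb : ∀ u, supp K u = a * ‖u‖ + inner ℝ b u) : K = closedBall b a := by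
  ext x
  rw [mem_closedBall, dist_eq_norm]
  constructor
  · intro hx
    have h1 := le_supp hK hx (x - b)
    rw [hb, ← sub_le_iff_le_add, ← inner_sub_left, real_inner_self_eq_norm_sq] at h1
    rcases (norm_nonneg (x - b)).eq_or_lt with h0 | h0
    · rwa [← h0]
    · nlinarith
  · intro hx
    refine mem_of_forall_inner_le_supp hne hKc hKv fun u => ?_
    rw [hb, ← sub_le_iff_le_add, ← inner_sub_left]
    exact (real_inner_le_norm _ _).trans (by gcongr)

end SimilarSections

namespace SimilarSections

open Filter Topology MeasureTheory

section Reflection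

variable {E : Type*} [NormedAddCommGroup E] [InnerProductSpace ℝ E]

/-- The reflection in the hyperplane orthogonal to `a`. -/
noncomputable def hyperplaneReflection (a : E) : E ≃ₗᵢ[ℝ] E := (ℝ ∙ a)ᗮ.reflection

theorem hyperplaneReflection_apply (a x : E) :
    hyperplaneReflection a x = x - (2 * (inner ℝ a x / ‖a‖ ^ 2)) • a := by
  rw [hyperplaneReflection, Submodule.reflection_orthogonal_apply,
    Submodule.reflection_singleton_apply, mul_smul, two_smul, two_smul]
  simp

theorem norm_normalize_sub_le {a b : E} (ha : 1 ≤ ‖a‖) (hb : 1 ≤ ‖b‖) :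
    ‖‖a‖⁻¹ • a - ‖b‖⁻¹ • b‖ ≤ 2 * ‖a - b‖ := by
  have ha' : 0 < ‖a‖ := by linarith
  have hb' : 0 < ‖b‖ := by linarith
  have h1 : ‖a‖⁻¹ • a - ‖b‖⁻¹ • b = ‖a‖⁻¹ • (a - b) + (‖a‖⁻¹ * (‖b‖ - ‖a‖)) • (‖b‖⁻¹ • b) := by
    rw [smul_sub, smul_smul, ← sub_eq_zero]
    have : ‖a‖⁻¹ * (‖b‖ - ‖a‖) * ‖b‖⁻¹ = ‖a‖⁻¹ - ‖b‖⁻¹ := by field_simp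
    rw [this, sub_smul]
    abel
  have h2 : ‖‖b‖⁻¹ • b‖ = 1 := by rw [norm_smul, norm_inv, norm_norm, inv_mul_cancel₀ hb'.ne']
  have h3 : |‖b‖ - ‖a‖| ≤ ‖a - b‖ := by rw [abs_sub_comm]; exact abs_norm_sub_norm_le a b
  have h4 : ‖a‖⁻¹ ≤ 1 := inv_le_one_of_one_le₀ ha
  rw [h1]
  refine (norm_add_le _ _).trans ?_
  rw [norm_smul, norm_smul, h2, norm_mul, norm_inv, norm_norm, Real.norm_eq_abs, mul_one, two_mul]
  gcongr
  · exact mul_le_of_le_one_left (norm_nonneg _) h4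
  · exact (mul_le_of_le_one_left (abs_nonneg _) h4).trans h3

theorem norm_hyperplaneReflection_sub_le {a b : E} (ha : 1 ≤ ‖a‖) (hb : 1 ≤ ‖b‖) (x : E) :
    ‖hyperplaneReflection a x - hyperplaneReflection b x‖ ≤ 8 * ‖a - b‖ * ‖x‖ := by
  have ha' : 0 < ‖a‖ := by linarith
  have hb' : 0 < ‖b‖ := by linarith
  set a' := ‖a‖⁻¹ • a with ha1
  set b' := ‖b‖⁻¹ • b with hb1
  have na : ‖a'‖ = 1 := by rw [ha1, norm_smul, norm_inv, norm_norm, inv_mul_cancel₀ ha'.ne']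
  have nb : ‖b'‖ = 1 := by rw [hb1, norm_smul, norm_inv, norm_norm, inv_mul_cancel₀ hb'.ne']
  have h1 : hyperplaneReflection a x = x - (2 * inner ℝ a' x) • a' := by
    rw [hyperplaneReflection_apply, ha1, real_inner_smul_left, smul_smul]
    congr 2
    field_simp
  have h2 : hyperplaneReflection b x = x - (2 * inner ℝ b' x) • b' := by
    rw [hyperplaneReflection_apply, hb1, real_inner_smul_left, smul_smul]
    congr 2
    field_simp
  have h3 : hyperplaneReflection a x - hyperplaneReflection b x =
      (2 * inner ℝ (b' - a') x) • a' + (2 * inner ℝ b' x) • (b' - a') := by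
    rw [h1, h2, inner_sub_left, mul_sub, sub_smul, smul_sub]
    abel
  have hd : ‖b' - a'‖ ≤ 2 * ‖a - b‖ := by
    rw [norm_sub_rev]
    exact norm_normalize_sub_le ha hb
  have e1 : |inner ℝ (b' - a') x| ≤ 2 * ‖a - b‖ * ‖x‖ :=
    (abs_real_inner_le_norm _ _).trans (by gcongr)
  have e2 : |inner ℝ b' x| ≤ ‖x‖ := by simpa [nb] using abs_real_inner_le_norm b' x
  clear_value a' b'
  rw [h3]
  refine (norm_add_le _ _).trans ?_
  rw [norm_smul, norm_smul, na, Real.norm_eq_abs, Real.norm_eq_abs, abs_mul, abs_mul, abs_two]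
  nlinarith [mul_le_mul e2 hd (norm_nonneg _) (norm_nonneg _)]

end Reflection

variable {V : Type*} [NormedAddCommGroup V] [InnerProductSpace ℝ V] [FiniteDimensional ℝ V]
  [MeasurableSpace V] [BorelSpace V]
  {E : Type*} [NormedAddCommGroup E] [InnerProductSpace ℝ E]

/-- A compact convex set squeezed between two balls centred at the origin. -/
structure IsBody (B : Set E) (ρ R : ℝ) : Prop where
  compact : IsCompact B
  convex : Convex ℝ B
  pos : 0 < ρ
  subset : closedBall 0 ρ ⊆ B
  le : B ⊆ closedBall 0 R

omit [FiniteDimensional ℝ V] [MeasurableSpace V] [BorelSpace V] in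
theorem IsBody.preimage [FiniteDimensional ℝ V] {B : Set E} {ρ R : ℝ} (h : IsBody B ρ R)
    (A : V →ₗᵢ[ℝ] E) : IsBody (A ⁻¹' B) ρ R where
  compact := (isCompact_closedBall (0 : V) R).of_isClosed_subset
    (h.compact.isClosed.preimage A.continuous) fun x hx => by simpa using h.le hx
  convex := h.convex.linear_preimage A.toLinearMap
  pos := h.pos
  subset := fun x hx => h.subset (by simpa using hx)
  le := fun x hx => by simpa using h.le hx

omit [FiniteDimensional ℝ V] [MeasurableSpace V] [BorelSpace V] in
theorem IsBody.nonempty {B : Set E} {ρ R : ℝ} (h : IsBody B ρ R) : B.Nonempty :=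
  ⟨0, h.subset (by simp [h.pos.le])⟩

theorem IsBody.nonneg {B : Set E} {ρ R : ℝ} (h : IsBody B ρ R) : 0 ≤ R := by
  simpa using h.le (h.subset (by simp [h.pos.le] : (0 : E) ∈ closedBall (0 : E) ρ))

variable (V) in
/-- All sections of `B` by isometrically embedded copies of `V` are similar. -/
def SimilarPreimages (B : Set E) : Prop :=
  ∀ A A' : V →ₗᵢ[ℝ] E, ∃ r : ℝ, 0 < r ∧ ∃ (O : V ≃ₗᵢ[ℝ] V) (c : V),
    A' ⁻¹' B = (fun x => r • O x + c) '' (A ⁻¹' B)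

theorem profile_preimage {φ : V → ℝ} (hφ : IsKernel φ) {K : Set V} {ρ R : ℝ} (hK : IsBody K ρ R)
    (g : V ≃ₗᵢ[ℝ] V) (u : V) : profile φ (g ⁻¹' K) u = profile φ K (g u) := by
  refine profile_similar hφ one_pos g.symm 0 hK.nonempty hK.le
    (hK.preimage g.toLinearIsometry).le ?_ u
  have : (fun x : V => (1 : ℝ) • g.symm x + 0) = g.symm := by ext x; simp
  rw [this]
  exact (g.symm.toEquiv.image_eq_preimage_symm K).symm

theorem exists_approximate_section [FiniteDimensional ℝ E] {φ : V → ℝ} (hφ : IsKernel φ)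
    {B : Set E} {ρ R : ℝ} (hB : IsBody B ρ R) (hs : SimilarPreimages V B) {e : E} (he : ‖e‖ = 1)
    (A₀ : V →ₗᵢ[ℝ] E) (hA₀ : ∀ u, inner ℝ (A₀ u) e = 0) {η : ℝ} (hη : 0 < η) :
    ∃ σ : {w : E // ‖w‖ = 1 ∧ 0 ≤ inner ℝ w e} → (V →L[ℝ] E), Continuous σ ∧
      (∀ w u, ‖σ w u‖ = ‖u‖) ∧ (∀ w u, inner ℝ (σ w u) (w : E) = 0) ∧
      ∀ w u, ‖u‖ ≤ 1 → |profile φ (σ w ⁻¹' B) u - profile φ (A₀ ⁻¹' B) u| ≤ η := by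
  set D := {w : E // ‖w‖ = 1 ∧ 0 ≤ inner ℝ w e}
  let a : ℝ → D → E := fun t w => (2 - max 0 (min t 1)) • e + max 0 (min t 1) • (w : E)
  let A : ℝ → D → (V →ₗᵢ[ℝ] E) := fun t w => (hyperplaneReflection (a t w)).toLinearIsometry.comp A₀
  have hclamp : ∀ t : ℝ, 0 ≤ max 0 (min t 1) ∧ max 0 (min t 1) ≤ 1 := fun t =>
    ⟨le_max_left _ _, max_le zero_le_one (min_le_right _ _)⟩
  have ha : ∀ t w, 1 ≤ ‖a t w‖ := by
    intro t w
    have h1 : inner ℝ (a t w) e = (2 - max 0 (min t 1)) + max 0 (min t 1) * inner ℝ (w : E) e := by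
      simp only [a, inner_add_left, real_inner_smul_left, real_inner_self_eq_norm_sq, he]
      ring
    have h2 := real_inner_le_norm (a t w) e
    rw [he, mul_one, h1] at h2
    nlinarith [hclamp t, mul_nonneg (hclamp t).1 w.2.2]
  have hAa : ∀ t w s w', ‖(A t w).toContinuousLinearMap - (A s w').toContinuousLinearMap‖ ≤
      8 * ‖a t w - a s w'‖ := by
    intro t w s w'
    refine ContinuousLinearMap.opNorm_le_bound _ (by positivity) fun u => ?_
    have := norm_hyperplaneReflection_sub_le (ha t w) (ha s w') (A₀ u)
    rw [A₀.norm_map] at this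
    exact this
  obtain ⟨L, hL0, hL⟩ := exists_profile_lipschitz hφ (ρ := ρ) (R := R) hB.pos
  have hR := hB.nonneg
  have hρ := hB.pos
  set C := L * (8 * (R * R / ρ)) with hC
  have hC0 : 0 ≤ C := by positivity
  have hP : ∀ t w s w' (u : V), ‖u‖ ≤ 1 → |profile φ (A t w ⁻¹' B) u - profile φ (A s w' ⁻¹' B) u| ≤
      C * ‖a t w - a s w'‖ := by
    intro t w s w' u hu
    have h1 := hL (A t w ⁻¹' B) (A s w' ⁻¹' B)
      (‖(A t w).toContinuousLinearMap - (A s w').toContinuousLinearMap‖ * (R * R / ρ))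
      (by positivity) (hB.preimage _).le (hB.preimage _).le (hB.preimage _).subset
      (hB.preimage _).subset
      (supp_preimage_sub_le hB.convex hB.pos hB.le hB.subset (A := (A t w).toContinuousLinearMap)
        (A' := (A s w').toContinuousLinearMap) (A t w).norm_map (A s w').norm_map) u hu
    refine h1.trans ?_
    calc _ ≤ L * (8 * ‖a t w - a s w'‖ * (R * R / ρ)) := by gcongr; exact hAa t w s w'
      _ = _ := by rw [hC]; ring
  have hK₀ := hB.preimage A₀
  obtain ⟨k, hkc, hku, hk⟩ := exists_approximate_lift (D := D) (f := profile φ (A₀ ⁻¹' B))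
    (contDiff_profile hφ hK₀.nonempty hK₀.le) (L := 2 * C) (fun t w => profile φ (A t w ⁻¹' B))
    (by
      intro t w
      obtain ⟨r, hr, O, c, h⟩ := hs A₀ (A t w)
      refine ⟨O.symm.toLinearIsometry.toContinuousLinearMap,
        mem_unitary_of_norm_map O.symm.norm_map, fun u _ => ?_⟩
      exact profile_similar hφ hr O c hK₀.nonempty hK₀.le (hB.preimage _).le h u)
    (by
      intro t s w u ht0 ht1 hs0 hs1 hu
      refine (hP t w s w u hu).trans ?_
      have : a t w - a s w = (t - s) • ((w : E) - e) := by
        simp only [a, min_eq_left ht1, min_eq_left hs1, max_eq_right ht0, max_eq_right hs0]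
        module
      have h2 : ‖(w : E) - e‖ ≤ 2 := (norm_sub_le _ _).trans (by rw [w.2.1, he]; norm_num)
      rw [this, norm_smul, Real.norm_eq_abs]
      nlinarith [mul_le_mul_of_nonneg_left h2 (mul_nonneg hC0 (abs_nonneg (t - s)))])
    (by
      intro t w₀ η' hη'
      have hcont : Continuous fun w : D => C * ‖a t w - a t w₀‖ := by fun_prop
      have : ∀ᶠ w in 𝓝 w₀, C * ‖a t w - a t w₀‖ < η' :=
        hcont.continuousAt.eventually (gt_mem_nhds (by simpa using hη'))
      filter_upwards [this] with w hw u hu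
      exact (hP t w t w₀ u hu).trans hw.le)
    (by
      intro w u _
      have : (A 0 w : V → E) = A₀ := by
        ext x
        change hyperplaneReflection (a 0 w) (A₀ x) = A₀ x
        have h0 : a 0 w = (2 : ℝ) • e := by simp [a]
        rw [hyperplaneReflection_apply, h0, real_inner_smul_left, real_inner_comm, hA₀]
        simp
      simp only [this])
    η hη
  refine ⟨fun w => (A 1 w).toContinuousLinearMap.comp (k w), ?_, ?_, ?_, ?_⟩
  · refine Continuous.clm_comp ?_ hkc
    rw [continuous_iff_continuousAt]
    intro w₀
    refine tendsto_iff_norm_sub_tendsto_zero.2 ?_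
    refine squeeze_zero (fun _ => norm_nonneg _) (fun w => hAa 1 w 1 w₀) ?_
    have hcont : Continuous fun w : D => 8 * ‖a 1 w - a 1 w₀‖ := by fun_prop
    simpa using hcont.tendsto w₀
  · intro w u
    change ‖A 1 w (k w u)‖ = ‖u‖
    rw [(A 1 w).norm_map]
    exact ContinuousLinearMap.norm_map_of_mem_unitary (hku w) u
  · intro w u
    change inner ℝ (hyperplaneReflection (a 1 w) (A₀ (k w u))) (w : E) = 0
    have h1 : a 1 w = e + w := by
      simp only [a]
      norm_num
    have h2 : hyperplaneReflection (a 1 w) (-e) = w := by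
      have h3 : hyperplaneReflection (-e - (w : E)) (-e) = w :=
        Submodule.reflection_sub (by rw [norm_neg, he, w.2.1])
      rw [hyperplaneReflection_apply] at h3 ⊢
      have h4 : -e - (w : E) = -(a 1 w) := by rw [h1]; abel
      rw [h4, norm_neg, inner_neg_left, smul_neg, ← neg_smul] at h3
      rw [← h3]
      congr 2
      ring
    conv_lhs => rw [← h2]
    rw [LinearIsometryEquiv.inner_map_map, inner_neg_right, hA₀, neg_zero]
  · intro w u hu
    have hg : ∀ v, ‖k w v‖ = ‖v‖ := ContinuousLinearMap.norm_map_of_mem_unitary (hku w)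
    let g : V ≃ₗᵢ[ℝ] V := LinearIsometry.toLinearIsometryEquiv
      (⟨(k w).toLinearMap, hg⟩ : V →ₗᵢ[ℝ] V) rfl
    have := profile_preimage hφ (hB.preimage (A 1 w)) g u
    have h2 : ((A 1 w).toContinuousLinearMap.comp (k w) : V → E) ⁻¹' B = g ⁻¹' (A 1 w ⁻¹' B) := rfl
    rw [h2, this]
    exact hk w u hu

end SimilarSections

namespace SimilarSections

open Filter Topology MeasureTheory

section Polynomial

open Polynomial

theorem exists_integral_polynomial {α : Type*} [MeasurableSpace α] {μ : Measure α} (N : ℕ)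
    (p : α → ℝ[X]) (hp : ∀ x, (p x).degree < N)
    (hi : ∀ t : ℝ, Integrable (fun x => (p x).eval t) μ) :
    ∃ P : ℝ[X], P.degree < N ∧ (∀ t, P.eval t = ∫ x, (p x).eval t ∂μ) ∧
      ∀ k, P.coeff k = ∫ x, (p x).coeff k ∂μ := by
  set v : ℕ → ℝ := fun i => i with hv
  have hinj : Set.InjOn v (Finset.range N : Set ℕ) := Nat.cast_injective.injOn
  have hpx : ∀ x, p x = ∑ i ∈ Finset.range N,
      C ((p x).eval (v i)) * Lagrange.basis (Finset.range N) v i := fun x => by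
    conv_lhs => rw [Lagrange.eq_interpolate hinj (f := p x) (by simpa using hp x)]
    rw [Lagrange.interpolate_apply]
  refine ⟨Lagrange.interpolate (Finset.range N) v fun i => ∫ x, (p x).eval (v i) ∂μ, ?_, ?_, ?_⟩
  · simpa using Lagrange.degree_interpolate_lt (fun i => ∫ x, (p x).eval (v i) ∂μ) hinj
  · intro t
    rw [Lagrange.interpolate_apply, eval_finsetSum]
    simp only [eval_mul, eval_C]
    simp only [← integral_mul_const]
    rw [← integral_finsetSum _ fun i _ => (hi _).mul_const _]
    refine integral_congr_ae (Eventually.of_forall fun x => ?_)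
    beta_reduce
    conv_rhs => rw [hpx x]
    simp [eval_finsetSum]
  · intro k
    rw [Lagrange.interpolate_apply, finsetSum_coeff]
    simp only [coeff_C_mul]
    simp only [← integral_mul_const]
    rw [← integral_finsetSum _ fun i _ => (hi _).mul_const _]
    refine integral_congr_ae (Eventually.of_forall fun x => ?_)
    beta_reduce
    conv_rhs => rw [hpx x]
    simp [finsetSum_coeff]

theorem exists_polynomial_det {d : ℕ} {E : Type*} [NormedAddCommGroup E] [NormedSpace ℝ E]
    [FiniteDimensional ℝ E] (hd : Module.finrank ℝ E = d) (M : E →L[ℝ] E) (a b : ℝ) (m : ℕ) :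
    ∃ p : ℝ[X], p.degree < (m + d + 1 : ℕ) ∧
      (∀ t, p.eval t = (a + t * b) ^ m * (ContinuousLinearMap.id ℝ E + t • M).det) ∧
      p.coeff (m + d) = b ^ m * M.det := by
  classical
  set bs := Module.finBasisOfFinrankEq ℝ E hd
  set A := LinearMap.toMatrix bs bs M.toLinearMap
  have hdet : ∀ t : ℝ, (ContinuousLinearMap.id ℝ E + t • M).det = (1 + t • A).det := fun t => by
    rw [ContinuousLinearMap.det, ← LinearMap.det_toMatrix bs]
    congr 1
    simp [A]
  have hM : M.det = A.det := by
    rw [ContinuousLinearMap.det, ← LinearMap.det_toMatrix bs]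
  set q : ℝ[X] := (((X : ℝ[X]) • A.map C + (1 : Matrix (Fin d) (Fin d) ℝ).map C)).det
  have hq : q.natDegree ≤ d := by
    have := natDegree_det_X_add_C_le A 1
    rwa [Fintype.card_fin] at this
  have hl : (C a + X * C b : ℝ[X]).natDegree ≤ 1 := by compute_degree
  have hlm : ((C a + X * C b : ℝ[X]) ^ m).natDegree ≤ m := by
    simpa using natDegree_pow_le_of_le m hl
  refine ⟨(C a + X * C b) ^ m * q, ?_, ?_, ?_⟩
  · refine (degree_le_natDegree).trans_lt ?_
    have := natDegree_mul_le_of_le hlm hq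
    exact_mod_cast Nat.lt_succ_of_le this
  · intro t
    rw [eval_mul, hdet]
    congr 1
    · simp only [eval_pow, eval_add, eval_C, eval_mul, eval_X]
    · simp only [q]
      rw [← coe_evalRingHom, RingHom.map_det]
      congr 1
      ext i j
      simp only [RingHom.mapMatrix_apply, Matrix.map_apply, Matrix.add_apply, Matrix.smul_apply,
        smul_eq_mul, coe_evalRingHom, eval_add, eval_mul, eval_X, eval_C]
      ring
  · rw [coeff_mul_add_eq_of_natDegree_le hlm hq]
    congr 1
    · have := coeff_pow_of_natDegree_le (m := m) hl
      rw [mul_one] at this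
      rw [this]
      simp
    · rw [hM]
      have := coeff_det_X_add_C_card A 1
      rwa [Fintype.card_fin] at this

theorem coeff_eq_of_sq_eq {P : ℝ[X]} {k : ℕ} {c : ℝ} (hP : P.natDegree ≤ k) (h0 : P.eval 0 = c)
    (h : P ^ 2 = C (c ^ 2) * (1 + X ^ 2) ^ k) : P.coeff k = c := by
  wlog hc : 0 ≤ c generalizing P c
  · have := this (P := -P) (c := -c) (by simpa) (by simpa) (by simpa using h) (by linarith)
    simpa using this
  have hcoeff : P.coeff k ^ 2 = c ^ 2 := by
    have h1 := congrArg (fun Q : ℝ[X] => Q.coeff (2 * k)) h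
    have h2 : (P ^ 2).coeff (2 * k) = P.coeff k ^ 2 := coeff_pow_of_natDegree_le hP
    have h3 : (((1 + X ^ 2 : ℝ[X])) ^ k).coeff (k * 2) = 1 := by
      rw [coeff_pow_of_natDegree_le (by compute_degree)]
      simp [coeff_one]
    simp only [h2, coeff_C_mul] at h1
    rw [mul_comm 2 k, h3] at h1
    simpa using h1
  rcases sq_eq_sq_iff_eq_or_eq_neg.1 hcoeff with h1 | h1
  · exact h1
  rcases hc.eq_or_lt with hc0 | hc0
  · rw [h1, ← hc0, neg_zero]
  exfalso
  have hdeg : P.natDegree = k := le_antisymm hP (le_natDegree_of_ne_zero (by rw [h1]; linarith))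
  have hne : ∀ t, P.eval t ≠ 0 := fun t ht => by
    have := congrArg (eval t) h
    simp only [eval_pow, ht, eval_mul, eval_C, eval_add, eval_one, eval_X] at this
    have h5 : 0 < c ^ 2 * (1 + t ^ 2) ^ k := by positivity
    simp at this
    rcases this with h6 | h6
    · linarith
    · nlinarith [h6.1, sq_nonneg t]
  have hlc : P.leadingCoeff < 0 := by
    rw [leadingCoeff, hdeg, h1]; linarith
  rcases Nat.eq_zero_or_pos k with rfl | hk
  · rw [natDegree_eq_zero] at hdeg
    obtain ⟨x, rfl⟩ := hdeg
    simp at h0 h1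
    linarith
  have ht := P.tendsto_atBot_of_leadingCoeff_nonpos (by
    rw [← natDegree_pos_iff_degree_pos]; omega) hlc.le
  obtain ⟨T, hT0, hT⟩ := ((eventually_ge_atTop (0 : ℝ)).and (ht.eventually_lt_atBot 0)).exists
  obtain ⟨t, -, h7⟩ := intermediate_value_Icc' hT0 (P.continuous.continuousOn)
    (⟨hT.le, by rw [h0]; exact hc⟩ : (0 : ℝ) ∈ Set.Icc (P.eval T) (P.eval 0))
  exact hne t h7

theorem coeff_eq_of_eval_eq_sqrt_pow {P : ℝ[X]} {k : ℕ} {c δ : ℝ} (hP : P.natDegree ≤ k)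
    (hδ : 0 < δ) (h : ∀ t, 0 ≤ t → t < δ → P.eval t = c * √(1 + t ^ 2) ^ k) :
    P.coeff k = c ∧ (Odd k → c = 0) := by
  have h0 : P.eval 0 = c := by simpa using h 0 le_rfl hδ
  have hsq : P ^ 2 = C (c ^ 2) * (1 + X ^ 2) ^ k := by
    refine eq_of_infinite_eval_eq _ _ ((Set.Ico_infinite hδ).mono fun t ht => ?_)
    simp only [Set.mem_ofPred_eq, eval_pow, eval_mul, eval_C, eval_add, eval_one, eval_X]
    rw [h t ht.1 ht.2, mul_pow, ← pow_mul, mul_comm k 2, pow_mul, Real.sq_sqrt (by positivity)]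
  have h1 := coeff_eq_of_sq_eq hP h0 hsq
  refine ⟨h1, fun hk => ?_⟩
  have h2 := coeff_eq_of_sq_eq (P := P.comp (-X)) (k := k) (c := c)
    (by simpa [natDegree_comp] using hP) (by simpa using h0) (by
      have := congrArg (fun Q : ℝ[X] => Q.comp (-X)) hsq
      simpa using this)
  rw [show (-X : ℝ[X]) = C (-1) * X by simp, comp_C_mul_X_coeff, h1, hk.neg_one_pow] at h2
  linarith

end Polynomial

end SimilarSections

namespace SimilarSections

open Filter Topology MeasureTheory Pointwise

section TangentField

variable {E : Type*} [NormedAddCommGroup E] [InnerProductSpace ℝ E]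

/-- The positively homogeneous extension of a `C¹` unit tangent vector field on the unit sphere. -/
structure IsTangentField (g : E → E) : Prop where
  smul : ∀ c : ℝ, 0 < c → ∀ x, g (c • x) = c • g x
  norm : ∀ x, ‖g x‖ = ‖x‖
  orth : ∀ x, inner ℝ (g x) x = 0
  contDiffAt : ∀ x, x ≠ 0 → ContDiffAt ℝ 1 g x

namespace IsTangentField

variable {g : E → E} (hg : IsTangentField g)
include hg

theorem hasFDerivAt {x : E} (hx : x ≠ 0) : HasFDerivAt g (fderiv ℝ g x) x :=
  ((hg.contDiffAt x hx).differentiableAt one_ne_zero).hasFDerivAt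

theorem continuousAt_fderiv {x : E} (hx : x ≠ 0) : ContinuousAt (fderiv ℝ g) x :=
  ((hg.contDiffAt x hx).fderiv_right (m := 0) (by simp)).continuousAt

theorem fderiv_smul {c : ℝ} (hc : 0 < c) {x : E} (hx : x ≠ 0) :
    fderiv ℝ g (c • x) = fderiv ℝ g x := by
  have h1 : HasFDerivAt (fun y : E => c • y) (c • ContinuousLinearMap.id ℝ E) x :=
    (hasFDerivAt_id x).const_smul c
  have h2 := (hg.hasFDerivAt (smul_ne_zero hc.ne' hx)).comp x h1
  have h3 : (g ∘ fun y : E => c • y) = fun y => c • g y := funext fun y => hg.smul c hc y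
  rw [h3] at h2
  have h4 := h2.unique ((hg.hasFDerivAt hx).const_smul c)
  have h5 : c • fderiv ℝ g (c • x) = c • fderiv ℝ g x := by
    rw [← h4]; ext v; simp
  exact smul_right_injective _ hc.ne' h5

theorem fderiv_normalize {x : E} (hx : x ≠ 0) : fderiv ℝ g x = fderiv ℝ g (‖x‖⁻¹ • x) :=
  (hg.fderiv_smul (inv_pos.2 (norm_pos_iff.2 hx)) hx).symm

theorem exists_bound [FiniteDimensional ℝ E] {F : Type*} [NormedAddCommGroup F]
    (Φ : (E →L[ℝ] E) → F) (hΦ : Continuous Φ) :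
    ∃ C, ∀ x, x ≠ 0 → ‖Φ (fderiv ℝ g x)‖ ≤ C := by
  have : ProperSpace E := FiniteDimensional.proper ℝ E
  obtain ⟨C, hC⟩ := (isCompact_sphere (0 : E) 1).exists_bound_of_continuousOn
    (f := fun x => Φ (fderiv ℝ g x)) fun x hx =>
      (hΦ.continuousAt.comp (hg.continuousAt_fderiv (by
        rintro rfl; simp at hx))).continuousWithinAt
  refine ⟨C, fun x hx => ?_⟩
  rw [hg.fderiv_normalize hx]
  refine hC _ ?_
  rw [mem_sphere_zero_iff_norm, norm_smul, norm_inv, norm_norm,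
    inv_mul_cancel₀ (norm_ne_zero_iff.2 hx)]

theorem exists_lipschitz [FiniteDimensional ℝ E] :
    ∃ K : ℝ, 1 ≤ K ∧ (∀ x, x ≠ 0 → ‖fderiv ℝ g x‖ ≤ K) ∧ ∀ x y, ‖g x - g y‖ ≤ K * ‖x - y‖ := by
  obtain ⟨C, hC⟩ := hg.exists_bound (fun M => M) continuous_id
  refine ⟨max C 1, le_max_right _ _, fun x hx => (hC x hx).trans (le_max_left _ _), fun x y => ?_⟩
  by_cases h0 : (0 : E) ∈ segment ℝ y x
  · have h1 := dist_add_dist_of_mem_segment h0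
    rw [dist_zero_right, dist_zero_left, dist_eq_norm, norm_sub_rev] at h1
    calc ‖g x - g y‖ ≤ ‖g x‖ + ‖g y‖ := norm_sub_le _ _
      _ = ‖x - y‖ := by rw [hg.norm, hg.norm, ← h1, add_comm]
      _ ≤ _ := le_mul_of_one_le_left (norm_nonneg _) (le_max_right _ _)
  · have hne : ∀ z ∈ segment ℝ y x, z ≠ 0 := fun z hz h => h0 (h ▸ hz)
    exact (convex_segment y x).norm_image_sub_le_of_norm_hasFDerivWithin_le
      (fun z hz => (hg.hasFDerivAt (hne z hz)).hasFDerivWithinAt)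
      (fun z hz => (hC z (hne z hz)).trans (le_max_left _ _))
      (left_mem_segment ℝ y x) (right_mem_segment ℝ y x)

theorem norm_add_smul (x : E) (t : ℝ) : ‖x + t • g x‖ = √(1 + t ^ 2) * ‖x‖ := by
  have h1 : ‖x + t • g x‖ ^ 2 = (1 + t ^ 2) * ‖x‖ ^ 2 := by
    rw [norm_add_sq_real, inner_smul_right, real_inner_comm, hg.orth, norm_smul, hg.norm,
      mul_pow, Real.norm_eq_abs, sq_abs]
    ring
  rw [← Real.sqrt_sq (norm_nonneg (x + t • g x)), h1, Real.sqrt_mul (by positivity),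
    Real.sqrt_sq (norm_nonneg x)]

theorem map_zero : g 0 = 0 := by
  rw [← norm_eq_zero, hg.norm, norm_zero]

end IsTangentField

theorem det_id_add_pos [FiniteDimensional ℝ E] {M : E →L[ℝ] E} (hM : ‖M‖ < 1) :
    0 < (ContinuousLinearMap.id ℝ E + M).det := by
  have hne : ∀ s ∈ Set.Icc (0 : ℝ) 1, (ContinuousLinearMap.id ℝ E + s • M).det ≠ 0 := by
    intro s hs h
    have hu : ¬ IsUnit (ContinuousLinearMap.id ℝ E + s • M).toLinearMap := by
      rw [LinearMap.isUnit_iff_isUnit_det]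
      rw [ContinuousLinearMap.det] at h
      rw [h]
      exact not_isUnit_zero
    refine hu ((LinearMap.isUnit_iff_ker_eq_bot _).2 (LinearMap.ker_eq_bot'.2 fun x hx => ?_))
    have h1 : x + s • M x = 0 := by simpa using hx
    have h2 : ‖x‖ ≤ ‖M‖ * ‖x‖ := by
      calc ‖x‖ = ‖s • M x‖ := by rw [← norm_neg (s • M x), ← eq_neg_of_add_eq_zero_left h1]
        _ ≤ 1 * ‖M x‖ := by
            rw [norm_smul, Real.norm_eq_abs, abs_of_nonneg hs.1]; gcongr; exact hs.2
        _ ≤ ‖M‖ * ‖x‖ := by rw [one_mul]; exact M.le_opNorm x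
    by_contra hx0
    have := norm_pos_iff.2 hx0
    nlinarith
  have hc : ContinuousOn (fun s : ℝ => (ContinuousLinearMap.id ℝ E + s • M).det)
      (Set.Icc 0 1) :=
    (ContinuousLinearMap.continuous_det.comp (by fun_prop)).continuousOn
  by_contra! h
  have h0 : (ContinuousLinearMap.id ℝ E + (0 : ℝ) • M).det = 1 := by
    simp [ContinuousLinearMap.det]
  obtain ⟨s, hs, hs0⟩ := intermediate_value_Icc' zero_le_one hc
    (⟨by simpa using h, by simp only [h0]; exact zero_le_one⟩ : (0 : ℝ) ∈ Set.Icc _ _)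
  exact hne s hs hs0

namespace IsTangentField

variable {g : E → E} (hg : IsTangentField g)
include hg

theorem image_add_smul [FiniteDimensional ℝ E] {K t : ℝ} (ht : 0 ≤ t)
    (hK : ∀ x y, ‖g x - g y‖ ≤ K * ‖x - y‖) (hK0 : 0 ≤ K) (htK : t * K < 1) :
    Function.Injective (fun x => x + t • g x) ∧
    (fun x => x + t • g x) '' (ball 0 1 \ {0}) = √(1 + t ^ 2) • (ball (0 : E) 1 \ {0}) := by
  have : CompleteSpace E := FiniteDimensional.complete ℝ E
  have hl : ∀ x y, ‖t • g x - t • g y‖ ≤ t * K * ‖x - y‖ := fun x y => by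
    rw [← smul_sub, norm_smul, Real.norm_eq_abs, abs_of_nonneg ht, mul_assoc]
    gcongr
    exact hK x y
  have hR : 0 < √(1 + t ^ 2) := by positivity
  refine ⟨fun x y hxy => ?_, ?_⟩
  · by_contra hne
    have h1 := hl y x
    have h2 : x - y = t • g y - t • g x := by
      rw [sub_eq_sub_iff_add_eq_add]
      simpa [add_comm] using hxy
    rw [← h2, norm_sub_rev y x] at h1
    have := norm_pos_iff.2 (sub_ne_zero.2 hne)
    nlinarith
  · have hs : √(1 + t ^ 2) • (ball (0 : E) 1 \ {0}) = ball 0 (√(1 + t ^ 2)) \ {0} := by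
      rw [Set.smul_set_sdiff₀ hR.ne', _root_.smul_ball hR.ne', Set.smul_set_singleton]
      simp [abs_of_pos hR]
    rw [hs]
    ext y
    constructor
    · rintro ⟨x, ⟨hx, hx0⟩, rfl⟩
      rw [mem_ball_zero_iff] at hx
      have hx0' := norm_pos_iff.2 hx0
      refine ⟨?_, ?_⟩
      · rw [mem_ball_zero_iff, hg.norm_add_smul]
        nlinarith
      · change x + t • g x ≠ 0
        rw [← norm_ne_zero_iff, hg.norm_add_smul]
        positivity
    · rintro ⟨hy, hy0⟩
      have hcon : ContractingWith ⟨t * K, by positivity⟩ (fun x => y - t • g x) := by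
        refine ⟨by exact_mod_cast htK, LipschitzWith.of_dist_le_mul fun a b => ?_⟩
        rw [dist_eq_norm, dist_eq_norm, sub_sub_sub_cancel_left, ← norm_neg, neg_sub]
        exact hl a b
      have hfix := hcon.fixedPoint_isFixedPt
      set x := hcon.fixedPoint
      have hxy : x + t • g x = y := by
        have h1 : y - t • g x = x := hfix
        rw [← h1]
        nth_rewrite 2 [h1]
        abel
      have hn := hg.norm_add_smul x t
      rw [hxy] at hn
      rw [mem_ball_zero_iff, hn] at hy
      refine ⟨x, ⟨?_, ?_⟩, hxy⟩
      · rw [mem_ball_zero_iff]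
        nlinarith
      · intro hx0
        apply hy0
        rw [Set.mem_singleton_iff, ← norm_eq_zero, hn, Set.mem_singleton_iff.1 hx0, norm_zero,
          mul_zero]

variable [FiniteDimensional ℝ E] [MeasurableSpace E] [BorelSpace E]

theorem integral_pow_det (a : E) (m : ℕ) :
    (∫ x in ball 0 1 \ {0}, (inner ℝ a (g x)) ^ m * (fderiv ℝ g x).det =
      ∫ x in ball 0 1 \ {0}, (inner ℝ a x) ^ m) ∧
    (Odd (m + Module.finrank ℝ E) → ∫ x in ball (0 : E) 1 \ {0}, (inner ℝ a x) ^ m = 0) := by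
  set s : Set E := ball 0 1 \ {0} with hs
  have hsm : MeasurableSet s := measurableSet_ball.diff (measurableSet_singleton 0)
  have hsf : volume s ≠ ⊤ := ((measure_mono Set.sdiff_subset).trans_lt measure_ball_lt_top).ne
  obtain ⟨K, hK1, hK, hKl⟩ := hg.exists_lipschitz
  have hgc : Continuous g := by
    have : LipschitzWith ⟨K, by linarith⟩ g := LipschitzWith.of_dist_le_mul fun x y => by
      rw [dist_eq_norm, dist_eq_norm]; exact hKl x y
    exact this.continuous
  choose p hp1 hp2 hp3 using fun x => exists_polynomial_det (E := E) rfl (fderiv ℝ g x)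
    (inner ℝ a x) (inner ℝ a (g x)) m
  have hInt : ∀ t, IntegrableOn (fun x => (p x).eval t) s := fun t => by
    obtain ⟨C, hC⟩ := hg.exists_bound
      (fun M => (ContinuousLinearMap.id ℝ E + t • M).det)
      (ContinuousLinearMap.continuous_det.comp (by fun_prop))
    simp only [hp2]
    have hcont : ContinuousOn (fun x => (inner ℝ a x + t * inner ℝ a (g x)) ^ m *
        (ContinuousLinearMap.id ℝ E + t • fderiv ℝ g x).det) s := by
      refine ContinuousOn.mul (by fun_prop) fun x hx => ?_
      exact (ContinuousLinearMap.continuous_det.continuousAt.comp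
        (continuousAt_const.add ((hg.continuousAt_fderiv hx.2).const_smul t))).continuousWithinAt
    refine IntegrableOn.of_bound hsf.lt_top (hcont.aestronglyMeasurable hsm)
      ((‖a‖ * (1 + |t|)) ^ m * C) ?_
    filter_upwards [ae_restrict_mem hsm] with x hx
    rw [norm_mul, norm_pow]
    have hx1 : ‖x‖ < 1 := mem_ball_zero_iff.1 hx.1
    gcongr
    · calc ‖inner ℝ a x + t * inner ℝ a (g x)‖ ≤ ‖inner ℝ a x‖ + |t| * ‖inner ℝ a (g x)‖ := by
            refine (norm_add_le _ _).trans ?_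
            rw [norm_mul, Real.norm_eq_abs t]
        _ ≤ ‖a‖ * ‖x‖ + |t| * (‖a‖ * ‖g x‖) := by
            gcongr <;> exact norm_inner_le_norm _ _
        _ ≤ ‖a‖ * 1 + |t| * (‖a‖ * 1) := by
            rw [hg.norm]; gcongr
        _ = _ := by ring
    · exact hC x hx.2
  obtain ⟨P, hPd, hPe, hPc⟩ := exists_integral_polynomial (μ := volume.restrict s)
    (m + Module.finrank ℝ E + 1) p (fun x => hp1 x) hInt
  have hPn : P.natDegree ≤ m + Module.finrank ℝ E := by
    rcases eq_or_ne P 0 with rfl | h0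
    · simp
    · rw [Polynomial.degree_eq_natDegree h0] at hPd
      have : P.natDegree < m + Module.finrank ℝ E + 1 := by exact_mod_cast hPd
      omega
  have key : ∀ t, 0 ≤ t → t < K⁻¹ → P.eval t =
      (∫ x in s, (inner ℝ a x) ^ m) * √(1 + t ^ 2) ^ (m + Module.finrank ℝ E) := by
    intro t ht0 htK
    have htK' : t * K < 1 := by
      rw [← inv_mul_cancel₀ (show K ≠ 0 by linarith)]
      gcongr
    have hR : 0 < √(1 + t ^ 2) := by positivity
    obtain ⟨hinj, himg⟩ := hg.image_add_smul ht0 hKl (by linarith) htK'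
    have h1 := integral_image_eq_integral_abs_det_fderiv_smul volume hsm
      (f := fun x => x + t • g x) (f' := fun x => ContinuousLinearMap.id ℝ E + t • fderiv ℝ g x)
      (fun x hx => ((hasFDerivAt_id x).add
        ((hg.hasFDerivAt hx.2).const_smul t)).hasFDerivWithinAt) hinj.injOn
      (fun x => (inner ℝ a x) ^ m)
    rw [himg] at h1
    have h2 := Measure.setIntegral_comp_smul_of_pos volume (fun x => (inner ℝ a x) ^ m) s hR
    rw [h1] at h2
    simp only [inner_smul_right, mul_pow, smul_eq_mul, inner_add_right] at h2
    rw [integral_const_mul, ← div_eq_inv_mul, eq_div_iff (by positivity)] at h2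
    rw [hPe, pow_add, ← mul_assoc, mul_comm (∫ x in s, _), h2]
    refine setIntegral_congr_fun hsm fun x hx => ?_
    simp only [hp2]
    rw [mul_comm, abs_of_pos]
    refine det_id_add_pos ?_
    rw [norm_smul, Real.norm_eq_abs, abs_of_nonneg ht0]
    exact (mul_le_mul_of_nonneg_left (hK x hx.2) ht0).trans_lt htK'
  obtain ⟨h1, h2⟩ := coeff_eq_of_eval_eq_sqrt_pow hPn (inv_pos.2 (by linarith)) key
  refine ⟨?_, h2⟩
  rw [← h1, hPc]
  exact setIntegral_congr_fun hsm fun x _ => (hp3 x).symm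

theorem even_finrank : Even (Module.finrank ℝ E) := by
  by_contra h
  have h1 := (hg.integral_pow_det 0 0).2 (by simpa using h)
  simp only [pow_zero, integral_const, smul_eq_mul, mul_one, measureReal_restrict_apply_univ] at h1
  rw [measureReal_eq_zero_iff ((measure_mono Set.sdiff_subset).trans_lt measure_ball_lt_top).ne] at h1
  have hnt : Nontrivial E := by
    rw [← Module.finrank_pos_iff (R := ℝ)]
    rcases Nat.eq_zero_or_pos (Module.finrank ℝ E) with h0 | h0
    · simp [h0] at h
    · exact h0
  have hopen : IsOpen (ball (0 : E) 1 \ {0}) := isOpen_ball.sdiff isClosed_singleton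
  obtain ⟨x, hx⟩ := exists_ne (0 : E)
  refine (hopen.measure_pos volume ⟨(2 * ‖x‖)⁻¹ • x, ?_, ?_⟩).ne' h1
  · have := norm_pos_iff.2 hx
    rw [mem_ball_zero_iff, norm_smul, norm_inv, Real.norm_eq_abs, abs_of_pos (by positivity)]
    field_simp
    norm_num
  · have := norm_pos_iff.2 hx
    exact smul_ne_zero (by positivity) hx

end IsTangentField

end TangentField

end SimilarSections

namespace SimilarSections

open Filter Topology MeasureTheory

section Multiplicity

variable {E : Type*} [NormedAddCommGroup E] [NormedSpace ℝ E] [FiniteDimensional ℝ E]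
  [MeasurableSpace E] [BorelSpace E]

theorem tsum_indicator_one_eq_natCast {ι α : Type*} [Countable ι] (t : ι → Set α) {y : α}
    (h : ∑' i, (t i).indicator (fun _ => (1 : ENNReal)) y ≠ ⊤) :
    ∃ k : ℕ, ∑' i, (t i).indicator (fun _ => (1 : ENNReal)) y = k := by
  let : MeasurableSpace ι := ⊤
  have h1 : ∑' i, (t i).indicator (fun _ => (1 : ENNReal)) y
      = Measure.count {i | y ∈ t i} := by
    rw [Measure.count, Measure.sum_apply _ MeasurableSpace.measurableSet_top]
    refine tsum_congr fun i => ?_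
    rw [Measure.dirac_apply' _ MeasurableSpace.measurableSet_top]
    rfl
  rw [h1] at h ⊢
  have hf := Measure.count_apply_lt_top.1 h.lt_top
  exact ⟨_, Measure.count_apply_finite' hf MeasurableSpace.measurableSet_top⟩

theorem exists_multiplicity {D : Set E} {f : E → E} {f' : E → E →L[ℝ] E} (hD : MeasurableSet D)
    (hf : Measurable f) (hf' : ∀ x ∈ D, HasFDerivWithinAt f (f' x) D x)
    (hdet : ∀ x ∈ D, (f' x).det ≠ 0) (μ : Measure E) [μ.IsAddHaarMeasure] :
    ∃ N : E → ENNReal, Measurable N ∧ (∀ y, N y ≠ ⊤ → ∃ k : ℕ, N y = k) ∧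
      ∀ S, MeasurableSet S →
        ∫⁻ x in D ∩ f ⁻¹' S, ENNReal.ofReal |(f' x).det| ∂μ = ∫⁻ y in S, N y ∂μ := by
  classical
  rcases D.eq_empty_or_nonempty with rfl | hne
  · exact ⟨0, measurable_zero, fun y _ => ⟨0, by simp⟩, fun S _ => by simp⟩
  obtain ⟨t, A, htd, htm, hts, hta, htA⟩ := exists_partition_approximatesLinearOn_of_hasFDerivWithinAt
    f D f' hf' (fun M => if h : M.det ≠ 0 then
      (‖((M.toContinuousLinearEquivOfDetNeZero h).symm : E →L[ℝ] E)‖₊ + 1)⁻¹ else 1) (by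
      intro M
      split_ifs <;> positivity)
  have hinj : ∀ i, Set.InjOn f (D ∩ t i) := by
    intro i
    obtain ⟨y, hy, hAy⟩ := htA hne i
    have hd : (A i).det ≠ 0 := hAy ▸ hdet y hy
    have h1 := hta i
    rw [dif_pos hd] at h1
    refine ApproximatesLinearOn.injOn (f' := (A i).toContinuousLinearEquivOfDetNeZero hd) h1 ?_
    rcases subsingleton_or_nontrivial E with hs | hs
    · exact Or.inl hs
    · refine Or.inr ?_
      have := ((A i).toContinuousLinearEquivOfDetNeZero hd).nnnorm_symm_pos
      gcongr
      exact lt_add_one _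
  have hsub : ∀ i, D ∩ t i ⊆ D := fun i => Set.inter_subset_left
  have hDt : ∀ i, MeasurableSet (D ∩ t i) := fun i => hD.inter (htm i)
  have himg : ∀ i, MeasurableSet (f '' (D ∩ t i)) := fun i =>
    measurable_image_of_fderivWithin (hDt i) (fun x hx => (hf' x hx.1).mono (hsub i)) (hinj i)
  refine ⟨fun y => ∑' i, (f '' (D ∩ t i)).indicator (fun _ => 1) y, ?_,
    fun y hy => tsum_indicator_one_eq_natCast _ hy, fun S hS => ?_⟩
  · exact Measurable.ennreal_tsum fun i => measurable_const.indicator (himg i)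
  · rw [lintegral_tsum fun i => (measurable_const.indicator (himg i)).aemeasurable]
    have hU : D ∩ f ⁻¹' S = ⋃ i, (D ∩ t i) ∩ f ⁻¹' S := by
      ext x
      simp only [Set.mem_inter_iff, Set.mem_iUnion]
      constructor
      · rintro ⟨h1, h2⟩
        obtain ⟨i, hi⟩ := Set.mem_iUnion.1 (hts h1)
        exact ⟨i, ⟨h1, hi⟩, h2⟩
      · rintro ⟨i, ⟨h1, -⟩, h2⟩
        exact ⟨h1, h2⟩
    rw [hU, lintegral_iUnion (fun i => (hDt i).inter (hf hS))
      fun i j hij => (htd hij).mono (fun x hx => hx.1.2) (fun x hx => hx.1.2)]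
    refine tsum_congr fun i => ?_
    rw [lintegral_abs_det_fderiv_eq_addHaar_image μ ((hDt i).inter (hf hS))
      (fun x hx => (hf' x hx.1.1).mono fun z hz => hz.1.1)
      ((hinj i).mono Set.inter_subset_left), lintegral_indicator_const (himg i), one_mul,
      Measure.restrict_apply (himg i), Set.image_inter_preimage]

end Multiplicity

section CharFun

theorem hasSum_integral_exp {α : Type*} [MeasurableSpace α] {μ : Measure α} [IsFiniteMeasure μ]
    {u w : α → ℝ} {U W : ℝ} (hu : AEStronglyMeasurable u μ) (hw : AEStronglyMeasurable w μ)
    (hU : ∀ᵐ x ∂μ, |u x| ≤ U) (hW : ∀ᵐ x ∂μ, |w x| ≤ W) :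
    HasSum (fun m : ℕ => Complex.I ^ m / (m.factorial : ℂ) * ((∫ x, u x ^ m * w x ∂μ : ℝ) : ℂ))
      (∫ x, Complex.exp (u x * Complex.I) * w x ∂μ) := by
  have h1 : ∀ m : ℕ, Complex.I ^ m / (m.factorial : ℂ) * ((∫ x, u x ^ m * w x ∂μ : ℝ) : ℂ) =
      ∫ x, Complex.I ^ m / (m.factorial : ℂ) * ((u x ^ m * w x : ℝ) : ℂ) ∂μ := fun m => by
    rw [integral_const_mul, integral_complex_ofReal]
  simp only [h1]
  refine hasSum_integral_of_dominated_convergence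
    (fun m _ => U ^ m / m.factorial * W) (fun m => ?_) (fun m => ?_) ?_ ?_ ?_
  · exact (Complex.continuous_ofReal.comp_aestronglyMeasurable ((hu.pow m).mul hw)).const_mul _
  · filter_upwards [hU, hW] with x h2 h3
    rw [norm_mul, norm_div, norm_pow, Complex.norm_I, one_pow, Complex.norm_natCast,
      Complex.norm_real, norm_mul, norm_pow, Real.norm_eq_abs, Real.norm_eq_abs, ← mul_assoc,
      one_div, inv_mul_eq_div]
    have hU0 : 0 ≤ U := (abs_nonneg _).trans h2
    gcongr
  · exact Eventually.of_forall fun x => (Real.summable_pow_div_factorial U).mul_right W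
  · exact integrable_const _
  · refine Eventually.of_forall fun x => ?_
    have h4 : HasSum (fun m : ℕ => ((u x * Complex.I) ^ m / (m.factorial : ℂ)))
        (Complex.exp (u x * Complex.I)) := by
      rw [Complex.exp_eq_exp_ℂ]
      exact NormedSpace.expSeries_div_hasSum_exp _
    have h5 : (fun m : ℕ => Complex.I ^ m / (m.factorial : ℂ) * ((u x ^ m * w x : ℝ) : ℂ)) =
        fun m : ℕ => (u x * Complex.I) ^ m / (m.factorial : ℂ) * (w x : ℂ) := by
      funext m
      push_cast
      ring
    rw [h5]
    exact h4.mul_right (w x : ℂ)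

end CharFun

end SimilarSections

namespace SimilarSections

open Filter Topology MeasureTheory

section EvenField

variable {E : Type*} [NormedAddCommGroup E] [InnerProductSpace ℝ E] [FiniteDimensional ℝ E]
  [MeasurableSpace E] [BorelSpace E]

theorem lintegral_eq_two_mul_of_even {e : E} (he : e ≠ 0) {h : E → ENNReal} (hm : Measurable h)
    (hev : ∀ x, h (-x) = h x) :
    ∫⁻ x, h x = 2 * ∫⁻ x in {x | 0 < inner ℝ x e}, h x := by
  have hP : MeasurableSet {x : E | 0 < inner ℝ x e} := measurableSet_lt (by fun_prop) (by fun_prop)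
  rw [← lintegral_add_compl h hP, two_mul]
  congr 1
  have h0 : volume ((ℝ ∙ e)ᗮ : Set E) = 0 := by
    refine Measure.addHaar_submodule _ _ fun h => he ?_
    have h1 : e ∈ (ℝ ∙ e)ᗮ := h ▸ Submodule.mem_top
    rw [Submodule.mem_orthogonal_singleton_iff_inner_right] at h1
    exact inner_self_eq_zero.1 h1
  have h1 : ({x : E | 0 < inner ℝ x e}ᶜ : Set E) =ᵐ[volume] Neg.neg ⁻¹' {x | 0 < inner ℝ x e} := by
    rw [ae_eq_set]
    refine ⟨measure_mono_null (fun x hx => ?_) h0, ?_⟩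
    · simp only [Set.mem_sdiff, Set.mem_compl_iff, Set.mem_setOf_eq, not_lt, Set.mem_preimage,
        inner_neg_left, Left.neg_pos_iff] at hx
      rw [SetLike.mem_coe, Submodule.mem_orthogonal_singleton_iff_inner_left]
      exact le_antisymm hx.1 hx.2
    · rw [Set.sdiff_eq_empty.2, measure_empty]
      intro x hx
      simp only [Set.mem_preimage, Set.mem_setOf_eq, inner_neg_left, Left.neg_pos_iff,
        Set.mem_compl_iff, not_lt] at hx ⊢
      exact hx.le
  rw [setLIntegral_congr h1, ← (Measure.measurePreserving_neg volume).setLIntegral_comp_preimage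
    hP hm]
  simp only [hev]

namespace IsTangentField

variable {g : E → E} (hg : IsTangentField g)
include hg

omit [MeasurableSpace E] [BorelSpace E] in
theorem continuous : Continuous g := by
  obtain ⟨K, hK1, -, hKl⟩ := hg.exists_lipschitz
  have : LipschitzWith ⟨K, by linarith⟩ g := LipschitzWith.of_dist_le_mul fun x y => by
    rw [dist_eq_norm, dist_eq_norm]; exact hKl x y
  exact this.continuous

theorem det_neg_of_even (hev : ∀ x, g (-x) = g x) (x : E) :
    (fderiv ℝ g (-x)).det = (fderiv ℝ g x).det := by
  rcases eq_or_ne x 0 with rfl | hx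
  · rw [neg_zero]
  have h1 : (g ∘ fun y => -y) = g := funext hev
  have h2 : fderiv ℝ g (-x) = - fderiv ℝ g x := by
    have h3 := (hg.hasFDerivAt (neg_ne_zero.2 hx)).comp x (hasFDerivAt_id x).neg
    rw [show (g ∘ Neg.neg) = g from h1] at h3
    rw [← h3.unique (hg.hasFDerivAt hx)]
    ext v
    simp
  rw [h2, ContinuousLinearMap.det, ContinuousLinearMap.det]
  have h3 : ((-fderiv ℝ g x : E →L[ℝ] E) : E →ₗ[ℝ] E) = (-1 : ℝ) • (fderiv ℝ g x : E →ₗ[ℝ] E) := by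
    ext; simp
  rw [h3, LinearMap.det_smul, hg.even_finrank.neg_one_pow, one_mul]

omit hg in
theorem measurable_det_fderiv : Measurable fun x => (fderiv ℝ g x).det := by
  have : CompleteSpace E := FiniteDimensional.complete ℝ E
  exact ContinuousLinearMap.continuous_det.measurable.comp (measurable_fderiv ℝ g)

theorem exists_even_multiplicity [Nontrivial E] (hev : ∀ x, g (-x) = g x) {σ : ℝ} (hσ : |σ| = 1) :
    ∃ N : E → ENNReal, Measurable N ∧ (∀ y, N y ≠ ⊤ → ∃ k : ℕ, N y = k) ∧
      ∀ S, MeasurableSet S →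
        ∫⁻ x in (ball 0 1 \ {0}) ∩ g ⁻¹' S, ENNReal.ofReal (σ * (fderiv ℝ g x).det) =
          2 * ∫⁻ y in S, N y := by
  obtain ⟨e, he⟩ := exists_ne (0 : E)
  set s : Set E := ball 0 1 \ {0} with hs
  have hsm : MeasurableSet s := measurableSet_ball.diff (measurableSet_singleton 0)
  have hw := measurable_det_fderiv (g := g)
  have hgm := hg.continuous.measurable
  have hP : MeasurableSet {x : E | 0 < inner ℝ x e} := measurableSet_lt (by fun_prop) (by fun_prop)
  have hQ : MeasurableSet {x : E | 0 < σ * (fderiv ℝ g x).det} :=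
    measurableSet_lt (by fun_prop) (hw.const_mul σ)
  obtain ⟨N, hN1, hN2, hN3⟩ := exists_multiplicity
    (D := s ∩ {x : E | 0 < inner ℝ x e} ∩ {x : E | 0 < σ * (fderiv ℝ g x).det})
    (f := g) (f' := fderiv ℝ g)
    ((hsm.inter hP).inter hQ) hgm (fun x hx => (hg.hasFDerivAt hx.1.1.2).hasFDerivWithinAt)
    (fun x hx h => by simpa [h] using hx.2) volume
  refine ⟨N, hN1, hN2, fun S hS => ?_⟩
  have hsS := hsm.inter (hgm hS)
  have hwm : Measurable fun x => ENNReal.ofReal (σ * (fderiv ℝ g x).det) :=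
    (hw.const_mul σ).ennreal_ofReal
  rw [← hN3 S hS, ← lintegral_indicator hsS, lintegral_eq_two_mul_of_even he]
  · congr 1
    rw [← lintegral_indicator hP, ← lintegral_indicator (((hsm.inter hP).inter hQ).inter (hgm hS))]
    refine lintegral_congr fun x => ?_
    by_cases h1 : 0 < inner ℝ x e <;> by_cases h2 : x ∈ s <;> by_cases h3 : x ∈ g ⁻¹' S <;>
      by_cases h4 : 0 < σ * (fderiv ℝ g x).det <;>
      simp only [Set.indicator, Set.mem_inter_iff, Set.mem_setOf_eq, h1, h2, h3, h4, and_self,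
        and_true, and_false, false_and, if_true, if_false]
    · rw [← abs_of_pos h4, abs_mul, hσ, one_mul]
    · exact ENNReal.ofReal_of_nonpos (not_lt.1 h4)
  · exact hwm.indicator hsS
  · intro x
    have h1 : -x ∈ s ↔ x ∈ s := by simp [hs]
    have h2 : -x ∈ s ∩ g ⁻¹' S ↔ x ∈ s ∩ g ⁻¹' S := by
      rw [Set.mem_inter_iff, Set.mem_inter_iff, h1, Set.mem_preimage, hev, Set.mem_preimage]
    by_cases h3 : x ∈ s ∩ g ⁻¹' S
    · rw [Set.indicator_of_mem h3, Set.indicator_of_mem (h2.2 h3), hg.det_neg_of_even hev]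
    · rw [Set.indicator_of_notMem h3, Set.indicator_of_notMem (h2.not.2 h3)]

theorem map_withDensity_eq :
    ((volume.restrict (ball 0 1 \ {0})).withDensity
      fun x => ENNReal.ofReal (fderiv ℝ g x).det).map g =
    ((volume.restrict (ball 0 1 \ {0})).withDensity
      fun x => ENNReal.ofReal (-(fderiv ℝ g x).det)).map g + volume.restrict (ball 0 1 \ {0}) := by
  have : CompleteSpace E := FiniteDimensional.complete ℝ E
  set s : Set E := ball 0 1 \ {0} with hs
  have hsm : MeasurableSet s := measurableSet_ball.diff (measurableSet_singleton 0)
  have hsf : volume s ≠ ⊤ := ((measure_mono Set.sdiff_subset).trans_lt measure_ball_lt_top).ne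
  set ν := (volume : Measure E).restrict s with hν
  have : IsFiniteMeasure ν := ⟨by rw [hν, Measure.restrict_apply_univ]; exact hsf.lt_top⟩
  have hgm := hg.continuous.measurable
  set w : E → ℝ := fun x => (fderiv ℝ g x).det with hwdef
  have hw : Measurable w := measurable_det_fderiv (g := g)
  obtain ⟨C, hC⟩ := hg.exists_bound (fun M => M.det) ContinuousLinearMap.continuous_det
  have hCν : ∀ᵐ x ∂ν, |w x| ≤ C := by
    filter_upwards [ae_restrict_mem hsm] with x hx using hC x hx.2
  have hwi : Integrable w ν := Integrable.of_bound hw.aestronglyMeasurable C hCν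
  have : IsFiniteMeasure (ν.withDensity fun x => ENNReal.ofReal (w x)) :=
    isFiniteMeasure_withDensity_ofReal hwi.2
  have : IsFiniteMeasure (ν.withDensity fun x => ENNReal.ofReal (-w x)) :=
    isFiniteMeasure_withDensity_ofReal hwi.neg.2
  refine Measure.ext_of_charFun (funext fun t => ?_)
  have hcf : ∀ v : E → ℝ, Measurable v →
      charFun ((ν.withDensity fun x => ENNReal.ofReal (v x)).map g) t =
        ∫ x, Complex.exp (((inner ℝ (g x) t : ℝ) : ℂ) * Complex.I) * ((max (v x) 0 : ℝ) : ℂ) ∂ν := by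
    intro v hv
    rw [charFun_apply, integral_map hgm.aemeasurable (by fun_prop),
      integral_withDensity_eq_integral_toReal_smul hv.ennreal_ofReal
        (Eventually.of_forall fun x => ENNReal.ofReal_lt_top)]
    refine integral_congr_ae (Eventually.of_forall fun x => ?_)
    simp only [ENNReal.toReal_ofReal', Complex.real_smul]
    ring
  have hInt : ∀ v : E → ℝ, Integrable v ν → Integrable (fun x =>
      Complex.exp (((inner ℝ (g x) t : ℝ) : ℂ) * Complex.I) * (v x : ℂ)) ν := by
    intro v hv
    refine (hv.ofReal (𝕜 := ℂ)).bdd_mul (c := 1) ?_ (Eventually.of_forall fun x => ?_)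
    · exact (by fun_prop : Measurable _).aestronglyMeasurable
    · rw [Complex.norm_exp_ofReal_mul_I]
  have hadd : charFun ((ν.withDensity fun x => ENNReal.ofReal (-w x)).map g + ν) t =
      charFun ((ν.withDensity fun x => ENNReal.ofReal (-w x)).map g) t + charFun ν t := by
    simp only [charFun_apply]
    rw [integral_add_measure] <;>
    · refine Integrable.of_bound (by fun_prop) 1 (Eventually.of_forall fun x => ?_)
      rw [Complex.norm_exp_ofReal_mul_I]
  rw [hadd, hcf _ hw, hcf (fun x => -w x) hw.neg, ← sub_eq_iff_eq_add', ← integral_sub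
    (hInt _ (hwi.pos_part)) (hInt _ (hwi.neg_part))]
  have hu : ∀ᵐ x ∂ν, |inner ℝ (g x) t| ≤ ‖t‖ := by
    filter_upwards [ae_restrict_mem hsm] with x hx
    have hx1 : ‖x‖ < 1 := mem_ball_zero_iff.1 hx.1
    refine (abs_real_inner_le_norm _ _).trans ?_
    rw [hg.norm]
    exact mul_le_of_le_one_left (norm_nonneg _) hx1.le
  have hu' : ∀ᵐ x ∂ν, |inner ℝ x t| ≤ ‖t‖ := by
    filter_upwards [ae_restrict_mem hsm] with x hx
    have hx1 : ‖x‖ < 1 := mem_ball_zero_iff.1 hx.1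
    refine (abs_real_inner_le_norm _ _).trans ?_
    exact mul_le_of_le_one_left (norm_nonneg _) hx1.le
  have S1 := hasSum_integral_exp (μ := ν) (u := fun x => inner ℝ (g x) t) (w := w)
    (by fun_prop) hw.aestronglyMeasurable hu hCν
  have S2 := hasSum_integral_exp (μ := ν) (u := fun x => inner ℝ x t) (w := fun _ => 1) (W := 1)
    (by fun_prop) (by fun_prop) hu' (by simp)
  have hmom : ∀ m : ℕ, ∫ x, inner ℝ (g x) t ^ m * w x ∂ν = ∫ x, inner ℝ x t ^ m * 1 ∂ν :=
    fun m => by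
      have := (hg.integral_pow_det t m).1
      simp only [mul_one]
      simpa only [real_inner_comm t] using this
  simp only [hmom] at S1
  have h9 := S1.unique S2
  rw [charFun_apply]
  simp only [Complex.ofReal_one, mul_one] at h9
  rw [← h9]
  refine integral_congr_ae (Eventually.of_forall fun x => ?_)
  simp only
  rw [← mul_sub, ← Complex.ofReal_sub, max_zero_sub_max_neg_zero_eq_self]

theorem not_even [Nontrivial E] (hev : ∀ x, g (-x) = g x) : False := by
  set s : Set E := ball 0 1 \ {0} with hs
  have hsm : MeasurableSet s := measurableSet_ball.diff (measurableSet_singleton 0)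
  have hsf : volume s ≠ ⊤ := ((measure_mono Set.sdiff_subset).trans_lt measure_ball_lt_top).ne
  have hgm := hg.continuous.measurable
  obtain ⟨N, hN1, hN2, hN3⟩ := hg.exists_even_multiplicity hev (σ := 1) (by simp)
  obtain ⟨M, hM1, hM2, hM3⟩ := hg.exists_even_multiplicity hev (σ := -1) (by simp)
  simp only [one_mul, neg_one_mul] at hN3 hM3
  have hmap := hg.map_withDensity_eq
  have key : ∀ S, MeasurableSet S → 2 * ∫⁻ y in S, N y =
      2 * (∫⁻ y in S, M y) + ∫⁻ y in S, s.indicator (fun _ => 1) y := by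
    intro S hS
    rw [← hN3 S hS, ← hM3 S hS]
    have h1 := congrArg (fun μ : Measure E => μ S) hmap
    simp only [Measure.add_apply] at h1
    rw [Measure.map_apply hgm hS, Measure.map_apply hgm hS, withDensity_apply _ (hgm hS),
      withDensity_apply _ (hgm hS), Measure.restrict_restrict (hgm hS),
      Measure.restrict_apply hS, Set.inter_comm] at h1
    rw [h1, lintegral_indicator_const hsm, one_mul, Measure.restrict_apply hsm,
      Set.inter_comm S]
  have hae : (fun y => 2 * N y) =ᵐ[volume] fun y => 2 * M y + s.indicator (fun _ => 1) y := by
    refine ae_eq_of_forall_setLIntegral_eq_of_sigmaFinite (hN1.const_mul 2)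
      ((hM1.const_mul 2).add (measurable_const.indicator hsm)) fun S hS _ => ?_
    rw [lintegral_const_mul _ hN1, lintegral_add_left (hM1.const_mul 2), lintegral_const_mul _ hM1]
    exact key S hS
  have hfin : ∫⁻ y, N y ≠ ⊤ := by
    have h1 := hN3 Set.univ MeasurableSet.univ
    rw [Set.preimage_univ, Set.inter_univ, Measure.restrict_univ] at h1
    obtain ⟨C, hC⟩ := hg.exists_bound (fun M => M.det) ContinuousLinearMap.continuous_det
    have h2 : ∫⁻ x in s, ENNReal.ofReal (fderiv ℝ g x).det < ⊤ := by
      calc ∫⁻ x in s, ENNReal.ofReal (fderiv ℝ g x).det ≤ ∫⁻ x in s, ENNReal.ofReal C := by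
            refine setLIntegral_mono measurable_const fun x hx => ?_
            exact ENNReal.ofReal_le_ofReal ((le_abs_self _).trans (hC x hx.2))
        _ < ⊤ := by
            rw [setLIntegral_const]
            exact ENNReal.mul_lt_top ENNReal.ofReal_lt_top hsf.lt_top
    intro h3
    rw [h1, h3] at h2
    simp at h2
  have hpos : 0 < volume s := by
    obtain ⟨x, hx⟩ := exists_ne (0 : E)
    have hx' := norm_pos_iff.2 hx
    refine (isOpen_ball.sdiff isClosed_singleton).measure_pos volume ⟨(2 * ‖x‖)⁻¹ • x, ?_, ?_⟩
    · rw [mem_ball_zero_iff, norm_smul, norm_inv, Real.norm_eq_abs, abs_of_pos (by positivity)]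
      field_simp
      norm_num
    · exact smul_ne_zero (by positivity) hx
  have hall := hae.and (ae_lt_top hN1 hfin)
  obtain ⟨y, hys, hy1, hy2⟩ : ∃ y ∈ s, (2 * N y = 2 * M y + s.indicator (fun _ => 1) y) ∧ N y < ⊤ := by
    by_contra! hcon
    have : volume s = 0 := by
      refine measure_mono_null (fun y hy => ?_) hall
      simp only [Set.mem_compl_iff, Set.mem_setOf_eq, not_and, not_lt]
      exact fun h => hcon y hy h
    exact hpos.ne' this
  obtain ⟨a, ha⟩ := hN2 y hy2.ne
  rw [Set.indicator_of_mem hys] at hy1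
  have hMf : M y ≠ ⊤ := by
    intro h
    rw [ha, h] at hy1
    simp at hy1
    exact absurd hy1 (ENNReal.mul_ne_top (by simp) (by simp))
  obtain ⟨b, hb⟩ := hM2 y hMf
  rw [ha, hb] at hy1
  have : 2 * a = 2 * b + 1 := by exact_mod_cast hy1
  omega

end IsTangentField

end EvenField

end SimilarSections

namespace SimilarSections

open Filter Topology MeasureTheory

section Smoothing

open scoped Manifold ContDiff

variable {E : Type*} [NormedAddCommGroup E] [InnerProductSpace ℝ E] [FiniteDimensional ℝ E]

theorem exists_contDiff_inner_pos {X : E → E} (hX : ContinuousOn X (sphere 0 1))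
    (hne : ∀ x ∈ sphere (0 : E) 1, X x ≠ 0) :
    ∃ Y : E → E, ContDiff ℝ 1 Y ∧ (∀ x ∈ sphere (0 : E) 1, 0 < inner ℝ (Y x) (X x)) ∧
      ((∀ x ∈ sphere (0 : E) 1, X (-x) = X x) → ∀ x, Y (-x) = Y x) := by
  obtain ⟨Y, hY⟩ := exists_contMDiffMap_forall_mem_convex_of_local_const (n := 1) 𝓘(ℝ, E) (M := E)
    (t := fun x => {y : E | x ∈ sphere (0 : E) 1 → 0 < inner ℝ y (X x)}) (fun x => by
      intro y hy z hz a b ha hb hab hx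
      rw [inner_add_left, real_inner_smul_left, real_inner_smul_left]
      have h1 := hy hx
      have h2 := hz hx
      rcases ha.eq_or_lt with rfl | ha'
      · have : b = 1 := by linarith
        simpa [this] using h2
      · positivity) (fun x => by
      by_cases hx : x ∈ sphere (0 : E) 1
      · refine ⟨X x, eventually_nhdsWithin_iff.1 ?_⟩
        have h1 : ContinuousWithinAt (fun y => inner ℝ (X x) (X y)) (sphere 0 1) x :=
          continuousWithinAt_const.inner (hX x hx)
        exact h1.eventually (lt_mem_nhds (real_inner_self_pos.2 (hne x hx)))
      · refine ⟨0, ?_⟩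
        filter_upwards [isClosed_sphere.isOpen_compl.mem_nhds hx] with y hy h
        exact absurd h hy)
  have hYs : ContDiff ℝ 1 Y := Y.contMDiff.contDiff
  by_cases hev : ∀ x ∈ sphere (0 : E) 1, X (-x) = X x
  · refine ⟨fun x => Y x + Y (-x), hYs.add (hYs.comp contDiff_neg), fun x hx => ?_, fun _ x => ?_⟩
    · have h1 := hY x hx
      have hx' : -x ∈ sphere (0 : E) 1 := by simpa using hx
      have h2 := hY (-x) hx'
      rw [hev x hx] at h2
      rw [inner_add_left]
      positivity
    · simp [add_comm]
  · exact ⟨Y, hYs, fun x hx => hY x hx, fun h => absurd h hev⟩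

theorem exists_isTangentField {X : E → E} (hX : ContinuousOn X (sphere 0 1))
    (hne : ∀ x ∈ sphere (0 : E) 1, X x ≠ 0) (ho : ∀ x ∈ sphere (0 : E) 1, inner ℝ (X x) x = 0) :
    ∃ g : E → E, IsTangentField g ∧
      ((∀ x ∈ sphere (0 : E) 1, X (-x) = X x) → ∀ x, g (-x) = g x) := by
  obtain ⟨Y, hY1, hY2, hY3⟩ := exists_contDiff_inner_pos hX hne
  set Z : E → E := fun x => Y x - (inner ℝ (Y x) x : ℝ) • x with hZ
  have hZ1 : ContDiff ℝ 1 Z := hY1.sub ((hY1.inner ℝ contDiff_id).smul contDiff_id)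
  have hZ0 : ∀ x ∈ sphere (0 : E) 1, Z x ≠ 0 := fun x hx h => by
    have h1 : inner ℝ (Z x) (X x) = inner ℝ (Y x) (X x) := by
      rw [hZ, inner_sub_left, real_inner_smul_left, real_inner_comm (X x) x, ho x hx, mul_zero, sub_zero]
    rw [h, inner_zero_left] at h1
    exact (hY2 x hx).ne h1
  have hZo : ∀ x ∈ sphere (0 : E) 1, inner ℝ (Z x) x = 0 := fun x hx => by
    rw [mem_sphere_zero_iff_norm] at hx
    rw [hZ, inner_sub_left, real_inner_smul_left, real_inner_self_eq_norm_sq, hx]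
    ring
  have hsph : ∀ x : E, x ≠ 0 → ‖x‖⁻¹ • x ∈ sphere (0 : E) 1 := fun x hx => by
    rw [mem_sphere_zero_iff_norm, norm_smul, norm_inv, norm_norm,
      inv_mul_cancel₀ (norm_ne_zero_iff.2 hx)]
  refine ⟨fun x => ‖x‖ • (‖Z (‖x‖⁻¹ • x)‖⁻¹ • Z (‖x‖⁻¹ • x)), ⟨?_, ?_, ?_, ?_⟩, ?_⟩
  · intro c hc x
    have h1 : ‖c • x‖⁻¹ • c • x = ‖x‖⁻¹ • x := by
      rw [norm_smul, Real.norm_eq_abs, abs_of_pos hc, smul_smul, mul_inv, mul_assoc,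
        mul_comm, mul_assoc, mul_inv_cancel₀ hc.ne', mul_one]
    rw [h1, norm_smul, Real.norm_eq_abs, abs_of_pos hc, mul_smul]
  · intro x
    rcases eq_or_ne x 0 with rfl | hx
    · simp
    rw [norm_smul, norm_smul, norm_norm, norm_inv, norm_norm,
      inv_mul_cancel₀ (norm_ne_zero_iff.2 (hZ0 _ (hsph x hx))), mul_one]
  · intro x
    rcases eq_or_ne x 0 with rfl | hx
    · simp
    have h1 := hZo _ (hsph x hx)
    rw [real_inner_smul_right] at h1
    have h2 := (mul_eq_zero.1 h1).resolve_left (inv_ne_zero (norm_ne_zero_iff.2 hx))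
    rw [real_inner_smul_left, real_inner_smul_left, h2, mul_zero, mul_zero]
  · intro x hx
    have hn : ContDiffAt ℝ 1 (fun y : E => ‖y‖) x := contDiffAt_norm ℝ hx
    have hz : ContDiffAt ℝ 1 (fun y : E => Z (‖y‖⁻¹ • y)) x :=
      hZ1.contDiffAt.comp x ((hn.inv (norm_ne_zero_iff.2 hx)).smul contDiffAt_id)
    have h0 := hZ0 _ (hsph x hx)
    exact hn.smul (((hz.norm ℝ h0).inv (norm_ne_zero_iff.2 h0)).smul hz)
  · intro hev x
    have h1 : Z (‖-x‖⁻¹ • -x) = Z (‖x‖⁻¹ • x) := by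
      rw [norm_neg, smul_neg, hZ]
      simp only [hY3 hev, inner_neg_right, smul_neg, neg_smul, neg_neg]
    rw [norm_neg] at h1
    simp only [norm_neg, h1]

theorem exists_eq_zero_of_odd_finrank (h : Odd (Module.finrank ℝ E)) {X : E → E}
    (hX : ContinuousOn X (sphere 0 1)) (ho : ∀ x ∈ sphere (0 : E) 1, inner ℝ (X x) x = 0) :
    ∃ x ∈ sphere (0 : E) 1, X x = 0 := by
  borelize E
  by_contra! hne
  obtain ⟨g, hg, -⟩ := exists_isTangentField hX hne ho
  exact Nat.not_odd_iff_even.2 hg.even_finrank h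

theorem exists_eq_zero_of_even [Nontrivial E] {X : E → E}
    (hX : ContinuousOn X (sphere 0 1)) (ho : ∀ x ∈ sphere (0 : E) 1, inner ℝ (X x) x = 0)
    (hev : ∀ x ∈ sphere (0 : E) 1, X (-x) = X x) :
    ∃ x ∈ sphere (0 : E) 1, X x = 0 := by
  borelize E
  by_contra! hne
  obtain ⟨g, hg, h⟩ := exists_isTangentField hX hne ho
  exact hg.not_even (h hev)

end Smoothing

end SimilarSections

namespace SimilarSections

open Filter Topology MeasureTheory

section Glue

variable {E : Type*} [NormedAddCommGroup E] [InnerProductSpace ℝ E]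

theorem exists_continuousOn_glue {e : E} {P Q : {w : E // ‖w‖ = 1 ∧ 0 ≤ inner ℝ w e} → E}
    (hP : Continuous P) (hQ : Continuous Q)
    (h : ∀ v v' : {w : E // ‖w‖ = 1 ∧ 0 ≤ inner ℝ w e}, (v' : E) = -v → P v = Q v') :
    ∃ X : E → E, ContinuousOn X (sphere 0 1) ∧
      ∀ w : {w : E // ‖w‖ = 1 ∧ 0 ≤ inner ℝ w e}, X w = P w ∧ X (-w) = Q w := by
  classical
  set X : E → E := fun x => if h : ‖x‖ = 1 ∧ 0 ≤ inner ℝ x e then P ⟨x, h⟩ else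
    if h' : ‖-x‖ = 1 ∧ 0 ≤ inner ℝ (-x) e then Q ⟨-x, h'⟩ else 0 with hX
  have hX1 : ∀ (x : E) (hx : ‖x‖ = 1 ∧ 0 ≤ inner ℝ x e), X x = P ⟨x, hx⟩ := fun x hx => by
    simp only [hX, dif_pos hx]
  have hX2 : ∀ (x : E) (hx : ‖-x‖ = 1 ∧ 0 ≤ inner ℝ (-x) e), X x = Q ⟨-x, hx⟩ := fun x hx => by
    by_cases hx' : ‖x‖ = 1 ∧ 0 ≤ inner ℝ x e
    · rw [hX1 x hx']
      exact h _ _ rfl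
    · simp only [hX]
      rw [dif_neg hx', dif_pos hx]
  refine ⟨X, ?_, fun w => ⟨hX1 w w.2, ?_⟩⟩
  · have hc1 : ContinuousOn X {x | ‖x‖ = 1 ∧ 0 ≤ inner ℝ x e} := by
      rw [continuousOn_iff_continuous_restrict]
      refine hP.congr fun x => (hX1 x x.2).symm
    have hc2 : ContinuousOn X {x | ‖-x‖ = 1 ∧ 0 ≤ inner ℝ (-x) e} := by
      rw [continuousOn_iff_continuous_restrict]
      have : Continuous fun x : {x : E | ‖-x‖ = 1 ∧ 0 ≤ inner ℝ (-x) e} =>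
          Q ⟨-x, x.2⟩ := hQ.comp (by fun_prop)
      exact this.congr fun x => (hX2 x x.2).symm
    have hcl1 : IsClosed {x : E | ‖x‖ = 1 ∧ 0 ≤ inner ℝ x e} :=
      (isClosed_eq continuous_norm continuous_const).inter
        (isClosed_le (f := fun _ : E => (0 : ℝ)) (g := fun x : E => inner ℝ x e)
          continuous_const (by fun_prop))
    have hcl2 : IsClosed {x : E | ‖-x‖ = 1 ∧ 0 ≤ inner ℝ (-x) e} := hcl1.preimage continuous_neg
    have := hc1.union_of_isClosed hc2 hcl1 hcl2
    · refine this.mono fun x hx => ?_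
      have hx' : ‖x‖ = 1 := by simpa using hx
      rcases le_total 0 (inner ℝ x e) with h0 | h0
      · exact Or.inl ⟨hx', h0⟩
      · exact Or.inr ⟨by rw [norm_neg, hx'], by rw [inner_neg_left]; linarith⟩
  · have h1 : ‖-(-(w : E))‖ = 1 ∧ 0 ≤ inner ℝ (-(-(w : E))) e := by rw [neg_neg]; exact w.2
    rw [hX2 _ h1]
    congr 1
    exact Subtype.ext (neg_neg _)

variable [FiniteDimensional ℝ E]

theorem exists_eq_zero_of_glue {e : E}
    {P Q : {w : E // ‖w‖ = 1 ∧ 0 ≤ inner ℝ w e} → E} (hE : Odd (Module.finrank ℝ E) ∨ P = Q)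
    [Nontrivial E]
    (hP : Continuous P) (hQ : Continuous Q)
    (h : ∀ v v' : {w : E // ‖w‖ = 1 ∧ 0 ≤ inner ℝ w e}, (v' : E) = -v → P v = Q v')
    (hPo : ∀ w, inner ℝ (P w) (w : E) = 0) (hQo : ∀ w, inner ℝ (Q w) (w : E) = 0) :
    ∃ w, P w = 0 ∨ Q w = 0 := by
  obtain ⟨X, hX, hXw⟩ := exists_continuousOn_glue hP hQ h
  have key : ∀ x ∈ sphere (0 : E) 1, ∃ w : {w : E // ‖w‖ = 1 ∧ 0 ≤ inner ℝ w e},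
      x = w ∨ x = -w := fun x hx => by
    have hx' : ‖x‖ = 1 := by simpa using hx
    rcases le_total 0 (inner ℝ x e) with h0 | h0
    · exact ⟨⟨x, hx', h0⟩, Or.inl rfl⟩
    · exact ⟨⟨-x, by rw [norm_neg, hx'], by rw [inner_neg_left]; linarith⟩,
        Or.inr (neg_neg x).symm⟩
  have ho : ∀ x ∈ sphere (0 : E) 1, inner ℝ (X x) x = 0 := fun x hx => by
    obtain ⟨w, rfl | rfl⟩ := key x hx
    · rw [(hXw w).1, hPo]
    · rw [(hXw w).2, inner_neg_right, hQo, neg_zero]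
  obtain ⟨x, hx, hx0⟩ : ∃ x ∈ sphere (0 : E) 1, X x = 0 := by
    rcases hE with hE | rfl
    · exact exists_eq_zero_of_odd_finrank hE hX ho
    · refine exists_eq_zero_of_even hX ho fun x hx => ?_
      obtain ⟨w, rfl | rfl⟩ := key x hx
      · rw [(hXw w).1, (hXw w).2]
      · rw [neg_neg, (hXw w).1, (hXw w).2]
  obtain ⟨w, rfl | rfl⟩ := key x hx
  · exact ⟨w, Or.inl ((hXw w).1 ▸ hx0)⟩
  · exact ⟨w, Or.inr ((hXw w).2 ▸ hx0)⟩

end Glue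

section Isometries

variable {E V : Type*} [NormedAddCommGroup E] [InnerProductSpace ℝ E] [FiniteDimensional ℝ E]
  [NormedAddCommGroup V] [InnerProductSpace ℝ V] [FiniteDimensional ℝ V]

theorem range_eq_orthogonal (hd : Module.finrank ℝ E = Module.finrank ℝ V + 1) (A : V →ₗᵢ[ℝ] E)
    {w : E} (hw : w ≠ 0) (hA : ∀ u, inner ℝ (A u) w = 0) :
    LinearMap.range A.toLinearMap = (ℝ ∙ w)ᗮ := by
  apply Submodule.eq_of_le_of_finrank_eq
  · rintro _ ⟨u, rfl⟩
    rw [Submodule.mem_orthogonal_singleton_iff_inner_left]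
    exact hA u
  · rw [LinearMap.finrank_range_of_inj A.injective]
    have : Fact (Module.finrank ℝ E = Module.finrank ℝ V + 1) := ⟨hd⟩
    rw [Submodule.finrank_orthogonal_span_singleton (n := Module.finrank ℝ V) hw]

theorem exists_apply_eq (hd : Module.finrank ℝ E = Module.finrank ℝ V + 1) (A : V →ₗᵢ[ℝ] E)
    {w : E} (hw : w ≠ 0) (hA : ∀ u, inner ℝ (A u) w = 0) {x : E} (hx : inner ℝ x w = 0) :
    ∃ u, A u = x := by
  have : x ∈ LinearMap.range A.toLinearMap := by
    rw [range_eq_orthogonal hd A hw hA, Submodule.mem_orthogonal_singleton_iff_inner_left]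
    exact hx
  exact this

theorem exists_isometryEquiv_comp (hd : Module.finrank ℝ E = Module.finrank ℝ V + 1)
    (A A' : V →ₗᵢ[ℝ] E) {w : E} (hw : w ≠ 0) (hA : ∀ u, inner ℝ (A u) w = 0)
    (hA' : ∀ u, inner ℝ (A' u) w = 0) : ∃ k : V ≃ₗᵢ[ℝ] V, ∀ u, A' u = A (k u) := by
  choose k hk using fun u => exists_apply_eq hd A hw hA (hA' u)
  let kl : V →ₗᵢ[ℝ] V :=
    { toFun := k
      map_add' := fun x y => A.injective (by simp [hk])
      map_smul' := fun c x => A.injective (by simp [hk])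
      norm_map' := fun x => by
        change ‖k x‖ = ‖x‖
        rw [← A.norm_map, hk, A'.norm_map] }
  exact ⟨kl.toLinearIsometryEquiv rfl, fun u => (hk u).symm⟩

theorem exists_linearIsometry_orthogonal (hd : Module.finrank ℝ E = Module.finrank ℝ V + 1)
    (w : E) : ∃ A : V →ₗᵢ[ℝ] E, ∀ u, inner ℝ (A u) w = 0 := by
  have : Nontrivial E := Module.nontrivial_of_finrank_pos (R := ℝ) (by omega)
  obtain ⟨w', hw', h⟩ : ∃ w' : E, w' ≠ 0 ∧ ∀ x, inner ℝ x w' = 0 → inner ℝ x w = 0 := by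
    by_cases hw : w = 0
    · obtain ⟨z, hz⟩ := exists_ne (0 : E)
      exact ⟨z, hz, by simp [hw]⟩
    · exact ⟨w, hw, fun _ => id⟩
  have : Fact (Module.finrank ℝ E = Module.finrank ℝ V + 1) := ⟨hd⟩
  have h2 := Submodule.finrank_orthogonal_span_singleton (𝕜 := ℝ) (E := E) (n := Module.finrank ℝ V) hw'
  let g : V ≃ₗᵢ[ℝ] ((ℝ ∙ w')ᗮ : Submodule ℝ E) := (stdOrthonormalBasis ℝ V).equiv
    (stdOrthonormalBasis ℝ ((ℝ ∙ w')ᗮ : Submodule ℝ E)) (finCongr h2.symm)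
  refine ⟨(Submodule.subtypeₗᵢ _).comp g.toLinearIsometry, fun u => h _ ?_⟩
  exact (Submodule.mem_orthogonal_singleton_iff_inner_left).1 (g u).2

end Isometries

end SimilarSections

namespace SimilarSections

open Filter Topology MeasureTheory

section Profiles

variable {E V : Type*} [NormedAddCommGroup E] [InnerProductSpace ℝ E] [FiniteDimensional ℝ E]
  [NormedAddCommGroup V] [InnerProductSpace ℝ V] [FiniteDimensional ℝ V]

theorem exists_unit_orthogonal (hd : Module.finrank ℝ E = Module.finrank ℝ V + 1)
    (A : V →ₗᵢ[ℝ] E) : ∃ e : E, ‖e‖ = 1 ∧ ∀ u, inner ℝ (A u) e = 0 := by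
  have h1 : (LinearMap.range A.toLinearMap)ᗮ ≠ ⊥ := by
    intro h
    rw [Submodule.orthogonal_eq_bot_iff] at h
    have := LinearMap.finrank_range_of_inj (f := A.toLinearMap) A.injective
    rw [h, finrank_top] at this
    omega
  obtain ⟨z, hz, hz0⟩ := Submodule.exists_mem_ne_zero_of_ne_bot h1
  refine ⟨‖z‖⁻¹ • z, norm_smul_inv_norm hz0, fun u => ?_⟩
  rw [inner_smul_right, hz (A u) ⟨u, rfl⟩, mul_zero]

variable [MeasurableSpace V] [BorelSpace V]

theorem apply_ne_of_profile_ne (hd : Module.finrank ℝ E = Module.finrank ℝ V + 1) {φ : V → ℝ}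
    (hφ : IsKernel φ) {B : Set E} {ρ R : ℝ} (hB : IsBody B ρ R) {f : V → ℝ} {η : ℝ}
    (A A' : V →ₗᵢ[ℝ] E) {w : E} (hw : w ≠ 0) (hA : ∀ u, inner ℝ (A u) w = 0)
    (hA' : ∀ u, inner ℝ (A' u) w = 0)
    (h : ∀ u, ‖u‖ ≤ 1 → |profile φ (A ⁻¹' B) u - f u| ≤ η)
    (h' : ∀ u, ‖u‖ ≤ 1 → |profile φ (A' ⁻¹' B) u - f u| ≤ η) {y z : V} (hy : ‖y‖ ≤ 1)
    (hz : ‖z‖ ≤ 1) (hyz : 2 * η < |f y - f z|) : A y ≠ A' z := by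
  intro heq
  obtain ⟨k, hk⟩ := exists_isometryEquiv_comp hd A A' hw hA hA'
  have h1 : A' ⁻¹' B = k ⁻¹' (A ⁻¹' B) := by
    ext u
    simp [hk]
  have h2 : y = k z := A.injective (by rw [heq, hk])
  have h3 := h' z hz
  rw [h1, profile_preimage hφ (hB.preimage A), ← h2] at h3
  have h4 := h y hy
  rw [abs_sub_comm] at h4
  have := abs_add_le (f y - profile φ (A ⁻¹' B) y) (profile φ (A ⁻¹' B) y - f z)
  rw [sub_add_sub_cancel] at this
  linarith

/-- The reflection of a point of a closed half-sphere in the axis of that half-sphere. -/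
noncomputable def axisReflection (e : E) (w : {w : E // ‖w‖ = 1 ∧ 0 ≤ inner ℝ w e}) :
    {w : E // ‖w‖ = 1 ∧ 0 ≤ inner ℝ w e} :=
  ⟨-hyperplaneReflection e w, by rw [norm_neg, LinearIsometryEquiv.norm_map]; exact w.2.1, by
    by_cases he : e = 0
    · simp [he]
    have he' : ‖e‖ ^ 2 ≠ 0 := by simpa using he
    have := w.2.2
    rw [hyperplaneReflection_apply, inner_neg_left, inner_sub_left, real_inner_smul_left,
      real_inner_self_eq_norm_sq, real_inner_comm]
    field_simp
    rw [real_inner_comm]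
    linarith⟩

theorem continuous_axisReflection (e : E) : Continuous (axisReflection e) := by
  refine Continuous.subtype_mk ?_ _
  exact ((hyperplaneReflection e).continuous.comp continuous_subtype_val).neg

theorem axisReflection_eq_neg {e : E} {w : {w : E // ‖w‖ = 1 ∧ 0 ≤ inner ℝ w e}}
    (hw : inner ℝ (w : E) e = 0) : (axisReflection e w : E) = -w := by
  change -hyperplaneReflection e (w : E) = -w
  rw [hyperplaneReflection_apply, real_inner_comm, hw]
  simp

theorem axisReflection_inner_eq_zero {e : E} {w v : {w : E // ‖w‖ = 1 ∧ 0 ≤ inner ℝ w e}}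
    (hw : (v : E) = -w) : inner ℝ (w : E) e = 0 := by
  have h1 := w.2.2
  have h2 := v.2.2
  rw [hw, inner_neg_left] at h2
  linarith

theorem axisReflection_eq {e : E} {w v : {w : E // ‖w‖ = 1 ∧ 0 ≤ inner ℝ w e}}
    (hw : (v : E) = -w) : axisReflection e w = v :=
  Subtype.ext ((axisReflection_eq_neg (axisReflection_inner_eq_zero hw)).trans hw.symm)

/-- The orthogonal projection along a unit vector `w`. -/
noncomputable def projAlong (w x : E) : E := x - inner ℝ x w • w

theorem inner_projAlong {w : E} (hw : ‖w‖ = 1) (x : E) : inner ℝ (projAlong w x) w = 0 := by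
  rw [projAlong, inner_sub_left, real_inner_smul_left, real_inner_self_eq_norm_sq, hw]
  ring

theorem norm_projAlong_le {w : E} (hw : ‖w‖ = 1) (x : E) : ‖projAlong w x‖ ≤ ‖x‖ := by
  have h1 : ‖x‖ * ‖x‖ = ‖projAlong w x‖ * ‖projAlong w x‖ + ‖inner ℝ x w • w‖ * ‖inner ℝ x w • w‖ := by
    rw [← norm_add_sq_eq_norm_sq_add_norm_sq_real, projAlong, sub_add_cancel]
    rw [inner_smul_right, inner_projAlong hw, mul_zero]
  nlinarith [norm_nonneg x, norm_nonneg (projAlong w x), norm_nonneg (inner ℝ x w • w)]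

theorem projAlong_eq_self {w x : E} (h : inner ℝ x w = 0) : projAlong w x = x := by
  simp [projAlong, h]

theorem continuous_projAlong {X : Type*} [TopologicalSpace X] {f g : X → E} (hf : Continuous f)
    (hg : Continuous g) : Continuous fun x => projAlong (f x) (g x) := by
  unfold projAlong
  fun_prop

theorem profile_preimage_neg (hd : Module.finrank ℝ E = Module.finrank ℝ V + 1) {φ : V → ℝ}
    (hφ : IsKernel φ) {B : Set E} {ρ R : ℝ} (hB : IsBody B ρ R) (hs : SimilarPreimages V B)
    (A₀ : V →ₗᵢ[ℝ] E) {y : V} (hy : ‖y‖ = 1) :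
    profile φ (A₀ ⁻¹' B) y = profile φ (A₀ ⁻¹' B) (-y) := by
  by_contra hne
  have : Nontrivial E := Module.nontrivial_of_finrank_pos (R := ℝ) (by omega)
  obtain ⟨e, he, hA₀⟩ := exists_unit_orthogonal hd A₀
  set f := profile φ (A₀ ⁻¹' B) with hf
  have hpos : 0 < |f y - f (-y)| := abs_pos.2 (sub_ne_zero.2 hne)
  obtain ⟨σ, hσc, hσn, hσo, hσf⟩ := exists_approximate_section hφ hB hs he A₀ hA₀
    (η := |f y - f (-y)| / 4) (by linarith)
  let S : {w : E // ‖w‖ = 1 ∧ 0 ≤ inner ℝ w e} → (V →ₗᵢ[ℝ] E) := fun w =>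
    ⟨(σ w).toLinearMap, hσn w⟩
  let P : {w : E // ‖w‖ = 1 ∧ 0 ≤ inner ℝ w e} → E := fun w =>
    σ w y + (1 - inner ℝ (w : E) e) • projAlong (w : E) (σ (axisReflection e w) y)
  have hPc : Continuous P := by
    have h1 : Continuous fun w => σ w y := hσc.clm_apply continuous_const
    have h2 : Continuous fun w => σ (axisReflection e w) y := h1.comp (continuous_axisReflection e)
    exact h1.add ((by fun_prop : Continuous fun w : {w : E // ‖w‖ = 1 ∧ 0 ≤ inner ℝ w e} =>
      1 - inner ℝ (w : E) e).smul (continuous_projAlong continuous_subtype_val h2))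
  have hequator : ∀ v v' : {w : E // ‖w‖ = 1 ∧ 0 ≤ inner ℝ w e}, (v' : E) = -v →
      P v = σ v y + σ v' y := fun v v' h => by
    simp only [P]
    rw [axisReflection_eq h, axisReflection_inner_eq_zero h, projAlong_eq_self, sub_zero, one_smul]
    have := hσo v' y
    rw [h, inner_neg_right] at this
    linarith
  obtain ⟨w, hw⟩ := exists_eq_zero_of_glue (e := e) (P := P) (Q := P) (Or.inr rfl) hPc hPc
    (fun v v' h => by
      rw [hequator v v' h, hequator v' v (by rw [h, neg_neg]), add_comm])
    (fun w => by
      simp only [P]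
      rw [inner_add_left, real_inner_smul_left, hσo, inner_projAlong w.2.1, mul_zero, add_zero])
    (fun w => by
      simp only [P]
      rw [inner_add_left, real_inner_smul_left, hσo, inner_projAlong w.2.1, mul_zero, add_zero])
  rw [or_self] at hw
  have hle : inner ℝ (w : E) e ≤ 1 := by
    have := real_inner_le_norm (w : E) e
    rwa [w.2.1, he, mul_one] at this
  rcases w.2.2.eq_or_lt with h0 | h0
  · have hneg : ((axisReflection e w : {w : E // ‖w‖ = 1 ∧ 0 ≤ inner ℝ w e}) : E) = -w :=
      axisReflection_eq_neg h0.symm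
    rw [hequator w _ hneg] at hw
    refine apply_ne_of_profile_ne hd hφ hB (S w) (S (axisReflection e w)) (w := (w : E))
      (f := f) (η := |f y - f (-y)| / 4) ?_ (hσo w) (fun u => ?_) (hσf _) (hσf _) (y := y)
      (z := -y) hy.le (by rw [norm_neg, hy]) (by linarith) ?_
    · rw [← norm_ne_zero_iff, w.2.1]; exact one_ne_zero
    · have := hσo (axisReflection e w) u
      rw [hneg, inner_neg_right] at this
      change inner ℝ (σ (axisReflection e w) u) (w : E) = 0
      linarith
    · change σ w y = σ (axisReflection e w) (-y)
      rw [map_neg]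
      exact eq_neg_of_add_eq_zero_left hw
  · have h1 : ‖σ w y‖ = ‖(1 - inner ℝ (w : E) e) • projAlong (w : E) (σ (axisReflection e w) y)‖ := by
      rw [eq_neg_of_add_eq_zero_left hw, norm_neg]
    rw [hσn, hy, norm_smul, Real.norm_of_nonneg (by linarith)] at h1
    have h2 := norm_projAlong_le w.2.1 (σ (axisReflection e w) y)
    rw [hσn, hy] at h2
    nlinarith [norm_nonneg (projAlong (w : E) (σ (axisReflection e w) y))]

theorem profile_preimage_eq (hd : Module.finrank ℝ E = Module.finrank ℝ V + 1)
    (hE : Odd (Module.finrank ℝ E)) {φ : V → ℝ}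
    (hφ : IsKernel φ) {B : Set E} {ρ R : ℝ} (hB : IsBody B ρ R) (hs : SimilarPreimages V B)
    (A₀ : V →ₗᵢ[ℝ] E) {y z : V} (hy : ‖y‖ = 1) (hz : ‖z‖ = 1) :
    profile φ (A₀ ⁻¹' B) y = profile φ (A₀ ⁻¹' B) z := by
  by_contra hne
  have : Nontrivial E := Module.nontrivial_of_finrank_pos (R := ℝ) (by omega)
  obtain ⟨e, he, hA₀⟩ := exists_unit_orthogonal hd A₀
  set f := profile φ (A₀ ⁻¹' B) with hf
  have hpos : 0 < |f y - f z| := abs_pos.2 (sub_ne_zero.2 hne)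
  obtain ⟨σ, hσc, hσn, hσo, hσf⟩ := exists_approximate_section hφ hB hs he A₀ hA₀
    (η := |f y - f z| / 4) (by linarith)
  let S : {w : E // ‖w‖ = 1 ∧ 0 ≤ inner ℝ w e} → (V →ₗᵢ[ℝ] E) := fun w =>
    ⟨(σ w).toLinearMap, hσn w⟩
  let F : {w : E // ‖w‖ = 1 ∧ 0 ≤ inner ℝ w e} → ℝ → E := fun w a =>
    a • projAlong (w : E) (σ (axisReflection e w) y) - (1 - a) • σ w z
  have hFc : Continuous fun p : {w : E // ‖w‖ = 1 ∧ 0 ≤ inner ℝ w e} × ℝ => F p.1 p.2 := by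
    have h1 : ∀ u, Continuous fun w => σ w u := fun u => hσc.clm_apply continuous_const
    have h2 : Continuous fun w => σ (axisReflection e w) y :=
      (h1 y).comp (continuous_axisReflection e)
    exact (continuous_snd.smul ((continuous_projAlong continuous_subtype_val h2).comp
      continuous_fst)).sub ((continuous_const.sub continuous_snd).smul ((h1 z).comp continuous_fst))
  have hFo : ∀ w a, inner ℝ (F w a) (w : E) = 0 := fun w a => by
    simp only [F]
    rw [inner_sub_left, real_inner_smul_left, real_inner_smul_left, hσo, inner_projAlong w.2.1]
    simp
  have hF0 : ∀ w, F w 0 ≠ 0 := fun w => by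
    simp only [F]
    rw [zero_smul, zero_sub, sub_zero, one_smul, neg_ne_zero, ← norm_ne_zero_iff, hσn, hz]
    exact one_ne_zero
  have hFeq : ∀ (w : {w : E // ‖w‖ = 1 ∧ 0 ≤ inner ℝ w e}) (a : ℝ), inner ℝ (w : E) e = 0 → 0 ≤ a → a ≤ 1 → F w a ≠ 0 := by
    intro w a hw ha0 ha1 h0
    have hneg : ((axisReflection e w : {w : E // ‖w‖ = 1 ∧ 0 ≤ inner ℝ w e}) : E) = -w :=
      axisReflection_eq_neg hw
    have horth : ∀ u, inner ℝ (σ (axisReflection e w) u) (w : E) = 0 := fun u => by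
      have := hσo (axisReflection e w) u
      rw [hneg, inner_neg_right] at this
      linarith
    simp only [F] at h0
    rw [projAlong_eq_self (horth y), sub_eq_zero] at h0
    have h1 := congrArg norm h0
    rw [norm_smul, norm_smul, hσn, hσn, hy, hz, Real.norm_of_nonneg ha0,
      Real.norm_of_nonneg (by linarith)] at h1
    have h2 : a = 1 / 2 := by linarith
    refine apply_ne_of_profile_ne hd hφ hB (S (axisReflection e w)) (S w) (w := (w : E))
      (f := f) (η := |f y - f z| / 4) ?_ horth (hσo w) (hσf _) (hσf _) (y := y)
      (z := z) hy.le hz.le (by linarith) ?_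
    · rw [← norm_ne_zero_iff, w.2.1]; exact one_ne_zero
    · refine smul_right_injective E (by norm_num : (1 / 2 : ℝ) ≠ 0) ?_
      change (1 / 2 : ℝ) • σ (axisReflection e w) y = (1 / 2 : ℝ) • σ w z
      rw [h2] at h0
      rw [h0]
      norm_num
  obtain ⟨s, hs0, hsF⟩ : ∃ s : ℝ, 0 < s ∧ ∀ (w : {w : E // ‖w‖ = 1 ∧ 0 ≤ inner ℝ w e}) (a : ℝ),
      inner ℝ (w : E) e < s → 0 ≤ a → a ≤ 1 →
      F w a ≠ 0 := by
    have hDc : CompactSpace {w : E // ‖w‖ = 1 ∧ 0 ≤ inner ℝ w e} := by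
      refine (isCompact_iff_compactSpace (X := E)).1 (?_ : IsCompact {w : E | ‖w‖ = 1 ∧ 0 ≤ inner ℝ w e})
      refine (isCompact_sphere (0 : E) 1).of_isClosed_subset
        ((isClosed_eq continuous_norm continuous_const).inter
        (isClosed_le (f := fun _ : E => (0 : ℝ)) (g := fun x : E => inner ℝ x e)
          continuous_const (by fun_prop))) fun x hx => by simpa using hx.1
    set Z := (Set.univ ×ˢ Set.Icc (0 : ℝ) 1) ∩
      {p : {w : E // ‖w‖ = 1 ∧ 0 ≤ inner ℝ w e} × ℝ | F p.1 p.2 = 0} with hZ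
    have hZc : IsCompact Z := (isCompact_univ.prod isCompact_Icc).inter_right
      (isClosed_eq hFc continuous_const)
    rcases Z.eq_empty_or_nonempty with hZe | hZn
    · refine ⟨1, one_pos, fun w a _ h0 h1 h => ?_⟩
      have : (w, a) ∈ Z := ⟨⟨trivial, h0, h1⟩, h⟩
      rw [hZe] at this
      exact this
    · obtain ⟨p, hp, hmin⟩ := hZc.exists_isMinOn hZn
        (f := fun p => inner ℝ (p.1 : E) e) (by fun_prop)
      refine ⟨inner ℝ (p.1 : E) e, ?_, fun w a hw h0 h1 h => ?_⟩
      · refine lt_of_le_of_ne p.1.2.2 fun h => ?_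
        exact hFeq p.1 p.2 h.symm hp.1.2.1 hp.1.2.2 hp.2
      · exact absurd (hmin (show (w, a) ∈ Z from ⟨⟨trivial, h0, h1⟩, h⟩)) (not_le.2 hw)
  obtain ⟨w, hw⟩ := exists_eq_zero_of_glue (e := e) (P := fun w => σ w y)
    (Q := fun w => F w (max 0 (1 - inner ℝ (w : E) e / s))) (Or.inl hE)
    (hσc.clm_apply continuous_const) (hFc.comp (continuous_id.prodMk (by fun_prop)))
    (fun v v' h => by
      have h' : (v : E) = -v' := by rw [h, neg_neg]
      simp only [F]
      rw [axisReflection_inner_eq_zero h', axisReflection_eq h', zero_div, sub_zero,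
        max_eq_right zero_le_one, one_smul, sub_self, zero_smul, sub_zero, projAlong_eq_self]
      rw [h, inner_neg_right, hσo, neg_zero])
    (fun w => hσo w y) (fun w => hFo w _)
  rcases hw with hw | hw
  · have := hσn w y
    rw [hw, norm_zero, hy] at this
    exact zero_ne_one this
  · rcases lt_or_ge (inner ℝ (w : E) e) s with h | h
    · refine hsF w _ h (le_max_left _ _) (max_le zero_le_one ?_) hw
      have := div_nonneg w.2.2 hs0.le
      linarith
    · rw [max_eq_left] at hw
      · exact hF0 w hw
      · have := (one_le_div hs0).2 h
        linarith

end Profiles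

end SimilarSections

namespace SimilarSections

open Filter Topology MeasureTheory

section Sections

variable {E V : Type*} [NormedAddCommGroup E] [InnerProductSpace ℝ E] [FiniteDimensional ℝ E]
  [NormedAddCommGroup V] [InnerProductSpace ℝ V] [FiniteDimensional ℝ V]
  [MeasurableSpace V] [BorelSpace V]

theorem smoothed_zero_ne_zero {K : Set V} {ρ R : ℝ} (hK : IsBody K ρ R) {φ : V → ℝ}
    (hφ : IsKernel φ) : smoothed φ K 0 ≠ 0 := by
  have h1 : ∫ t, (ρ * ‖t‖) * φ (0 - t) ≤ smoothed φ K 0 :=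
    integral_mono (hφ.integrable_mul (continuous_const.mul continuous_norm) 0)
      (hφ.integrable_mul (continuous_supp hK.nonempty hK.le) 0) fun t =>
      mul_le_mul_of_nonneg_right (mul_norm_le_supp hK.pos.le hK.le hK.subset t) (hφ.nonneg _)
  have h2 : ∫ t, (ρ * ‖t‖) * φ (0 - t) = ρ * ∫ t, ‖t‖ * φ t := by
    rw [← integral_const_mul]
    congr 1
    ext t
    rw [hφ.radial (0 - t) t (by simp), mul_assoc]
  have := mul_pos hK.pos hφ.pos
  rw [← h2] at this
  exact (this.trans_le h1).ne'

theorem exists_center_preimage [Nontrivial V]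
    (hd : Module.finrank ℝ E = Module.finrank ℝ V + 1) {B : Set E} {ρ R : ℝ}
    (hB : IsBody B ρ R) (hs : SimilarPreimages V B) (A : V →ₗᵢ[ℝ] E) :
    ∃ b : V, ∀ u, supp (A ⁻¹' B) u - supp (A ⁻¹' B) (-u) = inner ℝ b u :=
  have hK := hB.preimage A
  exists_center_of_profile_even hK.nonneg hK.nonempty hK.le
    (fun _ hφ _ hy => profile_preimage_neg hd hφ hB hs A hy)
    fun _ hφ => smoothed_zero_ne_zero hK hφ

theorem exists_sub_mem_preimage [Nontrivial V]
    (hd : Module.finrank ℝ E = Module.finrank ℝ V + 1) {B : Set E} {ρ R : ℝ}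
    (hB : IsBody B ρ R) (hs : SimilarPreimages V B) (A : V →ₗᵢ[ℝ] E) :
    ∃ b : V, ∀ x ∈ A ⁻¹' B, b - x ∈ A ⁻¹' B := by
  have hK := hB.preimage A
  obtain ⟨b, hb⟩ := exists_center_preimage hd hB hs A
  exact ⟨b, fun x hx => sub_mem_of_supp_sub_supp_neg hK.le hK.nonempty hK.compact hK.convex hb hx⟩

theorem exists_preimage_eq_closedBall_of_odd [Nontrivial V]
    (hd : Module.finrank ℝ E = Module.finrank ℝ V + 1) (hE : Odd (Module.finrank ℝ E))
    {B : Set E} {ρ R : ℝ} (hB : IsBody B ρ R) (hs : SimilarPreimages V B) (A : V →ₗᵢ[ℝ] E) :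
    ∃ b : V, ∃ a : ℝ, A ⁻¹' B = closedBall b a := by
  have hK := hB.preimage A
  obtain ⟨b, hb⟩ := exists_center_preimage hd hB hs A
  obtain ⟨y, hy⟩ := exists_norm_eq V (zero_le_one (α := ℝ))
  have h1 : ∀ z, ‖z‖ = 1 → supp (A ⁻¹' B) y + supp (A ⁻¹' B) (-y) =
      supp (A ⁻¹' B) z + supp (A ⁻¹' B) (-z) := fun z hz =>
    exists_supp_add_const_of_profile_const hK.nonneg hK.nonempty hK.le
      (fun _ hφ _ _ hy hz => profile_preimage_eq hd hE hφ hB hs A hy hz)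
      (fun _ hφ => smoothed_zero_ne_zero hK hφ) hy hz
  set a := (supp (A ⁻¹' B) y + supp (A ⁻¹' B) (-y)) / 2 with ha
  have hunit : ∀ z, ‖z‖ = 1 → supp (A ⁻¹' B) z = a + inner ℝ ((1 / 2 : ℝ) • b) z := fun z hz => by
    have h2 := h1 z hz
    have h3 := hb z
    rw [real_inner_smul_left]
    linarith
  refine ⟨(1 / 2 : ℝ) • b, a, eq_closedBall_of_supp hK.le hK.nonempty hK.compact hK.convex ?_ ?_⟩
  · have h2 := mul_norm_le_supp hK.pos.le hK.le hK.subset y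
    have h3 := mul_norm_le_supp hK.pos.le hK.le hK.subset (-y)
    rw [norm_neg] at h3
    have := mul_nonneg hK.pos.le (norm_nonneg y)
    linarith
  · intro u
    rcases eq_or_ne u 0 with rfl | hu
    · have := supp_smul hK.nonempty hK.le (c := 2) two_pos 0
      rw [smul_zero] at this
      rw [norm_zero, inner_zero_right]
      linarith
    · have hu' : 0 < ‖u‖ := norm_pos_iff.2 hu
      have h2 := supp_smul hK.nonempty hK.le hu' (‖u‖⁻¹ • u)
      rw [smul_smul, mul_inv_cancel₀ hu'.ne', one_smul, hunit (‖u‖⁻¹ • u) (by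
        rw [norm_smul, norm_inv, norm_norm, inv_mul_cancel₀ hu'.ne']),
        mul_add, ← real_inner_smul_right, smul_smul, mul_inv_cancel₀ hu'.ne', one_smul] at h2
      rw [h2]
      ring

end Sections

end SimilarSections

namespace SimilarSections

open Filter Topology MeasureTheory

theorem eq_and_eq_of_quadratic_le_iff {m m' t t' : ℝ} (ht : 0 < t) (ht' : 0 < t')
    (h : ∀ s : ℝ, s ^ 2 - 2 * (s * m) ≤ t ↔ s ^ 2 - 2 * (s * m') ≤ t') : t = t' ∧ m = m' := by
  have key : ∀ m t : ℝ, 0 < t → {s : ℝ | s ^ 2 - 2 * (s * m) ≤ t} =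
      Set.Icc (m - √(m ^ 2 + t)) (m + √(m ^ 2 + t)) := fun m t ht => by
    ext s
    have h1 : s ^ 2 - 2 * (s * m) ≤ t ↔ (s - m) ^ 2 ≤ m ^ 2 + t := by
      constructor <;> intro h <;> linarith
    rw [Set.mem_setOf_eq, h1, Real.sq_le (by positivity), Set.mem_Icc]
    constructor <;> rintro ⟨h2, h3⟩ <;> constructor <;> linarith
  have h1 := (key m t ht).symm.trans ((Set.ext h : {s : ℝ | _} = {s : ℝ | _}).trans (key m' t' ht'))
  have hp : 0 < √(m ^ 2 + t) := Real.sqrt_pos.2 (by positivity)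
  obtain ⟨h2, h3⟩ := (Set.Icc_eq_Icc_iff (by linarith)).1 h1
  have h4 : m = m' := by linarith
  have h5 : √(m ^ 2 + t) = √(m' ^ 2 + t') := by linarith
  rw [Real.sqrt_inj (by positivity) (by positivity), h4] at h5
  exact ⟨by linarith, h4⟩

section Balls

variable {E V : Type*} [NormedAddCommGroup E] [InnerProductSpace ℝ E] [FiniteDimensional ℝ E]
  [NormedAddCommGroup V] [InnerProductSpace ℝ V] [FiniteDimensional ℝ V]

theorem exists_ne_zero_orthogonal_pair (hE : 3 ≤ Module.finrank ℝ E) (x y : E) :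
    ∃ w : E, w ≠ 0 ∧ inner ℝ x w = 0 ∧ inner ℝ y w = 0 := by
  have h1 : (Submodule.span ℝ {x, y})ᗮ ≠ ⊥ := by
    intro h
    rw [Submodule.orthogonal_eq_bot_iff] at h
    have h2 : Module.finrank ℝ (Submodule.span ℝ {x, y}) ≤ 2 := by
      classical
      have := finrank_span_finset_le_card (R := ℝ) ({x, y} : Finset E)
      rw [Finset.coe_pair] at this
      exact this.trans Finset.card_le_two
    rw [h, finrank_top] at h2
    omega
  obtain ⟨w, hw, hw0⟩ := Submodule.exists_mem_ne_zero_of_ne_bot h1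
  exact ⟨w, hw0, hw _ (Submodule.subset_span (by simp)), hw _ (Submodule.subset_span (by simp))⟩

theorem exists_linearIsometry_pair (hd : Module.finrank ℝ E = Module.finrank ℝ V + 1)
    (hV : 2 ≤ Module.finrank ℝ V) (x y : E) :
    ∃ A : V →ₗᵢ[ℝ] E, ∃ u v : V, A u = x ∧ A v = y := by
  obtain ⟨w, hw, hx, hy⟩ := exists_ne_zero_orthogonal_pair (E := E) (by omega) x y
  obtain ⟨A, hA⟩ := exists_linearIsometry_orthogonal (V := V) hd w
  obtain ⟨u, hu⟩ := exists_apply_eq hd A hw hA hx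
  obtain ⟨v, hv⟩ := exists_apply_eq hd A hw hA hy
  exact ⟨A, u, v, hu, hv⟩

theorem exists_common_unit (hd : Module.finrank ℝ E = Module.finrank ℝ V + 1)
    (hV : 2 ≤ Module.finrank ℝ V) (A A' : V →ₗᵢ[ℝ] E) :
    ∃ u v : V, ‖u‖ = 1 ∧ A u = A' v := by
  obtain ⟨e, he, hA⟩ := exists_unit_orthogonal hd A
  obtain ⟨e', he', hA'⟩ := exists_unit_orthogonal hd A'
  obtain ⟨w, hw, h, h'⟩ := exists_ne_zero_orthogonal_pair (E := E) (by omega) e e'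
  have hne : ∀ {e : E}, ‖e‖ = 1 → e ≠ 0 := fun h => by
    rw [← norm_ne_zero_iff, h]
    exact one_ne_zero
  obtain ⟨u, hu⟩ := exists_apply_eq hd A (hne he) hA
    (x := ‖w‖⁻¹ • w) (by rw [real_inner_smul_left, real_inner_comm, h, mul_zero])
  obtain ⟨v, hv⟩ := exists_apply_eq hd A' (hne he') hA'
    (x := ‖w‖⁻¹ • w) (by rw [real_inner_smul_left, real_inner_comm, h', mul_zero])
  refine ⟨u, v, ?_, hu.trans hv.symm⟩
  rw [← A.norm_map, hu, norm_smul, norm_inv, norm_norm, inv_mul_cancel₀ (norm_ne_zero_iff.2 hw)]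

/-- If every section of a body by a hyperplane through the origin is a ball, so is the body. -/
theorem eq_closedBall_of_sections (hd : Module.finrank ℝ E = Module.finrank ℝ V + 1)
    (hV : 2 ≤ Module.finrank ℝ V) {B : Set E} {ρ R : ℝ} (hB : IsBody B ρ R)
    (h : ∀ A : V →ₗᵢ[ℝ] E, ∃ b : V, ∃ a : ℝ, A ⁻¹' B = closedBall b a) :
    ∃ (c : E) (r : ℝ), 0 < r ∧ B = closedBall c r := by
  have : Nontrivial V := Module.nontrivial_of_finrank_pos (R := ℝ) (by omega)
  have h1 : ∀ A : V →ₗᵢ[ℝ] E, ∃ c : E, ∃ t : ℝ, 0 < t ∧ ∀ v, A v ∈ B ↔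
      ‖A v‖ ^ 2 - 2 * inner ℝ c (A v) ≤ t := fun A => by
    obtain ⟨b, a, hba⟩ := h A
    have ha : 0 ≤ a := by
      have : (0 : V) ∈ A ⁻¹' B := (hB.preimage A).subset (by simp [hB.pos.le])
      rw [hba, mem_closedBall] at this
      exact dist_nonneg.trans this
    have hiff : ∀ v, A v ∈ B ↔ ‖A v‖ ^ 2 - 2 * inner ℝ (A b) (A v) ≤ a ^ 2 - ‖b‖ ^ 2 := fun v => by
      change v ∈ A ⁻¹' B ↔ _
      rw [hba, mem_closedBall, dist_eq_norm, ← sq_le_sq₀ (norm_nonneg _) ha,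
        norm_sub_sq_real, A.norm_map, A.inner_map_map, real_inner_comm]
      constructor <;> intro h <;> linarith
    refine ⟨A b, a ^ 2 - ‖b‖ ^ 2, ?_, hiff⟩
    obtain ⟨u, hu⟩ := exists_norm_eq V hB.pos.le
    have e1 := (hiff u).1 (hB.subset (by simp [hu]))
    have e2 := (hiff (-u)).1 (hB.subset (by simp [hu]))
    rw [map_neg, norm_neg, inner_neg_right] at e2
    rw [A.norm_map, hu] at e1 e2
    have := pow_pos hB.pos 2
    linarith
  choose c t ht hct using h1
  have h2 : ∀ (A A' : V →ₗᵢ[ℝ] E) (u v : V), ‖u‖ = 1 → A u = A' v →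
      t A = t A' ∧ inner ℝ (c A) (A u) = inner ℝ (c A') (A u) := fun A A' u v hu huv => by
    refine eq_and_eq_of_quadratic_le_iff (ht A) (ht A') fun s => ?_
    have e1 := hct A (s • u)
    have e2 := hct A' (s • v)
    rw [map_smul] at e1 e2
    rw [← huv, e1, norm_smul, real_inner_smul_right, real_inner_smul_right, A.norm_map, hu,
      mul_one, Real.norm_eq_abs, sq_abs] at e2
    exact e2
  obtain ⟨A₀, -⟩ := exists_linearIsometry_orthogonal (V := V) hd (0 : E)
  have h3 : ∀ A, t A = t A₀ := fun A => by
    obtain ⟨u, v, hu, huv⟩ := exists_common_unit hd hV A A₀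
    exact (h2 A A₀ u v hu huv).1
  have h4 : ∀ (A A' : V →ₗᵢ[ℝ] E) (u v : V), A u = A' v →
      inner ℝ (c A) (A u) = inner ℝ (c A') (A u) := fun A A' u v huv => by
    rcases eq_or_ne u 0 with rfl | hu
    · simp
    · have := (h2 A A' (‖u‖⁻¹ • u) (‖u‖⁻¹ • v) (by
        rw [norm_smul, norm_inv, norm_norm, inv_mul_cancel₀ (norm_ne_zero_iff.2 hu)])
        (by rw [map_smul, map_smul, huv])).2
      rw [map_smul, real_inner_smul_right, real_inner_smul_right] at this
      exact mul_left_cancel₀ (inv_ne_zero (norm_ne_zero_iff.2 hu)) this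
  choose S p q hSp hSq using fun x : E => exists_linearIsometry_pair (V := V) hd hV x x
  have h5 : ∀ (A : V →ₗᵢ[ℝ] E) (u : V), inner ℝ (c A) (A u) = inner ℝ (c (S (A u))) (A u) :=
    fun A u => h4 A (S (A u)) u (p (A u)) (hSp _).symm
  let ℓ : E →ₗ[ℝ] ℝ :=
    { toFun := fun x => inner ℝ (c (S x)) x
      map_add' := fun x y => by
        obtain ⟨A, u, v, rfl, rfl⟩ := exists_linearIsometry_pair (V := V) hd hV x y
        rw [← h5, ← h5, ← map_add, ← h5, map_add, inner_add_right]
      map_smul' := fun s x => by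
        obtain ⟨A, u, v, rfl, -⟩ := exists_linearIsometry_pair (V := V) hd hV x x
        rw [← h5, ← map_smul, ← h5, map_smul, inner_smul_right]
        rfl }
  set d := (InnerProductSpace.toDual ℝ E).symm (LinearMap.toContinuousLinearMap ℓ) with hdd
  have hd' : ∀ x, inner ℝ d x = inner ℝ (c (S x)) x := fun x => by
    rw [hdd, InnerProductSpace.toDual_symm_apply]
    rfl
  have hpos : 0 < t A₀ + ‖d‖ ^ 2 := by have := ht A₀; positivity
  refine ⟨d, √(t A₀ + ‖d‖ ^ 2), Real.sqrt_pos.2 hpos, ?_⟩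
  ext x
  have := hct (S x) (p x)
  rw [hSp, h3, ← hd'] at this
  rw [this, mem_closedBall, dist_eq_norm, Real.le_sqrt (norm_nonneg _) hpos.le, norm_sub_sq_real,
    real_inner_comm]
  constructor <;> intro h <;> linarith

theorem SimilarPreimages.exists_eq_closedBall {B : Set E} (hs : SimilarPreimages V B)
    {A : V →ₗᵢ[ℝ] E} {b : V} {a : ℝ} (h : A ⁻¹' B = closedBall b a) (A' : V →ₗᵢ[ℝ] E) :
    ∃ b' : V, ∃ a' : ℝ, A' ⁻¹' B = closedBall b' a' := by
  obtain ⟨r, hr, O, c, hO⟩ := hs A A'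
  refine ⟨r • O b + c, r * a, ?_⟩
  rw [hO, h]
  ext y
  constructor
  · rintro ⟨x, hx, rfl⟩
    rw [mem_closedBall, dist_eq_norm] at hx ⊢
    rw [add_sub_add_right_eq_sub, ← smul_sub, ← map_sub, norm_smul, O.norm_map,
      Real.norm_of_nonneg hr.le]
    gcongr
  · intro hy
    rw [mem_closedBall, dist_eq_norm] at hy
    refine ⟨O.symm (r⁻¹ • (y - c)), ?_, ?_⟩
    · rw [mem_closedBall, dist_eq_norm, ← O.norm_map, map_sub, O.apply_symm_apply]
      have : r⁻¹ • (y - c) - O b = r⁻¹ • (y - (r • O b + c)) := by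
        rw [smul_sub, smul_sub, smul_add, smul_smul, inv_mul_cancel₀ hr.ne', one_smul]
        abel
      rw [this, norm_smul, norm_inv, Real.norm_of_nonneg hr.le, inv_mul_le_iff₀ hr]
      exact hy
    · simp [smul_smul, hr.ne']

end Balls

end SimilarSections

namespace SimilarSections

open Filter Topology MeasureTheory

/-- `p` is a centre of symmetry of `K`. -/
def IsCenter {V : Type*} [AddCommGroup V] [Module ℝ V] (K : Set V) (p : V) : Prop :=
  ∀ x ∈ K, (2 : ℝ) • p - x ∈ K

section Centers

variable {E V : Type*} [NormedAddCommGroup E] [InnerProductSpace ℝ E] [FiniteDimensional ℝ E]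
  [NormedAddCommGroup V] [InnerProductSpace ℝ V] [FiniteDimensional ℝ V]

omit [FiniteDimensional ℝ V] in
theorem IsCenter.supp_sub {K : Set V} {R : ℝ} {p : V} (h : IsCenter K p) (hne : K.Nonempty)
    (hK : K ⊆ closedBall 0 R) (u : V) : supp K u - supp K (-u) = 2 * inner ℝ p u := by
  have key : ∀ u, supp K u ≤ 2 * inner ℝ p u + supp K (-u) := fun u =>
    supp_le hne fun x hx => by
      have := le_supp hK (h x hx) (-u)
      rw [inner_neg_right, inner_sub_left, real_inner_smul_left] at this
      linarith
  have h1 := key u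
  have h2 := key (-u)
  rw [neg_neg, inner_neg_right] at h2
  linarith

omit [FiniteDimensional ℝ V] in
theorem IsCenter.unique {K : Set V} {R : ℝ} {p q : V} (h : IsCenter K p) (h' : IsCenter K q)
    (hne : K.Nonempty) (hK : K ⊆ closedBall 0 R) : p = q :=
  ext_inner_right ℝ fun u => by
    have h1 := h.supp_sub hne hK u
    have h2 := h'.supp_sub hne hK u
    linarith

theorem exists_ne_zero_orthogonal_triple (hE : 4 ≤ Module.finrank ℝ E) (x y z : E) :
    ∃ w : E, w ≠ 0 ∧ inner ℝ x w = 0 ∧ inner ℝ y w = 0 ∧ inner ℝ z w = 0 := by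
  have h1 : (Submodule.span ℝ {x, y, z})ᗮ ≠ ⊥ := by
    intro h
    rw [Submodule.orthogonal_eq_bot_iff] at h
    have h2 : Module.finrank ℝ (Submodule.span ℝ {x, y, z}) ≤ 3 := by
      classical
      have := finrank_span_finset_le_card (R := ℝ) ({x, y, z} : Finset E)
      simp only [Finset.coe_insert, Finset.coe_singleton] at this
      exact this.trans Finset.card_le_three
    rw [h, finrank_top] at h2
    omega
  obtain ⟨w, hw, hw0⟩ := Submodule.exists_mem_ne_zero_of_ne_bot h1
  exact ⟨w, hw0, hw _ (Submodule.subset_span (by simp)), hw _ (Submodule.subset_span (by simp)),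
    hw _ (Submodule.subset_span (by simp))⟩

theorem exists_linearIsometry_triple (hd : Module.finrank ℝ E = Module.finrank ℝ V + 1)
    (hV : 3 ≤ Module.finrank ℝ V) (x y z : E) :
    ∃ A : V →ₗᵢ[ℝ] E, ∃ u v w : V, A u = x ∧ A v = y ∧ A w = z := by
  obtain ⟨w, hw, hx, hy, hz⟩ := exists_ne_zero_orthogonal_triple (E := E) (by omega) x y z
  obtain ⟨A, hA⟩ := exists_linearIsometry_orthogonal (V := V) hd w
  obtain ⟨u, hu⟩ := exists_apply_eq hd A hw hA hx
  obtain ⟨v, hv⟩ := exists_apply_eq hd A hw hA hy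
  obtain ⟨t, ht⟩ := exists_apply_eq hd A hw hA hz
  exact ⟨A, u, v, t, hu, hv, ht⟩

theorem SimilarPreimages.exists_centered {B : Set E} {ρ R : ℝ} (hB : IsBody B ρ R)
    (hs : SimilarPreimages V B) {A A' : V →ₗᵢ[ℝ] E} {p p' : V} (hp : IsCenter (A ⁻¹' B) p)
    (hp' : IsCenter (A' ⁻¹' B) p') : ∃ r : ℝ, 0 < r ∧ ∃ O : V ≃ₗᵢ[ℝ] V,
      ∀ x, x ∈ A ⁻¹' B ↔ r • O (x - p) + p' ∈ A' ⁻¹' B := by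
  obtain ⟨r, hr, O, c, hO⟩ := hs A A'
  have hinj : Function.Injective fun x => r • O x + c := fun x y hxy => by
    simpa [hr.ne'] using hxy
  have h1 : IsCenter (A' ⁻¹' B) (r • O p + c) := by
    intro y hy
    rw [hO] at hy ⊢
    obtain ⟨x, hx, rfl⟩ := hy
    refine ⟨_, hp x hx, ?_⟩
    simp only [map_sub, map_smul]
    module
  have h2 := hp'.unique h1 (hB.preimage A').nonempty (hB.preimage A').le
  refine ⟨r, hr, O, fun x => ?_⟩
  have h3 : r • O (x - p) + p' = r • O x + c := by
    rw [h2, map_sub, smul_sub]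
    abel
  rw [h3, hO]
  exact (hinj.mem_set_image (s := A ⁻¹' B) (a := x)).symm

theorem exists_foot (A : V →ₗᵢ[ℝ] E) (c : E) :
    ∃ q : V, (∀ u, inner ℝ (A u) (c - A q) = 0) ∧ ∀ u, ‖c - A q‖ ≤ ‖c - A u‖ := by
  set q := ContinuousLinearMap.adjoint A.toContinuousLinearMap c
  have h1 : ∀ u, inner ℝ (A u) (c - A q) = 0 := fun u => by
    have h2 := ContinuousLinearMap.adjoint_inner_right A.toContinuousLinearMap u c
    change inner ℝ u q = inner ℝ (A u) c at h2
    rw [inner_sub_right, A.inner_map_map, h2, sub_self]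
  refine ⟨q, h1, fun u => ?_⟩
  have h3 : ‖c - A u‖ * ‖c - A u‖ = ‖c - A q‖ * ‖c - A q‖ + ‖A (q - u)‖ * ‖A (q - u)‖ := by
    rw [← norm_add_sq_eq_norm_sq_add_norm_sq_real, map_sub]
    · congr 2 <;> abel
    · rw [real_inner_comm]; exact h1 _
  nlinarith [norm_nonneg (c - A u), norm_nonneg (c - A q), norm_nonneg (A (q - u))]

theorem exists_inscribed {B : Set E} {ρ R : ℝ} (hB : IsBody B ρ R) {c : E} (hc : IsCenter B c)
    [Nontrivial E] :
    ∃ z : E, z ≠ c ∧ closedBall c ‖z - c‖ ⊆ B ∧ ∀ s : ℝ, 1 < s → c + s • (z - c) ∉ B := by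
  have hball : closedBall c ρ ⊆ B := fun x hx => by
    have h1 : x - c ∈ B := hB.subset (by simpa [dist_eq_norm] using hx)
    have h2 : (2 : ℝ) • c - (c - x) ∈ B := hc _ (hB.subset (by
      rw [mem_closedBall, dist_eq_norm] at hx
      simpa [norm_sub_rev] using hx))
    have h3 := hB.convex h1 h2 (by norm_num : (0 : ℝ) ≤ 1 / 2) (by norm_num : (0 : ℝ) ≤ 1 / 2)
      (by norm_num)
    have h4 : (1 / 2 : ℝ) • (x - c) + (1 / 2 : ℝ) • ((2 : ℝ) • c - (c - x)) = x := by module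
    rwa [h4] at h3
  have hcint : c ∈ interior B :=
    interior_mono hball (ball_subset_interior_closedBall (mem_ball_self hB.pos))
  have hne : (interior B)ᶜ.Nonempty := by
    obtain ⟨x, hx⟩ := exists_norm_eq E (by linarith [hB.nonneg] : 0 ≤ R + 1)
    refine ⟨x, fun h => ?_⟩
    have := hB.le (interior_subset h)
    rw [mem_closedBall_zero_iff, hx] at this
    linarith
  obtain ⟨z, hz, hzd⟩ := isOpen_interior.isClosed_compl.exists_infDist_eq_dist hne c
  have hzc : z ≠ c := fun h => hz (h ▸ hcint)
  refine ⟨z, hzc, ?_, fun s hs hsB => hz ?_⟩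
  · have h1 : ball c ‖z - c‖ ⊆ B := fun x hx => by
      by_contra hxB
      have h2 := infDist_le_dist_of_mem (x := c)
        (show x ∈ (interior B)ᶜ from fun h => hxB (interior_subset h))
      rw [hzd, dist_comm c z, dist_eq_norm, dist_comm] at h2
      exact absurd hx (not_lt.2 h2)
    rw [← closure_ball c (norm_ne_zero_iff.2 (sub_ne_zero.2 hzc))]
    exact hB.compact.isClosed.closure_subset_iff.2 h1
  · have h1 := hB.convex.combo_interior_self_mem_interior hcint hsB
      (a := 1 - s⁻¹) (b := s⁻¹) (sub_pos.2 (inv_lt_one_of_one_lt₀ hs)) (by positivity) (by ring)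
    have h2 : (1 - s⁻¹) • c + s⁻¹ • (c + s • (z - c)) = z := by
      rw [smul_add, smul_smul, inv_mul_cancel₀ (by linarith), sub_smul]
      module
    rwa [h2] at h1

/-- A body with pairwise similar centrally symmetric sections is centrally symmetric, and the size
of a section is controlled by its distance to the centre. -/
theorem exists_center_of_sections (hd : Module.finrank ℝ E = Module.finrank ℝ V + 1)
    (hV : 3 ≤ Module.finrank ℝ V) {B : Set E} {ρ R : ℝ} (hB : IsBody B ρ R)
    (hs : SimilarPreimages V B) (hc : ∀ A : V →ₗᵢ[ℝ] E, ∃ p, IsCenter (A ⁻¹' B) p) :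
    ∃ c : E, ∃ m : ℝ, 0 < m ∧ IsCenter B c ∧ ∃ (A₁ : V →ₗᵢ[ℝ] E) (p₁ : V), A₁ p₁ = c ∧
      ∀ (A : V →ₗᵢ[ℝ] E) (p : V), IsCenter (A ⁻¹' B) p → ∃ r : ℝ, 0 < r ∧ r ≤ 1 ∧
        (∀ u, 1 - ‖c - A u‖ ^ 2 / m ^ 2 ≤ r ^ 2) ∧ ∃ O : V ≃ₗᵢ[ℝ] V,
          ∀ x, x ∈ A₁ ⁻¹' B ↔ r • O (x - p₁) + p ∈ A ⁻¹' B := by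
  have : Nontrivial E := Module.nontrivial_of_finrank_pos (R := ℝ) (by omega)
  obtain ⟨⟨x, y⟩, ⟨hx, hy⟩, hmax⟩ := (hB.compact.prod hB.compact).exists_isMaxOn
    (hB.nonempty.prod hB.nonempty) (f := fun p : E × E => dist p.1 p.2) (by fun_prop)
  have hmax' : ∀ x' ∈ B, ∀ y' ∈ B, ‖x' - y'‖ ≤ ‖x - y‖ := fun x' hx' y' hy' => by
    rw [← dist_eq_norm, ← dist_eq_norm]
    exact hmax (show (x', y') ∈ B ×ˢ B from ⟨hx', hy'⟩)
  set c := (1 / 2 : ℝ) • (x + y) with hcdef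
  have h1 : ∀ (A : V →ₗᵢ[ℝ] E) (u v p : V), A u = x → A v = y → IsCenter (A ⁻¹' B) p → A p = c := by
    intro A u v p hu hv hp
    have key : ∀ w, A w ∈ B → ‖A w - A p‖ ≤ ‖x - y‖ / 2 := fun w hw => by
      have h2 := hmax' _ hw _ (hp w hw)
      have h3 : A w - A ((2 : ℝ) • p - w) = (2 : ℝ) • (A w - A p) := by
        rw [map_sub, map_smul]
        module
      rw [h3, norm_smul, Real.norm_eq_abs, abs_two] at h2
      linarith
    have h2 := key u (hu ▸ hx)
    have h3 := key v (hv ▸ hy)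
    rw [hu] at h2
    rw [hv] at h3
    have h4 := parallelogram_law_with_norm ℝ (x - A p) (y - A p)
    rw [sub_sub_sub_cancel_right] at h4
    have h5 : ‖x - A p + (y - A p)‖ = 0 := by
      have := norm_nonneg (x - A p + (y - A p))
      nlinarith [norm_nonneg (x - A p), norm_nonneg (y - A p)]
    rw [norm_eq_zero] at h5
    rw [hcdef]
    have h6 : (2 : ℝ) • A p = x + y := by
      rw [← sub_eq_zero, ← neg_eq_zero, ← h5]
      module
    rw [← h6, smul_smul]
    norm_num
  have hBc : IsCenter B c := by
    intro z hz
    obtain ⟨A, u, v, w, hu, hv, hw⟩ := exists_linearIsometry_triple (V := V) hd hV x y z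
    obtain ⟨p, hp⟩ := hc A
    have h2 := hp w (by rw [Set.mem_preimage, hw]; exact hz)
    rw [Set.mem_preimage, map_sub, map_smul, hw, h1 A u v p hu hv hp] at h2
    exact h2
  obtain ⟨z, hzc, hzB, hzs⟩ := exists_inscribed hB hBc
  obtain ⟨A₁, u₁, v₁, w₁, hu₁, hv₁, hw₁⟩ := exists_linearIsometry_triple (V := V) hd hV x y z
  obtain ⟨p₁, hp₁⟩ := hc A₁
  have hAp₁ := h1 A₁ u₁ v₁ p₁ hu₁ hv₁ hp₁
  have hm : 0 < ‖z - c‖ := norm_pos_iff.2 (sub_ne_zero.2 hzc)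
  refine ⟨c, ‖z - c‖, hm, hBc, A₁, p₁, hAp₁, fun A p hp => ?_⟩
  obtain ⟨r, hr, O, hO⟩ := hs.exists_centered hB hp₁ hp
  refine ⟨r, hr, ?_, fun u => ?_, O, hO⟩
  · have h2 := hmax' _ ((hO u₁).1 (by rw [Set.mem_preimage, hu₁]; exact hx)) _
      ((hO v₁).1 (by rw [Set.mem_preimage, hv₁]; exact hy))
    rw [← map_sub, A.norm_map, add_sub_add_right_eq_sub, ← smul_sub, ← map_sub, norm_smul,
      O.norm_map, sub_sub_sub_cancel_right, Real.norm_of_nonneg hr.le, ← A₁.norm_map, map_sub,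
      hu₁, hv₁] at h2
    have h3 : 0 < ‖x - y‖ := by
      obtain ⟨t, ht⟩ := exists_norm_eq E hB.pos.le
      have h4 := hmax' t (hB.subset (by simp [ht])) 0 (hB.subset (by simp [hB.pos.le]))
      rw [sub_zero, ht] at h4
      exact hB.pos.trans_le h4
    exact (mul_le_iff_le_one_left h3).1 h2
  · obtain ⟨q, hq, hqu⟩ := exists_foot A c
    suffices h : ‖z - c‖ ^ 2 - ‖c - A q‖ ^ 2 ≤ r ^ 2 * ‖z - c‖ ^ 2 by
      have h2 := pow_le_pow_left₀ (norm_nonneg _) (hqu u) 2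
      have h3 : 1 - ‖c - A u‖ ^ 2 / ‖z - c‖ ^ 2 = (‖z - c‖ ^ 2 - ‖c - A u‖ ^ 2) / ‖z - c‖ ^ 2 := by
        field_simp
      rw [h3, div_le_iff₀ (by positivity)]
      linarith
    rcases le_or_gt (‖z - c‖ ^ 2 - ‖c - A q‖ ^ 2) 0 with h0 | h0
    · exact h0.trans (by positivity)
    set s := √(‖z - c‖ ^ 2 - ‖c - A q‖ ^ 2) with hsdef
    have hs2 : s ^ 2 = ‖z - c‖ ^ 2 - ‖c - A q‖ ^ 2 := Real.sq_sqrt h0.le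
    have hs0 : 0 < s := Real.sqrt_pos.2 h0
    have h2 : ∀ v, ‖v‖ ≤ s → q + v ∈ A ⁻¹' B := fun v hv => by
      refine hzB ?_
      rw [mem_closedBall, dist_eq_norm, ← sq_le_sq₀ (norm_nonneg _) hm.le]
      have h3 : A (q + v) - c = A v - (c - A q) := by rw [map_add]; abel
      rw [h3, norm_sub_sq_real, hq, A.norm_map]
      have := pow_le_pow_left₀ (norm_nonneg _) hv 2
      linarith
    have h3 : ∀ v, ‖v‖ ≤ s → v + p ∈ A ⁻¹' B := fun v hv => by
      have h4 := (hB.preimage A).convex (h2 v hv) (hp _ (h2 (-v) (by rwa [norm_neg])))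
        (by norm_num : (0 : ℝ) ≤ 1 / 2) (by norm_num : (0 : ℝ) ≤ 1 / 2) (by norm_num)
      have h5 : (1 / 2 : ℝ) • (q + v) + (1 / 2 : ℝ) • ((2 : ℝ) • p - (q + -v)) = v + p := by module
      rwa [h5] at h4
    have h4 : ∀ t : ℝ, 1 < t → s ≤ t * (r * ‖z - c‖) := fun t ht => by
      by_contra! hlt
      have h5 : A₁ (p₁ + t • (w₁ - p₁)) = c + t • (z - c) := by
        rw [map_add, map_smul, map_sub, hw₁, hAp₁]
      refine hzs t ht ?_
      rw [← h5]
      refine (hO (p₁ + t • (w₁ - p₁))).2 (h3 _ ?_)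
      rw [add_sub_cancel_left, norm_smul, O.norm_map, norm_smul, ← A₁.norm_map, map_sub, hw₁, hAp₁,
        Real.norm_of_nonneg hr.le, Real.norm_of_nonneg (by linarith)]
      nlinarith
    have h5 : s ≤ r * ‖z - c‖ := by
      have h6 : Tendsto (fun t : ℝ => t * (r * ‖z - c‖)) (𝓝[>] 1) (𝓝 (1 * (r * ‖z - c‖))) :=
        (continuous_id.mul continuous_const).continuousAt.tendsto.mono_left nhdsWithin_le_nhds
      rw [one_mul] at h6
      exact ge_of_tendsto h6 (eventually_mem_nhdsWithin.mono h4)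
    rw [← hs2, ← mul_pow]
    exact pow_le_pow_left₀ hs0.le h5 2

end Centers

end SimilarSections

namespace SimilarSections

open Filter Topology MeasureTheory

section Gauge

variable {E : Type*} [NormedAddCommGroup E] [InnerProductSpace ℝ E]

theorem IsBody.mem_nhds {B : Set E} {ρ R : ℝ} (hB : IsBody B ρ R) : B ∈ 𝓝 (0 : E) :=
  mem_of_superset (closedBall_mem_nhds 0 hB.pos) hB.subset

theorem IsBody.gauge_le_one_iff {B : Set E} {ρ R : ℝ} (hB : IsBody B ρ R) {x : E} :
    gauge B x ≤ 1 ↔ x ∈ B := by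
  rw [gauge_le_one_iff_mem_closure hB.convex hB.mem_nhds, hB.compact.isClosed.closure_eq]

theorem IsBody.continuous_gauge {B : Set E} {ρ R : ℝ} (hB : IsBody B ρ R) :
    Continuous (gauge B) :=
  _root_.continuous_gauge hB.convex hB.mem_nhds

theorem IsBody.gauge_add_le {B : Set E} {ρ R : ℝ} (hB : IsBody B ρ R) (x y : E) :
    gauge B (x + y) ≤ gauge B x + gauge B y :=
  _root_.gauge_add_le hB.convex (absorbent_nhds_zero hB.mem_nhds) x y

theorem IsBody.gauge_pos {B : Set E} {ρ R : ℝ} (hB : IsBody B ρ R) {x : E} (hx : x ≠ 0) :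
    0 < gauge B x :=
  (_root_.gauge_pos (absorbent_nhds_zero hB.mem_nhds)
    (NormedSpace.isVonNBounded_of_isBounded ℝ hB.compact.isBounded)).2 hx

theorem IsBody.gauge_le {B : Set E} {ρ R : ℝ} (hB : IsBody B ρ R) (x : E) :
    gauge B x ≤ ‖x‖ / ρ := by
  have h := hB.pos
  exact (gauge_mono (absorbent_nhds_zero (closedBall_mem_nhds 0 h)) hB.subset x).trans
    (gauge_closedBall h.le x).le

/-- Convexity of the gauge along a line with the same value at both ends of an interval. -/
theorem IsBody.le_gauge_add_smul {B : Set E} {ρ R : ℝ} (hB : IsBody B ρ R) {x y : E}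
    (hx : gauge B x = 1) (hy : gauge B (x + y) = 1) {s : ℝ} (hs : s ≤ 0 ∨ 1 ≤ s) :
    1 ≤ gauge B (x + s • y) := by
  rcases hs with hs | hs
  · have h1 : x = (1 - s)⁻¹ • (x + s • y) + (-s * (1 - s)⁻¹) • (x + y) := by
      have : (1 - s) ≠ 0 := by linarith
      have h2 : (1 - s) * (1 - s)⁻¹ = 1 := mul_inv_cancel₀ this
      generalize (1 - s)⁻¹ = q at *
      match_scalars <;> linarith
    have h3 := hB.gauge_add_le ((1 - s)⁻¹ • (x + s • y)) ((-s * (1 - s)⁻¹) • (x + y))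
    have h0 : 0 < (1 - s)⁻¹ := inv_pos.2 (by linarith)
    rw [← h1, gauge_smul_of_nonneg h0.le, gauge_smul_of_nonneg (mul_nonneg (by linarith) h0.le),
      hx, hy, smul_eq_mul, smul_eq_mul] at h3
    have h2 : (1 - s) * (1 - s)⁻¹ = 1 := mul_inv_cancel₀ (by linarith)
    have h4 : (1 - s)⁻¹ * 1 ≤ (1 - s)⁻¹ * gauge B (x + s • y) := by linarith
    exact le_of_mul_le_mul_left h4 h0
  · have h0 : 0 < s := by linarith
    have h1 : s • (x + y) = (s - 1) • x + (x + s • y) := by module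
    have h3 := hB.gauge_add_le ((s - 1) • x) (x + s • y)
    rw [← h1, gauge_smul_of_nonneg h0.le, gauge_smul_of_nonneg (by linarith), hx, hy,
      smul_eq_mul, smul_eq_mul] at h3
    linarith

end Gauge

section Tilt

variable {E V : Type*} [NormedAddCommGroup E] [InnerProductSpace ℝ E]
  [NormedAddCommGroup V] [InnerProductSpace ℝ V]

/-- Rotating an isometric embedding towards a normal direction. -/
theorem exists_tilt (A : V →ₗᵢ[ℝ] E) {v : V} (hv : ‖v‖ = 1) {a : E} (ha : ‖a‖ = 1)
    (hA : ∀ u, inner ℝ (A u) a = 0) (θ : ℝ) : ∃ A' : V →ₗᵢ[ℝ] E, ∀ u,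
      A' u = A u + inner ℝ v u • ((Real.cos θ - 1) • A v + Real.sin θ • a) := by
  let L : V →ₗ[ℝ] E := A.toLinearMap +
    ((innerSL ℝ v : V →L[ℝ] ℝ) : V →ₗ[ℝ] ℝ).smulRight
      ((Real.cos θ - 1) • A v + Real.sin θ • a)
  have hL : ∀ u, L u = A u + inner ℝ v u • ((Real.cos θ - 1) • A v + Real.sin θ • a) :=
    fun u => rfl
  refine ⟨⟨L, fun u => ?_⟩, hL⟩
  rw [hL, ← sq_eq_sq₀ (norm_nonneg _) (norm_nonneg _), ← real_inner_self_eq_norm_sq,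
    ← real_inner_self_eq_norm_sq]
  have h1 : inner ℝ a a = (1 : ℝ) := by rw [real_inner_self_eq_norm_sq, ha, one_pow]
  have h2 : inner ℝ v v = (1 : ℝ) := by rw [real_inner_self_eq_norm_sq, hv, one_pow]
  have h3 : ∀ u, inner ℝ a (A u) = 0 := fun u => by rw [real_inner_comm, hA]
  simp only [inner_add_left, inner_add_right, real_inner_smul_left, real_inner_smul_right, hA, h3,
    A.inner_map_map, h1, h2, real_inner_comm v u]
  have h4 := Real.sin_sq_add_cos_sq θ
  rw [real_inner_comm u v]
  linear_combination (inner ℝ u v) ^ 2 * h4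

/-- If the section of `B` by the range of `A` has centre `p` and `B` has centre `c`, then `B` lies
on the correct side in the direction `c - A p`. -/
theorem IsBody.le_gauge_add_smul_center {B : Set E} {ρ R : ℝ} (hB : IsBody B ρ R) {c : E}
    (hc : IsCenter B c) {A : V →ₗᵢ[ℝ] E} {p : V} (hp : IsCenter (A ⁻¹' B) p) (u : V) {s : ℝ}
    (hs : s ≤ 0 ∨ gauge B (A u) ≤ s) :
    gauge B (A u) ≤ gauge B (A u + s • ((2 : ℝ) • (c - A p))) := by
  rcases eq_or_ne u 0 with rfl | hu
  · rw [map_zero, gauge_zero]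
    exact gauge_nonneg _
  set l := gauge B (A u) with hl
  have hl0 : 0 < l := hB.gauge_pos fun h => hu (A.injective (by rw [h, map_zero]))
  have h1 : gauge B (A (l⁻¹ • u)) = 1 := by
    rw [map_smul, gauge_smul_of_nonneg (inv_nonneg.2 hl0.le), ← hl, smul_eq_mul,
      inv_mul_cancel₀ hl0.ne']
  set w := l⁻¹ • u with hw
  have hwB : A w ∈ B := hB.gauge_le_one_iff.1 h1.le
  have h2 : A w + (2 : ℝ) • (c - A p) = (2 : ℝ) • c - A ((2 : ℝ) • p - w) := by
    rw [map_sub, map_smul A (2 : ℝ) p]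
    module
  have h3 : A w + (2 : ℝ) • (c - A p) ∈ B := by
    rw [h2]
    exact hc _ (hp _ hwB)
  have h4 : gauge B (A w + (2 : ℝ) • (c - A p)) = 1 := by
    refine le_antisymm (hB.gauge_le_one_iff.2 h3) ?_
    by_contra! hlt
    set ε := 1 - gauge B (A w + (2 : ℝ) • (c - A p)) with hε
    have h5 : A w + (2 : ℝ) • (c - A p) + ε • A w ∈ B := by
      refine hB.gauge_le_one_iff.1 ((hB.gauge_add_le _ _).trans ?_)
      rw [gauge_smul_of_nonneg (by linarith), h1, smul_eq_mul]
      linarith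
    have h6 : A ((2 : ℝ) • p - (1 + ε) • w) ∈ B := by
      have := hc _ h5
      convert this using 1
      rw [map_sub, map_smul A (2 : ℝ) p, map_smul A (1 + ε) w]
      module
    have h7 := hp _ h6
    rw [sub_sub_cancel, Set.mem_preimage, ← hB.gauge_le_one_iff, map_smul,
      gauge_smul_of_nonneg (by linarith), h1, smul_eq_mul] at h7
    linarith
  have h8 := hB.le_gauge_add_smul h1 h4 (s := l⁻¹ * s) (by
    refine hs.imp (fun h => mul_nonpos_of_nonneg_of_nonpos (inv_nonneg.2 hl0.le) h) fun h => ?_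
    rw [inv_mul_eq_div, le_div_iff₀ hl0]
    linarith)
  have h9 : A u + s • ((2 : ℝ) • (c - A p)) = l • (A w + (l⁻¹ * s) • ((2 : ℝ) • (c - A p))) := by
    rw [hw, map_smul, smul_add, smul_inv_smul₀ hl0.ne', smul_smul l (l⁻¹ * s),
      mul_inv_cancel_left₀ hl0.ne']
  rw [h9, gauge_smul_of_nonneg hl0.le, smul_eq_mul]
  exact le_mul_of_one_le_right hl0.le h8

end Tilt

end SimilarSections

namespace SimilarSections

open Filter Topology MeasureTheory

section Direction

variable {E V : Type*} [NormedAddCommGroup E] [InnerProductSpace ℝ E] [FiniteDimensional ℝ E]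
  [NormedAddCommGroup V] [InnerProductSpace ℝ V] [FiniteDimensional ℝ V]

theorem IsCenter.preimage {B : Set E} {c : E} (hc : IsCenter B c) {A : V →ₗᵢ[ℝ] E} {p : V}
    (hp : A p = c) : IsCenter (A ⁻¹' B) p := fun x hx => by
  have := hc _ hx
  rwa [Set.mem_preimage, map_sub, map_smul, hp]

theorem IsBody.norm_center_sub_le {B : Set E} {ρ R : ℝ} (hB : IsBody B ρ R) {A A' : V →ₗᵢ[ℝ] E}
    {p p' : V} (hp : IsCenter (A ⁻¹' B) p) (hp' : IsCenter (A' ⁻¹' B) p') :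
    ‖p - p'‖ ≤ ‖A.toContinuousLinearMap - A'.toContinuousLinearMap‖ * (R * R / ρ) := by
  have h1 := fun t => supp_preimage_sub_le hB.convex hB.pos hB.le hB.subset
    (A := A.toContinuousLinearMap) (A' := A'.toContinuousLinearMap) A.norm_map A'.norm_map t
  have h2 := hp.supp_sub (hB.preimage A).nonempty (hB.preimage A).le (p - p')
  have h3 := hp'.supp_sub (hB.preimage A').nonempty (hB.preimage A').le (p - p')
  have h4 := h1 (p - p')
  have h5 := h1 (-(p - p'))
  rw [norm_neg] at h5
  have h6 : inner ℝ p (p - p') - inner ℝ p' (p - p') = ‖p - p'‖ * ‖p - p'‖ := by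
    rw [← inner_sub_left, real_inner_self_eq_norm_mul_norm]
  rcases (norm_nonneg (p - p')).eq_or_lt with h0 | h0
  · rw [← h0]
    have := hB.pos
    have := hB.nonneg
    positivity
  refine le_of_mul_le_mul_right ?_ h0
  have h7 := (abs_le.1 h4).2
  have h8 := (abs_le.1 h5).1
  simp only [LinearIsometry.coe_toContinuousLinearMap] at h7 h8
  linarith

/-- A symmetric body all of whose central sections are symmetric has, for each section through its
centre, a conjugate direction. -/
theorem exists_conjugate_direction (hd : Module.finrank ℝ E = Module.finrank ℝ V + 1)
    {B : Set E} {ρ R : ℝ} (hB : IsBody B ρ R) {c : E} (hc : IsCenter B c) (hc0 : c ≠ 0)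
    (hs : ∀ A : V →ₗᵢ[ℝ] E, ∃ p, IsCenter (A ⁻¹' B) p) {A₀ : V →ₗᵢ[ℝ] E} {p₀ : V}
    (hp₀ : A₀ p₀ = c) :
    ∃ d : E, ‖d‖ = 1 ∧ ∀ u, ∀ s : ℝ, gauge B (A₀ u) ≤ gauge B (A₀ u + s • d) := by
  obtain ⟨a, ha, hA₀⟩ := exists_unit_orthogonal hd A₀
  have hp0 : p₀ ≠ 0 := by
    rintro rfl
    exact hc0 (by rw [← hp₀, map_zero])
  have hp0' := norm_pos_iff.2 hp0
  set v := ‖p₀‖⁻¹ • p₀ with hvdef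
  have hv : ‖v‖ = 1 := by rw [hvdef, norm_smul, norm_inv, norm_norm, inv_mul_cancel₀ hp0'.ne']
  set n : ℝ → E := fun θ => (Real.cos θ - 1) • A₀ v + Real.sin θ • a with hn
  have hnc : Continuous n := by fun_prop
  have hn0 : n 0 = 0 := by simp [hn]
  choose A hA using exists_tilt A₀ hv ha hA₀
  have hAn : ∀ θ, ‖(A θ).toContinuousLinearMap - A₀.toContinuousLinearMap‖ ≤ ‖n θ‖ := fun θ => by
    refine ContinuousLinearMap.opNorm_le_bound _ (norm_nonneg _) fun u => ?_
    have : ((A θ).toContinuousLinearMap - A₀.toContinuousLinearMap) u = inner ℝ v u • n θ := by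
      rw [ContinuousLinearMap.sub_apply, LinearIsometry.coe_toContinuousLinearMap,
        LinearIsometry.coe_toContinuousLinearMap, hA, add_sub_cancel_left]
    rw [this, norm_smul, mul_comm]
    gcongr
    simpa [hv] using abs_real_inner_le_norm v u
  choose p hp using fun θ => hs (A θ)
  have hpn : ∀ θ, ‖p θ - p₀‖ ≤ ‖n θ‖ * (R * R / ρ) := fun θ => by
    have := hB.pos
    exact (hB.norm_center_sub_le (hp θ) (hc.preimage hp₀)).trans (mul_le_mul_of_nonneg_right (hAn θ)
      (div_nonneg (mul_self_nonneg R) this.le))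
  have hτ0 : ∀ θ, 0 < θ → θ ≤ 1 → c - A θ (p θ) ≠ 0 := fun θ h0 h1 h => by
    have h2 : inner ℝ (A θ (p θ)) (Real.cos θ • a - Real.sin θ • A₀ v) = 0 := by
      have h3 : ∀ u, inner ℝ a (A₀ u) = 0 := fun u => by rw [real_inner_comm, hA₀]
      have h4 : inner ℝ a a = (1 : ℝ) := by rw [real_inner_self_eq_norm_sq, ha, one_pow]
      have h5 : inner ℝ v v = (1 : ℝ) := by rw [real_inner_self_eq_norm_sq, hv, one_pow]
      rw [hA]
      simp only [inner_add_left, inner_sub_right, real_inner_smul_left, real_inner_smul_right,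
        hA₀, h3, A₀.inner_map_map, h4, h5, real_inner_comm v (p θ)]
      ring
    rw [← sub_eq_zero.1 h, ← hp₀, inner_sub_right, real_inner_smul_right, hA₀,
      real_inner_smul_right, A₀.inner_map_map, hvdef, real_inner_smul_right,
      real_inner_self_eq_norm_sq] at h2
    have h6 : 0 < Real.sin θ := Real.sin_pos_of_pos_of_le_one h0 h1
    have h7 : 0 < Real.sin θ * (‖p₀‖⁻¹ * ‖p₀‖ ^ 2) := by positivity
    linarith
  have hθ : Tendsto (fun k : ℕ => 1 / ((k : ℝ) + 1)) atTop (𝓝 0) :=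
    tendsto_one_div_add_atTop_nhds_zero_nat
  have hnθ : Tendsto (fun k : ℕ => n (1 / ((k : ℝ) + 1))) atTop (𝓝 0) := by
    have := (hnc.tendsto 0).comp hθ
    rwa [hn0] at this
  have hAθ : ∀ u, Tendsto (fun k : ℕ => A (1 / ((k : ℝ) + 1)) u) atTop (𝓝 (A₀ u)) := fun u => by
    have := (hnθ.const_smul (inner ℝ v u)).const_add (A₀ u)
    rw [smul_zero, add_zero] at this
    exact this.congr fun k => (hA _ u).symm
  set τ : ℕ → E := fun k => (2 : ℝ) • (c - A (1 / ((k : ℝ) + 1)) (p (1 / ((k : ℝ) + 1)))) with hτ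
  have hτne : ∀ k, 0 < ‖τ k‖ := fun k => norm_pos_iff.2 (smul_ne_zero two_ne_zero
    (hτ0 _ (by positivity) (by
      rw [div_le_one (by positivity)]
      linarith [(Nat.cast_nonneg k : (0 : ℝ) ≤ k)])))
  have hτlim : Tendsto (fun k => ‖τ k‖) atTop (𝓝 0) := by
    have h1 : Tendsto (fun k : ℕ => 2 * (‖c - A (1 / ((k : ℝ) + 1)) p₀‖ +
        ‖n (1 / ((k : ℝ) + 1))‖ * (R * R / ρ))) atTop (𝓝 (2 * (‖c - c‖ + 0 * (R * R / ρ)))) := by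
      have h2 := hAθ p₀
      rw [hp₀] at h2
      have h3 := hnθ.norm
      rw [norm_zero] at h3
      exact ((h2.const_sub c).norm.add (h3.mul_const _)).const_mul 2
    rw [sub_self, norm_zero, zero_mul, add_zero, mul_zero] at h1
    refine squeeze_zero (fun k => norm_nonneg _) (fun k => ?_) h1
    rw [hτ, norm_smul, Real.norm_two]
    gcongr
    refine (norm_sub_le_norm_sub_add_norm_sub _ (A (1 / ((k : ℝ) + 1)) p₀) _).trans ?_
    gcongr
    rw [← map_sub, LinearIsometry.norm_map, norm_sub_rev]
    exact hpn _
  obtain ⟨d, hd1, φ, hφ, hlim⟩ := (isCompact_sphere (0 : E) 1).tendsto_subseq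
    (x := fun k => ‖τ k‖⁻¹ • τ k) fun k => by
      rw [mem_sphere_zero_iff_norm, norm_smul, norm_inv, norm_norm, inv_mul_cancel₀ (hτne k).ne']
  rw [mem_sphere_zero_iff_norm] at hd1
  refine ⟨d, hd1, fun u s => ?_⟩
  have hφt := hφ.tendsto_atTop
  have hl := (hB.continuous_gauge.tendsto _).comp ((hAθ u).comp hφt)
  have hr := (hB.continuous_gauge.tendsto _).comp (((hAθ u).comp hφt).add (hlim.const_smul s))
  refine le_of_tendsto_of_tendsto hl hr ?_
  have hev : ∀ᶠ k in atTop, s ≤ 0 ∨ gauge B (A (1 / (((φ k : ℕ) : ℝ) + 1)) u) * ‖τ (φ k)‖ ≤ s := by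
    rcases le_or_gt s 0 with h | h
    · exact Eventually.of_forall fun k => Or.inl h
    · have h2 := hl.mul (hτlim.comp hφt)
      rw [mul_zero] at h2
      filter_upwards [h2.eventually (gt_mem_nhds h)] with k hk
      exact Or.inr hk.le
  filter_upwards [hev] with k hk
  have h3 := hB.le_gauge_add_smul_center hc (hp (1 / (((φ k : ℕ) : ℝ) + 1))) u
    (s := s * ‖τ (φ k)‖⁻¹) (by
      refine hk.imp (fun h => mul_nonpos_of_nonpos_of_nonneg h (by positivity)) fun h => ?_
      rw [← div_eq_mul_inv, le_div_iff₀ (hτne _)]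
      exact h)
  rw [mul_smul] at h3
  exact h3

end Direction

end SimilarSections

namespace SimilarSections

open Filter Topology MeasureTheory Pointwise

section Volume

variable {V : Type*} [NormedAddCommGroup V] [InnerProductSpace ℝ V] [FiniteDimensional ℝ V]
  [MeasurableSpace V] [BorelSpace V]

theorem mul_volume_le_of_mapsTo {K K' : Set V} (hK : IsCompact K) {r : ℝ} (hr : 0 < r)
    (O : V ≃ₗᵢ[ℝ] V) (p p' : V) (h : ∀ x ∈ K, r • O (x - p) + p' ∈ K') :
    ENNReal.ofReal (r ^ Module.finrank ℝ V) * volume K ≤ volume K' := by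
  have h1 : volume (O.symm ⁻¹' ((fun x => x + p) ⁻¹' K)) = volume K := by
    rw [O.symm.measurePreserving.measure_preimage, measure_preimage_add_right]
    exact ((hK.measurableSet).preimage (measurable_add_const p)).nullMeasurableSet
  have h2 : r • (O.symm ⁻¹' ((fun x => x + p) ⁻¹' K)) ⊆ (fun x => x + p') ⁻¹' K' := by
    rintro _ ⟨y, hy, rfl⟩
    have := h _ hy
    rwa [add_sub_cancel_right, O.apply_symm_apply] at this
  calc ENNReal.ofReal (r ^ Module.finrank ℝ V) * volume K
      = volume (r • (O.symm ⁻¹' ((fun x => x + p) ⁻¹' K))) := by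
        rw [Measure.addHaar_smul, h1, abs_of_pos (by positivity)]
    _ ≤ volume ((fun x => x + p') ⁻¹' K') := measure_mono h2
    _ = volume K' := measure_preimage_add_right _ _ _

end Volume

section Conjugate

variable {E V : Type*} [NormedAddCommGroup E] [InnerProductSpace ℝ E] [FiniteDimensional ℝ E]
  [NormedAddCommGroup V] [InnerProductSpace ℝ V] [FiniteDimensional ℝ V]
  [MeasurableSpace V] [BorelSpace V]

theorem eq_zero_of_eventually_mul_pow_le {q κ : ℝ} (n : ℕ)
    (h : ∀ᶠ θ in 𝓝 (0 : ℝ), (Real.cos θ + Real.sin θ * q) * (1 - κ * θ ^ 2) ^ n ≤ 1) : q = 0 := by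
  have h1 : HasDerivAt (fun θ : ℝ => (Real.cos θ + Real.sin θ * q) * (1 - κ * θ ^ 2) ^ n) q 0 := by
    have h2 : HasDerivAt (fun θ : ℝ => Real.cos θ + Real.sin θ * q)
        (-Real.sin 0 + Real.cos 0 * q) 0 :=
      (Real.hasDerivAt_cos 0).add ((Real.hasDerivAt_sin 0).mul_const q)
    have h3 : HasDerivAt (fun θ : ℝ => 1 - κ * θ ^ 2) (-(κ * (2 * 0))) 0 := by
      simpa using ((hasDerivAt_pow 2 (0 : ℝ)).const_mul κ).const_sub 1
    have h4 := h2.fun_mul (h3.fun_pow n)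
    norm_num at h4
    exact h4
  refine IsLocalMax.hasDerivAt_eq_zero ?_ h1
  filter_upwards [h] with θ hθ
  simpa using hθ

/-- Under the conclusion of `exists_center_of_sections`, a section through the centre is conjugate
to its own normal direction. -/
theorem gauge_le_gauge_add_normal (hd : Module.finrank ℝ E = Module.finrank ℝ V + 1)
    {B : Set E} {ρ R : ℝ} (hB : IsBody B ρ R) {c : E} (hc : IsCenter B c) (hc0 : c ≠ 0)
    (hs : ∀ A : V →ₗᵢ[ℝ] E, ∃ p, IsCenter (A ⁻¹' B) p) {m : ℝ} {A₁ : V →ₗᵢ[ℝ] E} {p₁ : V}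
    (hA₁ : ∀ (A : V →ₗᵢ[ℝ] E) (p : V), IsCenter (A ⁻¹' B) p → ∃ r : ℝ, 0 < r ∧ r ≤ 1 ∧
        (∀ u, 1 - ‖c - A u‖ ^ 2 / m ^ 2 ≤ r ^ 2) ∧ ∃ O : V ≃ₗᵢ[ℝ] V,
          ∀ x, x ∈ A₁ ⁻¹' B ↔ r • O (x - p₁) + p ∈ A ⁻¹' B)
    {A₀ : V →ₗᵢ[ℝ] E} {p₀ : V} (hp₀ : A₀ p₀ = c) {a : E} (ha : ‖a‖ = 1)
    (hA₀ : ∀ u, inner ℝ (A₀ u) a = 0) (u : V) (s : ℝ) :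
    gauge B (A₀ u) ≤ gauge B (A₀ u + s • a) := by
  obtain ⟨d, hd1, hdir⟩ := exists_conjugate_direction hd hB hc hc0 hs hp₀
  have ha0 : a ≠ 0 := norm_ne_zero_iff.1 (by rw [ha]; exact one_ne_zero)
  have hδ : inner ℝ d a ≠ (0 : ℝ) := fun h => by
    obtain ⟨u, hu⟩ := exists_apply_eq hd A₀ ha0 hA₀ h
    have h1 := hdir u (-1)
    rw [hu, neg_one_smul, add_neg_cancel, gauge_zero] at h1
    have h2 : d ≠ 0 := norm_ne_zero_iff.1 (by rw [hd1]; exact one_ne_zero)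
    exact absurd h1 (not_le.2 (hB.gauge_pos h2))
  set δ := inner ℝ d a with hδdef
  obtain ⟨q, hq⟩ := exists_apply_eq hd A₀ ha0 hA₀ (x := a - δ⁻¹ • d) (by
    rw [inner_sub_left, real_inner_smul_left, real_inner_self_eq_norm_sq, ha, ← hδdef,
      inv_mul_cancel₀ hδ]
    norm_num)
  have hK : ∀ A : V →ₗᵢ[ℝ] E, IsBody (A ⁻¹' B) ρ R := fun A => hB.preimage A
  have hv0 : 0 < volume (A₁ ⁻¹' B) :=
    (measure_ball_pos volume (0 : V) hB.pos).trans_le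
      (measure_mono (ball_subset_closedBall.trans (hK A₁).subset))
  have hvt : volume (A₁ ⁻¹' B) ≠ ⊤ := (hK A₁).compact.measure_lt_top.ne
  have hvol0 : volume (A₀ ⁻¹' B) ≤ volume (A₁ ⁻¹' B) := by
    obtain ⟨r, hr, hr1, hr2, O, hO⟩ := hA₁ A₀ p₀ (hc.preimage hp₀)
    have h1 := hr2 p₀
    rw [hp₀, sub_self, norm_zero] at h1
    have hr3 : r = 1 := le_antisymm hr1 (by norm_num at h1; rwa [abs_of_pos hr] at h1)
    have := mul_volume_le_of_mapsTo (K' := A₁ ⁻¹' B) (hK A₀).compact one_pos O.symm p₀ p₁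
      fun x hx => by
        rw [one_smul, hO, add_sub_cancel_right, O.apply_symm_apply, hr3, one_smul, sub_add_cancel]
        exact hx
    simpa using this
  have hvq : ∀ v : V, ‖v‖ = 1 → inner ℝ v q = 0 := fun v hv => by
    refine eq_zero_of_eventually_mul_pow_le (κ := ‖p₀‖ ^ 2 / m ^ 2) (Module.finrank ℝ V) ?_
    have hev : ∀ᶠ θ in 𝓝 (0 : ℝ), 0 < 1 - ‖p₀‖ ^ 2 / m ^ 2 * θ ^ 2 :=
      (Continuous.continuousAt (f := fun θ : ℝ => 1 - ‖p₀‖ ^ 2 / m ^ 2 * θ ^ 2)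
        (by fun_prop)).eventually (lt_mem_nhds (by norm_num))
    filter_upwards [hev] with θ hθ
    obtain ⟨A, hA⟩ := exists_tilt A₀ hv ha hA₀ θ
    obtain ⟨p, hp⟩ := hs A
    obtain ⟨r, hr, hr1, hr2, O, hO⟩ := hA₁ A p hp
    have h1 := mul_volume_le_of_mapsTo (K' := A ⁻¹' B) (hK A₁).compact hr O p₁ p
      fun x hx => (hO x).1 hx
    let T : V →ₗ[ℝ] V := LinearMap.transvection ((innerSL ℝ v : V →L[ℝ] ℝ) : V →ₗ[ℝ] ℝ)
      ((Real.cos θ - 1) • v + Real.sin θ • q)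
    have hT : ∀ u, T u = u + inner ℝ v u • ((Real.cos θ - 1) • v + Real.sin θ • q) := fun u => rfl
    have hdet : LinearMap.det T = Real.cos θ + Real.sin θ * inner ℝ v q := by
      rw [LinearMap.transvection.det]
      change 1 + inner ℝ v ((Real.cos θ - 1) • v + Real.sin θ • q) = _
      rw [inner_add_right, real_inner_smul_right, real_inner_smul_right,
        real_inner_self_eq_norm_sq, hv]
      ring
    have hAT : ∀ u, A u = A₀ (T u) + (inner ℝ v u * Real.sin θ * δ⁻¹) • d := fun u => by
      rw [hA, hT, map_add, map_smul, map_add, map_smul, map_smul, hq]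
      module
    have h2 : T '' (A ⁻¹' B) ⊆ A₀ ⁻¹' B := by
      rintro _ ⟨x, hx, rfl⟩
      have hx' := hB.gauge_le_one_iff.2 hx
      rw [hAT] at hx'
      exact hB.gauge_le_one_iff.1 ((hdir _ _).trans hx')
    have h3 : ENNReal.ofReal (|LinearMap.det T| * r ^ Module.finrank ℝ V) ≤ 1 := by
      refine (ENNReal.mul_le_mul_iff_left hv0.ne' hvt).1 ?_
      rw [ENNReal.ofReal_mul (abs_nonneg _), one_mul, mul_assoc]
      refine (mul_le_mul_right h1 _).trans ?_
      rw [← Measure.addHaar_image_linearMap]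
      exact (measure_mono h2).trans hvol0
    rw [← ENNReal.ofReal_one, ENNReal.ofReal_le_ofReal_iff zero_le_one, hdet] at h3
    refine le_trans ?_ h3
    have h4 : 1 - ‖p₀‖ ^ 2 / m ^ 2 * θ ^ 2 ≤ r := by
      have h5 := hr2 p₀
      have h6 : ‖c - A p₀‖ ^ 2 ≤ ‖p₀‖ ^ 2 * θ ^ 2 := by
        have h7 : ‖c - A p₀‖ ^ 2 = inner ℝ v p₀ ^ 2 * (2 - 2 * Real.cos θ) := by
          rw [hA, hp₀, sub_add_cancel_left, norm_neg, norm_smul, mul_pow, Real.norm_eq_abs, sq_abs,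
            ← real_inner_self_eq_norm_sq]
          simp only [inner_add_left, inner_add_right, real_inner_smul_left, real_inner_smul_right,
            hA₀, real_inner_comm (A₀ v) a, A₀.inner_map_map]
          rw [real_inner_self_eq_norm_sq, real_inner_self_eq_norm_sq, hv, ha]
          linear_combination inner ℝ v p₀ ^ 2 * Real.sin_sq_add_cos_sq θ
        have h8 : |inner ℝ v p₀| ≤ ‖p₀‖ := by simpa [hv] using abs_real_inner_le_norm v p₀
        have h9 : inner ℝ v p₀ ^ 2 ≤ ‖p₀‖ ^ 2 := by
          rw [← sq_abs]
          gcongr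
        rw [h7]
        have := Real.one_sub_sq_div_two_le_cos (x := θ)
        have := Real.cos_le_one θ
        exact mul_le_mul h9 (by linarith) (by linarith) (sq_nonneg _)
      have h10 : ‖c - A p₀‖ ^ 2 / m ^ 2 ≤ ‖p₀‖ ^ 2 / m ^ 2 * θ ^ 2 := by
        rw [div_mul_eq_mul_div]
        gcongr
      nlinarith
    calc _ ≤ |Real.cos θ + Real.sin θ * inner ℝ v q| *
          (1 - ‖p₀‖ ^ 2 / m ^ 2 * θ ^ 2) ^ Module.finrank ℝ V := by
          gcongr
          exact le_abs_self _
      _ ≤ _ := by gcongr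
  have hq0 : q = 0 := by
    by_contra h
    have h1 := hvq (‖q‖⁻¹ • q) (by
      rw [norm_smul, norm_inv, norm_norm, inv_mul_cancel₀ (norm_ne_zero_iff.2 h)])
    rw [real_inner_smul_left, real_inner_self_eq_norm_sq] at h1
    have h2 : 0 < ‖q‖ := norm_pos_iff.2 h
    have h3 : 0 < ‖q‖⁻¹ * ‖q‖ ^ 2 := by positivity
    exact h3.ne' h1
  rw [hq0, map_zero] at hq
  have hq' : a = δ⁻¹ • d := (sub_eq_zero.1 hq.symm)
  rw [hq', smul_smul]
  exact hdir _ _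

end Conjugate

end SimilarSections

namespace SimilarSections

open Filter Topology MeasureTheory

section NonzeroCenter

theorem eq_of_abs_sub_le_sq {f : ℝ → ℝ} {C : ℝ} (h : ∀ x y, |f x - f y| ≤ C * (x - y) ^ 2)
    (x y : ℝ) : f x = f y := by
  have hf : ∀ x, HasDerivAt f 0 x := fun x => by
    rw [hasDerivAt_iff_isLittleO]
    have h1 : (fun y => f y - f x - (y - x) • (0 : ℝ)) =O[𝓝 x] fun y => (y - x) ^ 2 :=
      Asymptotics.IsBigO.of_bound C (Eventually.of_forall fun y => by
        simpa [abs_mul] using h y x)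
    refine h1.trans_isLittleO ?_
    have h2 : (fun y => (y - x) ^ 2) =o[𝓝 x] fun y => (y - x) ^ 1 := by
      have h3 : Tendsto (fun y => y - x) (𝓝 x) (𝓝 0) := by
        exact Continuous.tendsto' (by fun_prop) _ _ (sub_self x)
      exact (Asymptotics.isLittleO_pow_pow one_lt_two).comp_tendsto h3
    simpa using h2
  exact is_const_of_deriv_eq_zero (fun x => (hf x).differentiableAt) (fun x => (hf x).deriv) x y

variable {E V : Type*} [NormedAddCommGroup E] [InnerProductSpace ℝ E] [FiniteDimensional ℝ E]
  [NormedAddCommGroup V] [InnerProductSpace ℝ V] [FiniteDimensional ℝ V]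

omit [FiniteDimensional ℝ E] in
/-- A gauge that is conjugate to every orthogonal direction of a plane is constant on circles. -/
theorem IsBody.gauge_rotate_eq {B : Set E} {ρ R : ℝ} (hB : IsBody B ρ R) {y w : E}
    (hy : ‖y‖ = 1) (hw : ‖w‖ = 1) (hyw : inner ℝ y w = 0)
    (h : ∀ x a : E, x ∈ Submodule.span ℝ {y, w} → a ∈ Submodule.span ℝ {y, w} → ‖a‖ = 1 →
      inner ℝ x a = 0 → ∀ s : ℝ, gauge B x ≤ gauge B (x + s • a)) (θ : ℝ) :
    gauge B (Real.cos θ • y + Real.sin θ • w) = gauge B y := by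
  set e : ℝ → E := fun θ => Real.cos θ • y + Real.sin θ • w with he
  have hym : y ∈ Submodule.span ℝ {y, w} := Submodule.subset_span (by simp)
  have hwm : w ∈ Submodule.span ℝ {y, w} := Submodule.subset_span (by simp)
  have hyy : inner ℝ y y = (1 : ℝ) := by rw [real_inner_self_eq_norm_sq, hy, one_pow]
  have hww : inner ℝ w w = (1 : ℝ) := by rw [real_inner_self_eq_norm_sq, hw, one_pow]
  have hwy : inner ℝ w y = (0 : ℝ) := by rw [real_inner_comm, hyw]
  have hnorm : ∀ α β : ℝ, α ^ 2 + β ^ 2 = 1 → ‖α • y + β • w‖ = 1 := fun α β hαβ => by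
    rw [← sq_eq_sq₀ (norm_nonneg _) zero_le_one, ← real_inner_self_eq_norm_sq]
    simp only [inner_add_left, inner_add_right, real_inner_smul_left, real_inner_smul_right, hyy,
      hww, hyw, hwy]
    linear_combination hαβ
  have key : ∀ θ φ, gauge B (e φ) - gauge B (e θ) ≤ 1 / ρ * (θ - φ) ^ 2 / 2 := fun θ φ => by
    have hf0 : gauge B (e φ) ≤ 1 / ρ := by
      have := hB.gauge_le (e φ)
      rwa [hnorm _ _ (Real.cos_sq_add_sin_sq φ)] at this
    have h1 : Real.cos (θ - φ) * gauge B (e φ) ≤ gauge B (e θ) := by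
      rcases le_or_gt (Real.cos (θ - φ)) 0 with hc | hc
      · exact (mul_nonpos_of_nonpos_of_nonneg hc (gauge_nonneg _)).trans (gauge_nonneg _)
      have h2 := h (Real.cos (θ - φ) • e φ) ((-Real.sin φ) • y + Real.cos φ • w)
        (Submodule.smul_mem _ _ (Submodule.add_mem _ (Submodule.smul_mem _ _ hym)
          (Submodule.smul_mem _ _ hwm)))
        (Submodule.add_mem _ (Submodule.smul_mem _ _ hym) (Submodule.smul_mem _ _ hwm))
        (hnorm _ _ (by rw [neg_sq, Real.sin_sq_add_cos_sq]))
        (by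
          simp only [he, inner_add_left, inner_add_right, real_inner_smul_left,
            real_inner_smul_right, hyy, hww, hyw, hwy]
          ring) (Real.sin (θ - φ))
      rw [gauge_smul_of_nonneg hc.le, smul_eq_mul] at h2
      convert h2 using 2
      rw [he]
      have h3 : Real.cos θ = Real.cos (θ - φ) * Real.cos φ - Real.sin (θ - φ) * Real.sin φ := by
        rw [← Real.cos_add, sub_add_cancel]
      have h4 : Real.sin θ = Real.sin (θ - φ) * Real.cos φ + Real.cos (θ - φ) * Real.sin φ := by
        rw [← Real.sin_add, sub_add_cancel]
      simp only []
      rw [h3, h4]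
      module
    have h5 := Real.one_sub_sq_div_two_le_cos (x := θ - φ)
    have h6 := gauge_nonneg (s := B) (e φ)
    nlinarith [mul_le_mul hf0 (show 1 - Real.cos (θ - φ) ≤ (θ - φ) ^ 2 / 2 by linarith)
      (by linarith [Real.cos_le_one (θ - φ)]) (h6.trans hf0)]
  have h7 := eq_of_abs_sub_le_sq (f := fun θ => gauge B (e θ)) (C := 1 / ρ / 2) (fun x y => by
    rw [abs_le]
    constructor <;> nlinarith [key x y, key y x]) θ 0
  simpa [he] using h7

/-- A body all of whose sections by hyperplanes through the origin are similar and symmetric is a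
ball, provided its own centre is not the origin. -/
theorem eq_closedBall_of_center_ne_zero [MeasurableSpace V] [BorelSpace V]
    (hd : Module.finrank ℝ E = Module.finrank ℝ V + 1) (hV : 3 ≤ Module.finrank ℝ V)
    {B : Set E} {ρ R : ℝ} (hB : IsBody B ρ R) (hsim : SimilarPreimages V B) {c : E}
    (hc : IsCenter B c) (hc0 : c ≠ 0)
    (hs : ∀ A : V →ₗᵢ[ℝ] E, ∃ p, IsCenter (A ⁻¹' B) p) {m : ℝ} {A₁ : V →ₗᵢ[ℝ] E} {p₁ : V}
    (hA₁ : ∀ (A : V →ₗᵢ[ℝ] E) (p : V), IsCenter (A ⁻¹' B) p → ∃ r : ℝ, 0 < r ∧ r ≤ 1 ∧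
        (∀ u, 1 - ‖c - A u‖ ^ 2 / m ^ 2 ≤ r ^ 2) ∧ ∃ O : V ≃ₗᵢ[ℝ] V,
          ∀ x, x ∈ A₁ ⁻¹' B ↔ r • O (x - p₁) + p ∈ A ⁻¹' B) :
    ∃ c r, 0 < r ∧ B = closedBall c r := by
  have hconj : ∀ x a : E, ‖a‖ = 1 → inner ℝ c a = 0 → inner ℝ x a = 0 → ∀ s : ℝ,
      gauge B x ≤ gauge B (x + s • a) := fun x a ha hca hxa s => by
    have ha0 : a ≠ 0 := norm_ne_zero_iff.1 (by rw [ha]; exact one_ne_zero)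
    obtain ⟨A₀, hA₀⟩ := exists_linearIsometry_orthogonal (V := V) hd a
    obtain ⟨p₀, hp₀⟩ := exists_apply_eq hd A₀ ha0 hA₀ hca
    obtain ⟨u, rfl⟩ := exists_apply_eq hd A₀ ha0 hA₀ hxa
    exact gauge_le_gauge_add_normal hd hB hc hc0 hs hA₁ hp₀ ha hA₀ u s
  have hrot : ∀ y w : E, inner ℝ y c = 0 → inner ℝ w c = 0 → ‖y‖ = 1 → ‖w‖ = 1 →
      inner ℝ y w = 0 → ∀ θ, gauge B (Real.cos θ • y + Real.sin θ • w) = gauge B y := by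
    intro y w hyc hwc hy hw hyw θ
    refine hB.gauge_rotate_eq hy hw hyw (fun x a _ ha ha1 hxa s => hconj x a ha1 ?_ hxa s) θ
    have h1 : Submodule.span ℝ {y, w} ≤ (ℝ ∙ c)ᗮ := by
      rw [Submodule.span_le]
      rintro z (rfl | rfl) <;> rwa [SetLike.mem_coe, Submodule.mem_orthogonal_singleton_iff_inner_left]
    rw [real_inner_comm]
    exact Submodule.mem_orthogonal_singleton_iff_inner_left.1 (h1 ha)
  have hsphere : ∀ y z : E, inner ℝ y c = 0 → inner ℝ z c = 0 → ‖y‖ = 1 → ‖z‖ = 1 →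
      gauge B z = gauge B y := by
    intro y z hyc hzc hy hz
    obtain ⟨w, hw, hyw, hwc, β, hβ⟩ : ∃ w : E, ‖w‖ = 1 ∧ inner ℝ y w = 0 ∧ inner ℝ w c = 0 ∧
        ∃ β : ℝ, 0 ≤ β ∧ z = inner ℝ y z • y + β • w := by
      have hyy : inner ℝ y y = (1 : ℝ) := by rw [real_inner_self_eq_norm_sq, hy, one_pow]
      by_cases h0 : z - inner ℝ y z • y = 0
      · obtain ⟨w, hw, h1, h2⟩ := exists_ne_zero_orthogonal_pair (E := E) (by omega) y c
        refine ⟨‖w‖⁻¹ • w, ?_, ?_, ?_, 0, le_rfl, ?_⟩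
        · rw [norm_smul, norm_inv, norm_norm, inv_mul_cancel₀ (norm_ne_zero_iff.2 hw)]
        · rw [real_inner_smul_right, h1, mul_zero]
        · rw [real_inner_smul_left, real_inner_comm, h2, mul_zero]
        · rw [zero_smul, add_zero]
          exact sub_eq_zero.1 h0
      · refine ⟨‖z - inner ℝ y z • y‖⁻¹ • (z - inner ℝ y z • y), ?_, ?_, ?_,
          ‖z - inner ℝ y z • y‖, norm_nonneg _, ?_⟩
        · rw [norm_smul, norm_inv, norm_norm, inv_mul_cancel₀ (norm_ne_zero_iff.2 h0)]
        · rw [real_inner_smul_right, inner_sub_right, real_inner_smul_right, hyy]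
          ring
        · rw [real_inner_smul_left, inner_sub_left, real_inner_smul_left, hzc, hyc]
          ring
        · rw [smul_inv_smul₀ (norm_ne_zero_iff.2 h0)]
          abel
    obtain ⟨hβ0, hz'⟩ := hβ
    have h1 : inner ℝ y z ^ 2 + β ^ 2 = 1 := by
      have h2 : ‖z‖ ^ 2 = 1 := by rw [hz, one_pow]
      rw [hz', ← real_inner_self_eq_norm_sq] at h2
      have hwy : inner ℝ w y = (0 : ℝ) := by rw [real_inner_comm, hyw]
      have hyy : inner ℝ y y = (1 : ℝ) := by rw [real_inner_self_eq_norm_sq, hy, one_pow]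
      have hww : inner ℝ w w = (1 : ℝ) := by rw [real_inner_self_eq_norm_sq, hw, one_pow]
      generalize inner ℝ y z = α at h2 ⊢
      simp only [inner_add_left, inner_add_right, real_inner_smul_left, real_inner_smul_right,
        hyw, hwy, hyy, hww] at h2
      linarith
    have h2 : Real.cos (Real.arccos (inner ℝ y z)) = inner ℝ y z :=
      Real.cos_arccos (by nlinarith) (by nlinarith)
    have h3 : Real.sin (Real.arccos (inner ℝ y z)) = β := by
      rw [Real.sin_arccos, ← h1, add_sub_cancel_left, Real.sqrt_sq hβ0]
    have h4 := hrot y w hyc hwc hy hw hyw (Real.arccos (inner ℝ y z))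
    rwa [h2, h3, ← hz'] at h4
  obtain ⟨A, hA⟩ := exists_linearIsometry_orthogonal (V := V) hd c
  have : Nontrivial V := Module.nontrivial_of_finrank_pos (R := ℝ) (by omega)
  obtain ⟨v, hv⟩ := exists_norm_eq V zero_le_one
  have hl : 0 < gauge B (A v) := hB.gauge_pos fun h => by
    rw [← A.norm_map, h, norm_zero] at hv
    exact zero_ne_one hv
  have hg : ∀ u, gauge B (A u) = ‖u‖ * gauge B (A v) := fun u => by
    rcases eq_or_ne u 0 with rfl | hu
    · simp
    have h1 := hsphere (A v) (A (‖u‖⁻¹ • u)) (hA _) (hA _) (by rw [A.norm_map, hv])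
      (by rw [A.norm_map, norm_smul, norm_inv, norm_norm, inv_mul_cancel₀ (norm_ne_zero_iff.2 hu)])
    rw [← h1, map_smul, gauge_smul_of_nonneg (by positivity), smul_eq_mul,
      mul_inv_cancel_left₀ (norm_ne_zero_iff.2 hu)]
  have hball : A ⁻¹' B = closedBall 0 (gauge B (A v))⁻¹ := by
    ext u
    rw [Set.mem_preimage, ← hB.gauge_le_one_iff, hg, mem_closedBall_zero_iff, inv_eq_one_div,
      le_div_iff₀ hl]
  exact eq_closedBall_of_sections hd (by omega) hB (hsim.exists_eq_closedBall hball)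

end NonzeroCenter

end SimilarSections

namespace SimilarSections

open Filter Topology MeasureTheory

section Peak

variable {X : Type*} [TopologicalSpace X] [CompactSpace X] [MeasurableSpace X] [BorelSpace X]

theorem integral_mul_polynomial_eq_zero {μ : Measure X} [IsFiniteMeasure μ] {g s : X → ℝ}
    (hg : Continuous g) (hs : Continuous s) (h : ∀ k : ℕ, ∫ x, g x * s x ^ k ∂μ = 0)
    (p : Polynomial ℝ) : ∫ x, g x * p.eval (s x) ∂μ = 0 := by
  have hInt : ∀ f : X → ℝ, Continuous f → Integrable f μ := fun f hf =>
    hf.integrable_of_hasCompactSupport (HasCompactSupport.of_compactSpace f)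
  induction p using Polynomial.induction_on' with
  | add p q hp hq =>
    simp only [Polynomial.eval_add, mul_add]
    rw [integral_add (hInt _ (by fun_prop)) (hInt _ (by fun_prop)), hp, hq, add_zero]
  | monomial k c =>
    simp only [Polynomial.eval_monomial]
    have : ∀ x, g x * (c * s x ^ k) = c * (g x * s x ^ k) := fun x => by ring
    simp only [this]
    rw [integral_const_mul, h, mul_zero]

/-- If all moments of `g` against `s` vanish, then `g` cannot be positive on the zero set of `s`. -/
theorem exists_nonpos_of_moments_eq_zero {μ : Measure X} [IsFiniteMeasure μ] [μ.IsOpenPosMeasure]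
    {g s : X → ℝ} (hg : Continuous g) (hs : Continuous s) (hs0 : ∀ x, 0 ≤ s x)
    (h : ∀ k : ℕ, ∫ x, g x * s x ^ k ∂μ = 0) {x₀ : X} (hx₀ : s x₀ = 0) :
    ∃ x, s x = 0 ∧ g x ≤ 0 := by
  by_contra! hpos
  have hInt : ∀ f : X → ℝ, Continuous f → Integrable f μ := fun f hf =>
    hf.integrable_of_hasCompactSupport (HasCompactSupport.of_compactSpace f)
  obtain ⟨δ, hδ, hδg⟩ : ∃ δ : ℝ, 0 < δ ∧ ∀ x, s x < δ → 0 < g x := by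
    have hK : IsCompact {x | g x ≤ 0} := (isClosed_le hg continuous_const).isCompact
    rcases {x | g x ≤ 0}.eq_empty_or_nonempty with he | hne
    · refine ⟨1, one_pos, fun x _ => ?_⟩
      by_contra! hx
      exact (he ▸ (show x ∈ {x | g x ≤ 0} from hx) : x ∈ (∅ : Set X))
    · obtain ⟨y, hy, hmin⟩ := hK.exists_isMinOn hne hs.continuousOn
      refine ⟨s y, (hs0 y).lt_of_ne' fun h0 => (hpos y h0).not_ge hy, fun x hx => ?_⟩
      by_contra! hgx
      exact (hmin hgx).not_gt hx
  set φ : ℝ → ℝ := fun t => max 0 (δ - t) with hφ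
  have hφc : Continuous φ := by fun_prop
  have hcont : Continuous fun x => g x * φ (s x) := hg.mul (hφc.comp hs)
  have hI : 0 < ∫ x, g x * φ (s x) ∂μ := by
    refine hcont.integral_pos_of_hasCompactSupport_nonneg_nonzero
      (HasCompactSupport.of_compactSpace _) (fun x => ?_) (x := x₀) ?_
    · change 0 ≤ g x * φ (s x)
      rcases lt_or_ge (s x) δ with hx | hx
      · exact mul_nonneg (hδg x hx).le (le_max_left _ _)
      · have : φ (s x) = 0 := max_eq_left (by linarith)
        rw [this, mul_zero]
    · have : φ (s x₀) = δ := by rw [hφ, hx₀]; simpa using hδ.le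
      rw [this]
      exact mul_ne_zero (hpos x₀ hx₀).ne' hδ.ne'
  obtain ⟨b, hb⟩ : ∃ b, ∀ x, s x ≤ b := by
    obtain ⟨b, hb⟩ := (isCompact_range hs).bddAbove
    exact ⟨b, fun x => hb ⟨x, rfl⟩⟩
  set J := ∫ x, |g x| ∂μ with hJ
  have hJ0 : 0 ≤ J := integral_nonneg fun x => abs_nonneg _
  obtain ⟨p, hp⟩ := exists_polynomial_near_of_continuousOn 0 b φ hφc.continuousOn
    ((∫ x, g x * φ (s x) ∂μ) / (J + 1)) (by positivity)
  have hpI := integral_mul_polynomial_eq_zero hg hs h p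
  have hpc : Continuous fun x => g x * p.eval (s x) := hg.mul (p.continuous.comp hs)
  have hle : ∫ x, g x * φ (s x) ∂μ ≤ ∫ x, g x * p.eval (s x) + |g x| *
      ((∫ x, g x * φ (s x) ∂μ) / (J + 1)) ∂μ := by
    refine integral_mono (hInt _ hcont) (hInt _ (hpc.add (hg.abs.mul continuous_const))) fun x => ?_
    have h1 := hp (s x) ⟨hs0 x, hb x⟩
    have h2 : g x * φ (s x) - g x * p.eval (s x) ≤ |g x| * |p.eval (s x) - φ (s x)| := by
      rw [← mul_sub, abs_sub_comm, ← abs_mul]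
      exact le_abs_self _
    have h3 := mul_le_mul_of_nonneg_left h1.le (abs_nonneg (g x))
    simp only
    linarith
  rw [integral_add (hInt _ hpc) (hInt (fun x => |g x| * _) (hg.abs.mul continuous_const)), hpI, zero_add,
    integral_mul_const, ← hJ, mul_div_assoc', le_div_iff₀ (by linarith)] at hle
  nlinarith

end Peak

section Radial

variable {V : Type*} [NormedAddCommGroup V] [InnerProductSpace ℝ V] [FiniteDimensional ℝ V]

theorem exists_isometryEquiv_apply_eq {x y : V} (h : ‖x‖ = ‖y‖) : ∃ O : V ≃ₗᵢ[ℝ] V, O x = y :=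
  ⟨_, Submodule.reflection_sub h⟩

variable [MeasurableSpace V] [BorelSpace V]

/-- A radial weight with compact support. -/
noncomputable def cone (x : V) : ℝ := max 0 (1 - ‖x‖)

omit [FiniteDimensional ℝ V] [MeasurableSpace V] [BorelSpace V] [InnerProductSpace ℝ V] in
theorem continuous_cone : Continuous (cone : V → ℝ) := by
  unfold cone
  fun_prop

omit [FiniteDimensional ℝ V] [MeasurableSpace V] [BorelSpace V] [InnerProductSpace ℝ V] in
theorem cone_nonneg (x : V) : 0 ≤ cone x := le_max_left _ _

omit [FiniteDimensional ℝ V] [MeasurableSpace V] [BorelSpace V] [InnerProductSpace ℝ V] in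
theorem cone_eq_zero {x : V} (h : 1 < ‖x‖) : cone x = 0 := max_eq_left (by linarith)

omit [FiniteDimensional ℝ V] [MeasurableSpace V] [BorelSpace V] in
theorem cone_isometryEquiv (O : V ≃ₗᵢ[ℝ] V) (x : V) : cone (O x) = cone x := by
  rw [cone, O.norm_map, cone]

omit [MeasurableSpace V] [BorelSpace V] in
theorem hasCompactSupport_cone_mul (f : V → ℝ) :
    HasCompactSupport fun x => cone x * f x := by
  refine HasCompactSupport.intro (isCompact_closedBall (0 : V) 1) fun x hx => ?_
  rw [mem_closedBall_zero_iff, not_le] at hx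
  rw [cone_eq_zero hx, zero_mul]

theorem integrable_cone_mul {f : V → ℝ} (hf : Continuous f) :
    Integrable fun x => cone x * f x :=
  (continuous_cone.mul hf).integrable_of_hasCompactSupport (hasCompactSupport_cone_mul f)

theorem integral_cone_mul_pos {f : V → ℝ} (hf : Continuous f) (h0 : ∀ x, 0 ≤ f x) {v : V}
    (hv : ‖v‖ < 1) (hfv : f v ≠ 0) : 0 < ∫ x, cone x * f x := by
  refine (continuous_cone.mul hf).integral_pos_of_hasCompactSupport_nonneg_nonzero
    (hasCompactSupport_cone_mul f) (fun x => mul_nonneg (cone_nonneg x) (h0 x)) (x := v)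
    (mul_ne_zero ?_ hfv)
  have : 0 < 1 - ‖v‖ := by linarith
  exact (this.trans_le (le_max_right _ _)).ne'

theorem integral_cone_mul_norm_pos [Nontrivial V] : 0 < ∫ x : V, cone x * ‖x‖ := by
  obtain ⟨v, hv⟩ := exists_norm_eq V (show (0 : ℝ) ≤ 1 / 2 by norm_num)
  exact integral_cone_mul_pos continuous_norm (fun x => norm_nonneg x) (v := v)
    (by rw [hv]; norm_num) (by rw [hv]; norm_num)

/-- The even moments of a radial weight. -/
theorem exists_integral_cone_mul_inner_pow [Nontrivial V] (k : ℕ) : ∃ C : ℝ, 0 < C ∧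
    ∀ u : V, ∫ y, cone y * (inner ℝ y u) ^ (2 * k) = C * (‖u‖ ^ 2) ^ k := by
  obtain ⟨v, hv⟩ := exists_norm_eq V zero_le_one
  refine ⟨∫ y, cone y * (inner ℝ y v) ^ (2 * k), ?_, fun u => ?_⟩
  · refine integral_cone_mul_pos (by fun_prop) (fun x => ?_) (v := (1 / 2 : ℝ) • v) ?_ ?_
    · rw [pow_mul]
      positivity
    · rw [norm_smul, hv]
      norm_num
    · rw [real_inner_smul_left, real_inner_self_eq_norm_sq, hv]
      positivity
  · obtain ⟨O, hO⟩ := exists_isometryEquiv_apply_eq (x := u) (y := ‖u‖ • v)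
      (by rw [norm_smul, hv, norm_norm, mul_one])
    have h1 := O.measurePreserving.integral_comp O.toHomeomorph.measurableEmbedding
      fun y => cone y * (inner ℝ y (‖u‖ • v)) ^ (2 * k)
    simp only [← hO, cone_isometryEquiv, O.inner_map_map] at h1
    rw [h1, ← integral_mul_const]
    congr 1 with y
    rw [hO, real_inner_smul_right, mul_pow, pow_mul ‖u‖]
    ring

end Radial

end SimilarSections

namespace SimilarSections

open Filter Topology MeasureTheory

section Funk

variable {E V : Type*} [NormedAddCommGroup E] [InnerProductSpace ℝ E] [FiniteDimensional ℝ E]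
  [CompleteSpace E] [NormedAddCommGroup V] [InnerProductSpace ℝ V] [FiniteDimensional ℝ V]

instance compactSpace_unitary : CompactSpace (unitary (E →L[ℝ] E)) := by
  refine (isCompact_iff_compactSpace (s := (unitary (E →L[ℝ] E) : Set (E →L[ℝ] E)))).1 ?_
  have : ProperSpace (E →L[ℝ] E) := FiniteDimensional.proper ℝ _
  refine Metric.isCompact_of_isClosed_isBounded isClosed_unitary ?_
  refine Metric.isBounded_closedBall (x := (0 : E →L[ℝ] E)) (r := 1) |>.subset fun U hU => ?_
  rw [mem_closedBall_zero_iff]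
  refine ContinuousLinearMap.opNorm_le_bound _ zero_le_one fun x => ?_
  rw [one_mul]
  exact (Unitary.norm_map ⟨U, hU⟩ x).le

omit [FiniteDimensional ℝ E] in
theorem exists_unitary_apply_eq (O : E ≃ₗᵢ[ℝ] E) : ∃ U : unitary (E →L[ℝ] E),
    ∀ x, (U : E →L[ℝ] E) x = O x :=
  ⟨Unitary.linearIsometryEquiv.symm O, fun x => by
    rw [Unitary.coe_symm_linearIsometryEquiv_apply]; rfl⟩

variable [MeasurableSpace V] [BorelSpace V]
  [MeasurableSpace (unitary (E →L[ℝ] E))] [BorelSpace (unitary (E →L[ℝ] E))]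

theorem integral_swap_cone {μ : Measure (unitary (E →L[ℝ] E))} [IsFiniteMeasure μ]
    {f : V → unitary (E →L[ℝ] E) → ℝ} (hf : Continuous (Function.uncurry f)) :
    ∫ x, cone x * ∫ U, f x U ∂μ = ∫ U, (∫ x, cone x * f x U) ∂μ := by
  simp only [← integral_const_mul]
  refine integral_integral_swap_of_hasCompactSupport (f := fun x U => cone x * f x U)
    ((continuous_cone.comp continuous_fst).mul hf) ?_
  refine HasCompactSupport.intro ((isCompact_closedBall (0 : V) 1).prod isCompact_univ)
    fun p hp => ?_
  have h1 : 1 < ‖p.1‖ := by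
    by_contra! h
    exact hp ⟨mem_closedBall_zero_iff.2 h, trivial⟩
  simp only [Function.uncurry, cone_eq_zero h1, zero_mul]

variable {μ : Measure (unitary (E →L[ℝ] E))} [IsFiniteMeasure μ] [μ.IsMulRightInvariant]

theorem integral_apply_mul_eq_zero [Nontrivial V] {G : E → ℝ} (hG : Continuous G)
    (hGr : ∀ (r : ℝ) x, 0 ≤ r → G (r • x) = r * G x)
    (hGA : ∀ A : V →ₗᵢ[ℝ] E, ∫ x, cone x * G (A x) = 0) {χ : ℝ → ℝ} (hχ : Continuous χ)
    (A : V →ₗᵢ[ℝ] E) {e : E} (hA : ∀ u, inner ℝ (A u) e = 0) (w : E) (v : V) :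
    ∫ U, G ((U : E →L[ℝ] E) (A v)) * χ (inner ℝ ((U : E →L[ℝ] E) e) w) ∂μ = 0 := by
  set F : V → ℝ := fun v =>
    ∫ U, G ((U : E →L[ℝ] E) (A v)) * χ (inner ℝ ((U : E →L[ℝ] E) e) w) ∂μ with hF
  have hinv : ∀ x y, ‖x‖ = ‖y‖ → F x = F y := fun x y hxy => by
    have hxy' : ‖A x‖ = ‖A y‖ := by rw [A.norm_map, A.norm_map, hxy]
    obtain ⟨T, hT⟩ := exists_unitary_apply_eq (hyperplaneReflection (A x - A y))
    have h1 : (T : E →L[ℝ] E) (A x) = A y := by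
      rw [hT]
      exact Submodule.reflection_sub hxy'
    have h2 : (T : E →L[ℝ] E) e = e := by
      rw [hT, hyperplaneReflection_apply, inner_sub_left, hA, hA]
      simp
    have h3 := integral_mul_right_eq_self (μ := μ)
      (fun U => G ((U : E →L[ℝ] E) (A x)) * χ (inner ℝ ((U : E →L[ℝ] E) e) w)) T
    simp only [Submonoid.coe_mul, ContinuousLinearMap.mul_apply, h1, h2] at h3
    exact h3.symm
  have hhom : ∀ (r : ℝ) x, 0 ≤ r → F (r • x) = r * F x := fun r x hr => by
    simp only [hF]
    rw [← integral_const_mul]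
    congr 1 with U
    rw [map_smul, map_smul, hGr _ _ hr, mul_assoc]
  obtain ⟨v₀, hv₀⟩ := exists_norm_eq V zero_le_one
  have hFv : ∀ x, F x = ‖x‖ * F v₀ := fun x => by
    rw [← hhom _ _ (norm_nonneg x)]
    exact hinv _ _ (by rw [norm_smul, hv₀, norm_norm, mul_one])
  have hc : Continuous (Function.uncurry fun (x : V) (U : unitary (E →L[ℝ] E)) =>
      G ((U : E →L[ℝ] E) (A x)) * χ (inner ℝ ((U : E →L[ℝ] E) e) w)) := by
    have := A.continuous
    simp only [Function.uncurry_def]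
    fun_prop
  have hz : ∫ x, cone x * F x = 0 := by
    simp only [hF]
    rw [integral_swap_cone hc]
    refine integral_eq_zero_of_ae (Eventually.of_forall fun U => ?_)
    have h1 := hGA ((Unitary.linearIsometryEquiv U).toLinearIsometry.comp A)
    have h2 : ∀ x, ((Unitary.linearIsometryEquiv U).toLinearIsometry.comp A) x =
        (U : E →L[ℝ] E) (A x) := fun x => rfl
    simp only [h2] at h1
    simp only [← mul_assoc, integral_mul_const, h1, zero_mul, Pi.zero_apply]
  have h0 : F v₀ = 0 := by
    have h1 : ∀ x, cone x * F x = cone x * ‖x‖ * F v₀ := fun x => by rw [hFv, mul_assoc]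
    rw [integral_congr_ae (Eventually.of_forall h1), integral_mul_const] at hz
    exact (mul_eq_zero.1 hz).resolve_left integral_cone_mul_norm_pos.ne'
  change F v = 0
  rw [hFv, h0, mul_zero]

theorem integral_apply_mul_pow_eq_zero (hd : Module.finrank ℝ E = Module.finrank ℝ V + 1)
    (hV : 2 ≤ Module.finrank ℝ V) {G : E → ℝ} (hG : Continuous G)
    (hGr : ∀ (r : ℝ) x, 0 ≤ r → G (r • x) = r * G x)
    (hGA : ∀ A : V →ₗᵢ[ℝ] E, ∫ x, cone x * G (A x) = 0) {a : E} (ha : ‖a‖ = 1) (k : ℕ) :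
    ∫ U, G ((U : E →L[ℝ] E) a) * (1 - inner ℝ ((U : E →L[ℝ] E) a) a ^ 2) ^ k ∂μ = 0 := by
  have : Nontrivial V := Module.nontrivial_of_finrank_pos (R := ℝ) (by omega)
  have ha0 : a ≠ 0 := by
    rintro rfl
    simp at ha
  obtain ⟨A, hA⟩ := exists_linearIsometry_orthogonal (V := V) hd a
  have h1 : ∀ y : V, ∫ U, G ((U : E →L[ℝ] E) a) *
      (inner ℝ ((U : E →L[ℝ] E) (A y)) a) ^ (2 * k) ∂μ = 0 := fun y => by
    obtain ⟨z, hz0, hza, hz⟩ : ∃ z : E, z ≠ 0 ∧ inner ℝ a z = 0 ∧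
        ∀ x, inner ℝ x z = 0 → inner ℝ x (A y) = 0 := by
      by_cases hy : A y = 0
      · obtain ⟨z, hz, hz1, -⟩ := exists_ne_zero_orthogonal_pair (by omega) a (0 : E)
        exact ⟨z, hz, hz1, fun x _ => by rw [hy, inner_zero_right]⟩
      · exact ⟨A y, hy, by rw [real_inner_comm, hA], fun x hx => hx⟩
    obtain ⟨A', hA'⟩ := exists_linearIsometry_orthogonal (V := V) hd z
    obtain ⟨v, hv⟩ := exists_apply_eq hd A' hz0 hA' hza
    have := integral_apply_mul_eq_zero (μ := μ) hG hGr hGA (continuous_pow (2 * k)) A'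
      (fun u => hz _ (hA' u)) a v
    rwa [hv] at this
  obtain ⟨C, hC, hCu⟩ := exists_integral_cone_mul_inner_pow (V := V) k
  have hc : Continuous (Function.uncurry fun (y : V) (U : unitary (E →L[ℝ] E)) =>
      G ((U : E →L[ℝ] E) a) * (inner ℝ ((U : E →L[ℝ] E) (A y)) a) ^ (2 * k)) := by
    have := A.continuous
    simp only [Function.uncurry_def]
    fun_prop
  have h2 := integral_swap_cone (μ := μ) hc
  simp only [h1, mul_zero, integral_zero] at h2
  have h3 : ∀ U : unitary (E →L[ℝ] E), ∫ y, cone y * (G ((U : E →L[ℝ] E) a) *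
      (inner ℝ ((U : E →L[ℝ] E) (A y)) a) ^ (2 * k)) =
      C * (G ((U : E →L[ℝ] E) a) * (1 - inner ℝ ((U : E →L[ℝ] E) a) a ^ 2) ^ k) := fun U => by
    obtain ⟨b, hb⟩ : ∃ b, (U : E →L[ℝ] E) b = a :=
      ⟨(Unitary.linearIsometryEquiv U).symm a, (Unitary.linearIsometryEquiv U).apply_symm_apply a⟩
    have hb1 : ‖b‖ = 1 := by rw [← Unitary.norm_map U, hb, ha]
    set t := inner ℝ b a with ht
    have hta : inner ℝ ((U : E →L[ℝ] E) a) a = t := by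
      have h4 := Unitary.inner_map_map (𝕜 := ℝ) U a b
      rwa [hb, real_inner_comm b a] at h4
    obtain ⟨u, hu⟩ := exists_apply_eq hd A ha0 hA (x := b - t • a) (by
      rw [inner_sub_left, real_inner_smul_left, real_inner_self_eq_norm_sq, ha, ← ht]
      ring)
    have hun : ‖u‖ ^ 2 = 1 - t ^ 2 := by
      rw [← A.norm_map, hu, norm_sub_sq_real, real_inner_smul_right, norm_smul, hb1, ha, ← ht,
        Real.norm_eq_abs, mul_one, sq_abs]
      ring
    have hin : ∀ y, inner ℝ ((U : E →L[ℝ] E) (A y)) a = inner ℝ y u := fun y => by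
      have hb2 : b = A u + t • a := by rw [hu, sub_add_cancel]
      conv_lhs => rw [← hb]
      rw [Unitary.inner_map_map, hb2, inner_add_right, A.inner_map_map, real_inner_smul_right, hA,
        mul_zero, add_zero]
    rw [hta, ← hun]
    simp only [hin]
    have h4 : ∀ y : V, cone y * (G ((U : E →L[ℝ] E) a) * (inner ℝ y u) ^ (2 * k)) =
        G ((U : E →L[ℝ] E) a) * (cone y * (inner ℝ y u) ^ (2 * k)) := fun y => by ring
    simp only [h4]
    rw [integral_const_mul, hCu]
    ring
  simp only [h3, integral_const_mul] at h2
  exact (mul_eq_zero.1 h2.symm).resolve_left hC.ne'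

theorem nonpos_of_integral_cone_eq_zero [μ.IsOpenPosMeasure]
    (hd : Module.finrank ℝ E = Module.finrank ℝ V + 1)
    (hV : 2 ≤ Module.finrank ℝ V) {G : E → ℝ} (hG : Continuous G)
    (hGr : ∀ (r : ℝ) x, 0 ≤ r → G (r • x) = r * G x) (hGe : ∀ x, G (-x) = G x)
    (hGA : ∀ A : V →ₗᵢ[ℝ] E, ∫ x, cone x * G (A x) = 0) {a : E} (ha : ‖a‖ = 1) : G a ≤ 0 := by
  obtain ⟨U, hU, hGU⟩ := exists_nonpos_of_moments_eq_zero (μ := μ)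
    (g := fun U => G ((U : E →L[ℝ] E) a))
    (s := fun U => 1 - inner ℝ ((U : E →L[ℝ] E) a) a ^ 2) (by fun_prop) (by fun_prop)
    (fun U => by
      have h1 := abs_real_inner_le_norm ((U : E →L[ℝ] E) a) a
      rw [Unitary.norm_map, ha, mul_one] at h1
      have := (sq_le_one_iff_abs_le_one _).2 h1
      linarith)
    (integral_apply_mul_pow_eq_zero hd hV hG hGr hGA ha) (x₀ := 1) (by simp [ha])
  have h1 : inner ℝ ((U : E →L[ℝ] E) a) a = 1 ∨ inner ℝ ((U : E →L[ℝ] E) a) a = -1 :=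
    sq_eq_one_iff.1 (by linarith)
  have hUa : ‖(U : E →L[ℝ] E) a‖ = 1 := by rw [Unitary.norm_map, ha]
  rcases h1 with h1 | h1
  · rwa [(inner_eq_one_iff_of_norm_eq_one hUa ha).1 h1] at hGU
  · replace h1 : inner ℝ ((U : E →L[ℝ] E) a) (-a) = 1 := by rw [inner_neg_right, h1, neg_neg]
    rwa [(inner_eq_one_iff_of_norm_eq_one hUa (by rwa [norm_neg])).1 h1, hGe] at hGU

omit [MeasurableSpace (unitary (E →L[ℝ] E))] [BorelSpace (unitary (E →L[ℝ] E))]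
  [CompleteSpace E] in
/-- Injectivity of the Funk transform for homogeneous even functions. -/
theorem eq_zero_of_integral_cone_eq_zero (hd : Module.finrank ℝ E = Module.finrank ℝ V + 1)
    (hV : 2 ≤ Module.finrank ℝ V) {G : E → ℝ} (hG : Continuous G)
    (hGr : ∀ (r : ℝ) x, 0 ≤ r → G (r • x) = r * G x) (hGe : ∀ x, G (-x) = G x)
    (hGA : ∀ A : V →ₗᵢ[ℝ] E, ∫ x, cone x * G (A x) = 0) (x : E) : G x = 0 := by
  have : CompleteSpace E := FiniteDimensional.complete ℝ E
  let _ : MeasurableSpace (unitary (E →L[ℝ] E)) := borel _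
  have : BorelSpace (unitary (E →L[ℝ] E)) := ⟨rfl⟩
  let μ : Measure (unitary (E →L[ℝ] E)) := (Measure.haar).inv
  have h1 : ∀ a : E, ‖a‖ = 1 → G a = 0 := fun a ha => by
    refine le_antisymm (nonpos_of_integral_cone_eq_zero (μ := μ) hd hV hG hGr hGe hGA ha) ?_
    have := nonpos_of_integral_cone_eq_zero (μ := μ) hd hV (G := fun x => -G x) hG.neg
      (fun r x hr => by rw [hGr r x hr]; ring) (fun x => by rw [hGe])
      (fun A => by simp only [mul_neg, integral_neg, hGA A, neg_zero]) ha
    linarith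
  rcases eq_or_ne x 0 with rfl | hx
  · simpa using hGr 0 0 le_rfl
  · have hx' : ‖x‖ ≠ 0 := norm_ne_zero_iff.2 hx
    have h2 := hGr ‖x‖ (‖x‖⁻¹ • x) (norm_nonneg x)
    rwa [smul_smul, mul_inv_cancel₀ hx', one_smul, h1 (‖x‖⁻¹ • x) (by
      rw [norm_smul, norm_inv, norm_norm, inv_mul_cancel₀ hx']), mul_zero] at h2

end Funk

end SimilarSections

namespace SimilarSections

open Filter Topology MeasureTheory

section Assembly

variable {E V : Type*} [NormedAddCommGroup E] [InnerProductSpace ℝ E] [FiniteDimensional ℝ E]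
  [NormedAddCommGroup V] [InnerProductSpace ℝ V] [FiniteDimensional ℝ V]
  [MeasurableSpace V] [BorelSpace V]

/-- A symmetric body all of whose sections by hyperplanes through the origin are congruent is a
ball. -/
theorem eq_closedBall_of_center_zero (hd : Module.finrank ℝ E = Module.finrank ℝ V + 1)
    (hV : 2 ≤ Module.finrank ℝ V) {B : Set E} {ρ R : ℝ} (hB : IsBody B ρ R)
    (hc : IsCenter B 0) {A₁ : V →ₗᵢ[ℝ] E}
    (hA₁ : ∀ A : V →ₗᵢ[ℝ] E, ∃ O : V ≃ₗᵢ[ℝ] V, ∀ x, A₁ x ∈ B ↔ A (O x) ∈ B) :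
    ∃ c r, 0 < r ∧ B = closedBall c r := by
  have : Nontrivial V := Module.nontrivial_of_finrank_pos (R := ℝ) (by omega)
  have hGr : ∀ (r : ℝ) x, 0 ≤ r → gauge B (r • x) = r * gauge B x := fun r x hr =>
    gauge_smul_of_nonneg hr x
  have hmem : ∀ x y : E, gauge B x = gauge B y ↔ ∀ r : ℝ, 0 < r → (r • x ∈ B ↔ r • y ∈ B) := by
    intro x y
    refine ⟨fun h r hr => ?_, fun h => ?_⟩
    · rw [← hB.gauge_le_one_iff, ← hB.gauge_le_one_iff, hGr _ _ hr.le, hGr _ _ hr.le, h]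
    · have key : ∀ x y : E, (∀ r : ℝ, 0 < r → (r • x ∈ B ↔ r • y ∈ B)) →
          gauge B x ≤ gauge B y := fun x y h => by
        refine le_of_forall_pos_le_add fun ε hε => ?_
        have hp : 0 < gauge B y + ε := by linarith [gauge_nonneg (s := B) y]
        have h1 := (h _ (inv_pos.2 hp)).2 (hB.gauge_le_one_iff.1 (by
          rw [hGr _ _ (inv_pos.2 hp).le, inv_mul_le_one₀ hp]; linarith))
        rw [← hB.gauge_le_one_iff, hGr _ _ (inv_pos.2 hp).le, inv_mul_le_one₀ hp] at h1
        exact h1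
      exact le_antisymm (key x y h) (key y x fun r hr => (h r hr).symm)
  have hn := integral_cone_mul_norm_pos (V := V)
  have hg := hB.continuous_gauge
  set κ := (∫ x : V, cone x * gauge B (A₁ x)) / ∫ x : V, cone x * ‖x‖ with hκ
  have hG0 := eq_zero_of_integral_cone_eq_zero hd hV (G := fun x => gauge B x - κ * ‖x‖)
    (by fun_prop) (fun r x hr => by rw [hGr r x hr, norm_smul, Real.norm_of_nonneg hr]; ring)
    (fun x => by
      rw [norm_neg, (hmem (-x) x).2 fun r _ => ?_]
      rw [smul_neg]
      refine ⟨fun h => ?_, fun h => ?_⟩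
      · simpa using hc _ h
      · simpa using hc _ h)
    (fun A => by
      obtain ⟨O, hO⟩ := hA₁ A
      have h1 := O.measurePreserving.integral_comp O.toHomeomorph.measurableEmbedding
        fun x => cone x * gauge B (A x)
      have h2 : ∀ x, gauge B (A (O x)) = gauge B (A₁ x) := fun x =>
        (hmem _ _).2 fun r _ => by
          rw [← map_smul, ← map_smul, ← map_smul, ← hO]
      simp only [cone_isometryEquiv, h2] at h1
      have hi : Integrable fun x : V => cone x * gauge B (A x) :=
        integrable_cone_mul (hg.comp A.continuous)
      have hj : Integrable fun x : V => cone x * ‖x‖ * κ :=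
        (integrable_cone_mul continuous_norm).mul_const κ
      have h3 : ∀ x : V, cone x * (gauge B (A x) - κ * ‖A x‖) =
          cone x * gauge B (A x) - cone x * ‖x‖ * κ := fun x => by
        rw [A.norm_map]; ring
      simp only [h3]
      rw [integral_sub hi hj, integral_mul_const, ← h1, hκ, mul_div_cancel₀ _ hn.ne', sub_self])
  have hG : ∀ x, gauge B x = κ * ‖x‖ := fun x => sub_eq_zero.1 (hG0 x)
  obtain ⟨v, hv⟩ := exists_norm_eq V zero_le_one
  have hκ0 : 0 < κ := by
    have h1 : ‖A₁ v‖ = 1 := by rw [A₁.norm_map, hv]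
    have h2 := hB.gauge_pos (x := A₁ v) (norm_ne_zero_iff.1 (by rw [h1]; exact one_ne_zero))
    rwa [hG, h1, mul_one] at h2
  refine ⟨0, κ⁻¹, inv_pos.2 hκ0, ?_⟩
  ext x
  rw [← hB.gauge_le_one_iff, hG, mem_closedBall_zero_iff, ← one_div, le_div_iff₀ hκ0, mul_comm]

theorem eq_closedBall_of_similarPreimages (hd : Module.finrank ℝ E = Module.finrank ℝ V + 1)
    (hV : 2 ≤ Module.finrank ℝ V) {B : Set E} {ρ R : ℝ} (hB : IsBody B ρ R)
    (hs : SimilarPreimages V B) : ∃ c r, 0 < r ∧ B = closedBall c r := by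
  have : Nontrivial V := Module.nontrivial_of_finrank_pos (R := ℝ) (by omega)
  rcases Nat.even_or_odd (Module.finrank ℝ V) with he | ho
  · exact eq_closedBall_of_sections hd hV hB fun A =>
      exists_preimage_eq_closedBall_of_odd hd (hd ▸ he.add_one) hB hs A
  have hV3 : 3 ≤ Module.finrank ℝ V := by
    obtain ⟨k, hk⟩ := ho
    omega
  have hc : ∀ A : V →ₗᵢ[ℝ] E, ∃ p, IsCenter (A ⁻¹' B) p := fun A => by
    obtain ⟨b, hb⟩ := exists_sub_mem_preimage hd hB hs A
    refine ⟨(1 / 2 : ℝ) • b, fun x hx => ?_⟩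
    rw [smul_smul]
    have := hb x hx
    norm_num
    simpa using this
  obtain ⟨c, m, -, hBc, A₁, p₁, hp₁, h⟩ := exists_center_of_sections hd hV3 hB hs hc
  rcases eq_or_ne c 0 with rfl | hc0
  · have hp0 : p₁ = 0 := A₁.injective (by rw [hp₁, map_zero])
    subst hp0
    refine eq_closedBall_of_center_zero hd hV hB hBc (A₁ := A₁) fun A => ?_
    obtain ⟨r, hr0, hr1, hr, O, hO⟩ := h A 0 (hBc.preimage (map_zero A))
    have hr' : r = 1 := by
      refine le_antisymm hr1 ?_
      have h2 : (1 : ℝ) ≤ r ^ 2 := by simpa using hr 0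
      nlinarith
    refine ⟨O, fun x => ?_⟩
    have := hO x
    simpa [hr'] using this
  · exact eq_closedBall_of_center_ne_zero hd hV3 hB hs hBc hc0 hc h

omit [FiniteDimensional ℝ E] [MeasurableSpace V] [BorelSpace V] in
theorem similarPreimages_of_similar_sections {B : Set E} {ρ R : ℝ} (hB : IsBody B ρ R)
    (hsec : ∀ H₁ H₂ : Submodule ℝ E, Module.finrank ℝ H₁ = Module.finrank ℝ V →
      Module.finrank ℝ H₂ = Module.finrank ℝ V → ∃ f : E ≃ᵃ[ℝ] E,
        (∃ r : ℝ, 0 < r ∧ ∀ x y, dist (f x) (f y) = r * dist x y) ∧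
          f '' (B ∩ (H₁ : Set E)) = B ∩ (H₂ : Set E)) : SimilarPreimages V B := by
  intro A A'
  obtain ⟨f, ⟨r, hr, hf⟩, himg⟩ := hsec (LinearMap.range A.toLinearMap)
    (LinearMap.range A'.toLinearMap) (LinearMap.finrank_range_of_inj A.injective)
    (LinearMap.finrank_range_of_inj A'.injective)
  have hlin : ∀ x, f x = f.linear x + f 0 := fun x => by
    have := f.map_vadd 0 x
    simpa using this
  have hnorm : ∀ x, ‖f.linear x‖ = r * ‖x‖ := fun x => by
    have := hf x 0
    rwa [dist_eq_norm, dist_zero_right, hlin x, add_sub_cancel_right] at this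
  have hmap : ∀ u, A u ∈ B → ∃ v, A' v = f (A u) := fun u hu => by
    have h1 : f (A u) ∈ f '' (B ∩ (LinearMap.range A.toLinearMap : Set E)) :=
      ⟨A u, ⟨hu, u, rfl⟩, rfl⟩
    rw [himg] at h1
    exact h1.2
  have h0 : A 0 ∈ B := by
    rw [map_zero]
    exact hB.subset (by simp [hB.pos.le])
  obtain ⟨c, hc⟩ := hmap 0 h0
  rw [map_zero] at hc
  have hk : ∀ u, ∃ v, A' v = r⁻¹ • f.linear (A u) := fun u => by
    have hpos : 0 < ρ / (‖u‖ + 1) := div_pos hB.pos (by positivity)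
    obtain ⟨v, hv⟩ := hmap ((ρ / (‖u‖ + 1)) • u) (hB.subset (by
      rw [mem_closedBall_zero_iff, A.norm_map, norm_smul, Real.norm_of_nonneg hpos.le,
        div_mul_eq_mul_div, div_le_iff₀ (by positivity)]
      nlinarith [hB.pos, norm_nonneg u]))
    refine ⟨r⁻¹ • (ρ / (‖u‖ + 1))⁻¹ • (v - c), ?_⟩
    rw [map_smul, map_smul, map_sub, hv, hc, hlin, add_sub_cancel_right, map_smul, map_smul,
      inv_smul_smul₀ hpos.ne']
  choose k hk using hk
  let kl : V →ₗᵢ[ℝ] V :=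
    { toFun := k
      map_add' := fun x y => A'.injective (by simp [hk])
      map_smul' := fun c x => A'.injective (by simp [hk, smul_comm c])
      norm_map' := fun x => by
        change ‖k x‖ = ‖x‖
        rw [← A'.norm_map, hk, norm_smul, hnorm, A.norm_map, norm_inv,
          Real.norm_of_nonneg hr.le, inv_mul_cancel_left₀ hr.ne'] }
  have hkey : ∀ x, A' (r • k x + c) = f (A x) := fun x => by
    rw [map_add, map_smul, hk, smul_inv_smul₀ hr.ne', hc, ← hlin]
  refine ⟨r, hr, kl.toLinearIsometryEquiv rfl, c, ?_⟩
  ext y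
  constructor
  · intro hy
    have h1 : A' y ∈ B ∩ (LinearMap.range A'.toLinearMap : Set E) := ⟨hy, y, rfl⟩
    rw [← himg] at h1
    obtain ⟨_, ⟨hx, x, rfl⟩, hxy⟩ := h1
    exact ⟨x, hx, A'.injective ((hkey x).trans hxy)⟩
  · rintro ⟨x, hx, rfl⟩
    have h1 : f (A x) ∈ B ∩ (LinearMap.range A'.toLinearMap : Set E) :=
      himg ▸ ⟨A x, ⟨hx, x, rfl⟩, rfl⟩
    rw [← hkey] at h1
    exact h1.1

end Assembly

end SimilarSections

/-- if all hyperplane sections through the origin of a convex body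
`B ⊆ ℝ^{n+1}` are similar, then `B` is a closed Euclidean ball (not necessarily
centered at the origin). -/
theorem similar_central_sections_implies_ball
    (n : ℕ) (hn : 2 ≤ n)
    (B : Set (EuclideanSpace ℝ (Fin (n + 1))))
    (hBcompact : IsCompact B) (hBconv : Convex ℝ B)
    (hB0 : (0 : EuclideanSpace ℝ (Fin (n + 1))) ∈ interior B)
    (hsec : ∀ H₁ H₂ : Submodule ℝ (EuclideanSpace ℝ (Fin (n + 1))),
      Module.finrank ℝ H₁ = n → Module.finrank ℝ H₂ = n →
        ∃ f : EuclideanSpace ℝ (Fin (n + 1)) ≃ᵃ[ℝ] EuclideanSpace ℝ (Fin (n + 1)),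
          (∃ r : ℝ, 0 < r ∧ ∀ x y, dist (f x) (f y) = r * dist x y) ∧
          f '' (B ∩ (H₁ : Set (EuclideanSpace ℝ (Fin (n + 1))))) =
            B ∩ (H₂ : Set (EuclideanSpace ℝ (Fin (n + 1))))) :
    ∃ (c : EuclideanSpace ℝ (Fin (n + 1))) (r : ℝ), 0 < r ∧ B = closedBall c r := by
  obtain ⟨ρ, hρ, hρB⟩ := Metric.nhds_basis_closedBall.mem_iff.1 (mem_interior_iff_mem_nhds.1 hB0)
  obtain ⟨R, hR⟩ := hBcompact.isBounded.subset_closedBall 0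
  have hB : SimilarSections.IsBody B ρ R := ⟨hBcompact, hBconv, hρ, hρB, hR⟩
  refine SimilarSections.eq_closedBall_of_similarPreimages (V := EuclideanSpace ℝ (Fin n))
    (by simp) (by simpa using hn) hB
    (SimilarSections.similarPreimages_of_similar_sections hB fun H₁ H₂ h₁ h₂ => ?_)
  rw [finrank_euclideanSpace_fin] at h₁ h₂
  exact hsec H₁ H₂ h₁ h₂
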